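/- Let r ≥ p ≥ 2, k ≥ p, and let n be such that ⌈(p−1)n/r⌉ ≥ k. Set D = ⌈C(r,p−1) / ⌊r/(p−1)⌋⌉, where C(r,p−1) is the binomial coefficient. Then the strong (r,p) cover number of the complete k-uniform hypergraph satisfies the recurrence χ^c(K_n^k,k,r,p) ≤ D · χ^c(K_m^k,k,r,p) + 1, where m = ⌈(p−1)n/r⌉. (One balanced r-coloring properly (r,p) colors all hyperedges meeting at least p color classes; the remaining hyperedges lie in unions of p−1 color classes of total size at most m, and by Baranyai's theorem the (p−1)-element subsets of the r color classes can be partitioned into D parallel classes that are handled simultaneously.) -/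

import Mathlib

open Finset

/-- `E` (the hyperedge set of a hypergraph on vertex set `V`) has a strong `(r,p)` cover of
size `t`: there are `t` `r`-colorings of `V` such that every hyperedge receives at least `p`
distinct colors in at least one of them. -/
def HasStrongCover {V : Type*} [DecidableEq V] (E : Finset (Finset V)) (r p t : ℕ) : Prop :=
  ∃ χ : Fin t → V → Fin r, ∀ e ∈ E, ∃ i, p ≤ (e.image (χ i)).card

/-- The strong `(r,p)` cover number: minimum size of a strong `(r,p)` cover. -/
noncomputable def coverNumber {V : Type*} [DecidableEq V] (E : Finset (Finset V)) (r p : ℕ) : ℕ :=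
  sInf {t | HasStrongCover E r p t}

/-- The complete `k`-uniform hypergraph on `Fin n`: all `k`-element subsets of the vertices. -/
def completeEdges (n k : ℕ) : Finset (Finset (Fin n)) :=
  Finset.powersetCard k (Finset.univ : Finset (Fin n))

/-- A cover of size `t` bounds the cover number. -/
theorem coverNumber_le {V : Type*} [DecidableEq V] {E : Finset (Finset V)} {r p t : ℕ}
    (h : HasStrongCover E r p t) : coverNumber E r p ≤ t := Nat.sInf_le h

/-- If `n ≤ r` then one injective coloring is a strong cover. -/
theorem hasStrongCover_one_of_le {n k r p : ℕ} (hnr : n ≤ r) (hpk : p ≤ k) :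
    HasStrongCover (completeEdges n k) r p 1 := by
  refine ⟨fun _ => Fin.castLE hnr, fun e he => ⟨0, ?_⟩⟩
  rw [Finset.card_image_of_injective _ (Fin.castLE_injective hnr)]
  rw [completeEdges, Finset.mem_powersetCard] at he
  omega

/-- Pull-back machine: `w` colorings together with `P` maps to `Fin m`, such that each edge is
properly colored by one of the colorings or injective under one of the maps, and a cover of
size `t` of the complete hypergraph on `Fin m`, give a cover of size `w + P * t`. -/
theorem hasStrongCover_machine {n m k r p w P t : ℕ}
    (χ : Fin w → Fin n → Fin r) (φ : Fin P → Fin n → Fin m)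
    (h : ∀ e ∈ completeEdges n k,
      (∃ i, p ≤ (e.image (χ i)).card) ∨ ∃ j, Set.InjOn (φ j) (e : Set (Fin n)))
    (ht : HasStrongCover (completeEdges m k) r p t) :
    HasStrongCover (completeEdges n k) r p (w + P * t) := by
  obtain ⟨ψ, hψ⟩ := ht
  refine ⟨fun i => Fin.addCases χ
    (fun j v => ψ (finProdFinEquiv.symm j).2 (φ (finProdFinEquiv.symm j).1 v)) i, ?_⟩
  intro e he
  rcases h e he with ⟨i, hi⟩ | ⟨j, hj⟩
  · exact ⟨Fin.castAdd _ i, by simpa using hi⟩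
  · have hmem : e.image (φ j) ∈ completeEdges m k := by
      rw [completeEdges, Finset.mem_powersetCard] at he ⊢
      exact ⟨Finset.subset_univ _, by rw [Finset.card_image_of_injOn hj, he.2]⟩
    obtain ⟨i, hi⟩ := hψ _ hmem
    refine ⟨Fin.natAdd _ (finProdFinEquiv (j, i)), ?_⟩
    rw [Finset.image_image] at hi
    simp only [Fin.addCases_right, Equiv.symm_apply_apply]
    exact hi

/-- `D` dominates the number of `h`-sets through a fixed class. -/
theorem choose_le_D {r h D : ℕ} (hh : 1 ≤ h) (hr : h ≤ r) (hD : D = (r.choose h) ⌈/⌉ (r / h)) :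
    (r - 1).choose (h - 1) ≤ D := by
  have hf : 0 < r / h := Nat.div_pos hr hh
  have h1 : r.choose h ≤ (r / h) * D := by
    rw [hD]; simpa using (le_smul_ceilDiv (a := r / h) (b := r.choose h) hf)
  have h2 : r.choose h * h = r * (r - 1).choose (h - 1) := by
    obtain ⟨r', rfl⟩ : ∃ r', r = r' + 1 := ⟨r - 1, by omega⟩
    obtain ⟨h', rfl⟩ : ∃ h', h = h' + 1 := ⟨h - 1, by omega⟩
    simpa using (Nat.add_one_mul_choose_eq r' h').symm
  have h3 : (r / h) * h ≤ r := Nat.div_mul_le_self r h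
  have h4 : (r / h) * (r - 1).choose (h - 1) * h ≤ (r / h) * D * h := by
    calc (r / h) * (r - 1).choose (h - 1) * h = (r / h) * h * (r - 1).choose (h - 1) := by ring
      _ ≤ r * (r - 1).choose (h - 1) := Nat.mul_le_mul_right _ h3
      _ = r.choose h * h := h2.symm
      _ ≤ (r / h) * D * h := Nat.mul_le_mul_right _ h1
  exact Nat.le_of_mul_le_mul_left (Nat.le_of_mul_le_mul_right h4 hh) hf

/-- A map with image of size at most `m` can be replaced by a map to `Fin m`. -/
theorem exists_fin_map {n m : ℕ} {T : Type*} [DecidableEq T] (f : Fin n → T)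
    (hf : (univ.image f).card ≤ m) :
    ∃ g : Fin n → Fin m, ∀ x y, g x = g y → f x = f y := by
  let E := (univ.image f).equivFin
  refine ⟨fun x => Fin.castLE hf (E ⟨f x, mem_image_of_mem f (mem_univ x)⟩), fun x y h => ?_⟩
  have := E.injective (Fin.castLE_injective hf h)
  simpa using this

/-- The case in which no union of `h` classes of a balanced coloring overflows. -/
theorem nice_case {n k r h m t : ℕ} (hh : 1 ≤ h) (hr : h < r) (hk : h < k)
    (hnice : h * (n / r) + min (n % r) h ≤ m)
    (ht : HasStrongCover (completeEdges m k) r (h + 1) t) :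
    HasStrongCover (completeEdges n k) r (h + 1) (1 + (r - 1).choose (h - 1) * t) := by
  have r0 : 0 < r := by omega
  set q := n / r with hq
  set s := n % r with hs
  have hn : n = r * q + s := (Nat.div_add_mod n r).symm
  let I := powersetCard (h - 1) ((range r).erase 0)
  have hI : I.card = (r - 1).choose (h - 1) := by
    simp [I, card_powersetCard, r0]
  let F : Finset ℕ → Fin n → ℕ × ℕ := fun A v =>
    (if v.1 % r ∈ insert 0 A then v.1 % r else 0, v.1 / r)
  have hF : ∀ A ∈ I, (univ.image (F A)).card ≤ m := by
    intro A hA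
    rw [mem_powersetCard] at hA
    have h0 : 0 ∉ A := fun h0 => by simpa using hA.1 h0
    have hW : (insert 0 A).card = h := by rw [card_insert_of_notMem h0, hA.2]; omega
    have hsub : univ.image (F A) ⊆
        ((insert 0 A) ×ˢ range q) ∪ (((insert 0 A).filter (· < s)) ×ˢ {q}) := by
      intro x hx
      obtain ⟨v, -, rfl⟩ := mem_image.1 hx
      have hv := v.2
      have hd : r * (v.1 / r) + v.1 % r = v.1 := Nat.div_add_mod v.1 r
      have hle : v.1 / r ≤ q := Nat.div_le_div_right hv.le
      have hlt : v.1 / r = q → v.1 % r < s := by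
        intro h1; rw [h1] at hd; omega
      rw [mem_union]
      have hmem : (F A v).1 ∈ insert 0 A := by
        simp only [F]; split_ifs with h1
        · exact h1
        · simp
      rcases hle.lt_or_eq with h1 | h1
      · left; exact mem_product.2 ⟨hmem, mem_range.2 h1⟩
      · right
        refine mem_product.2 ⟨mem_filter.2 ⟨hmem, ?_⟩, mem_singleton.2 h1⟩
        have := hlt h1
        simp only [F]; split_ifs <;> omega
    refine (card_le_card hsub).trans ((card_union_le _ _).trans ?_)
    rw [card_product, card_product, card_range, hW, card_singleton, mul_one]
    have h1 : ((insert 0 A).filter (· < s)).card ≤ h := hW ▸ card_filter_le _ _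
    have h2 : ((insert 0 A).filter (· < s)).card ≤ s := by
      refine (card_le_card (t := range s) ?_).trans (by simp)
      intro x hx; simpa using (mem_filter.1 hx).2
    have := le_min h2 h1
    omega
  have hG : ∀ A : I, ∃ g : Fin n → Fin m, ∀ x y, g x = g y → F A x = F A y :=
    fun A => exists_fin_map _ (hF A A.2)
  choose G hG using hG
  let E := (I.equivFin.trans (finCongr hI))
  refine hasStrongCover_machine (fun _ v => ⟨v.1 % r, Nat.mod_lt _ r0⟩)
    (fun j => G (E.symm j)) ?_ ht
  intro e he
  rw [completeEdges, mem_powersetCard] at he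
  by_cases hgood : h + 1 ≤ (e.image (fun v : Fin n => (⟨v.1 % r, Nat.mod_lt _ r0⟩ : Fin r))).card
  · exact Or.inl ⟨0, hgood⟩
  right
  set U := e.image (fun v : Fin n => v.1 % r) with hU
  have hUc : U.card ≤ h := by
    have : U = (e.image (fun v : Fin n => (⟨v.1 % r, Nat.mod_lt _ r0⟩ : Fin r))).image
        Fin.val := by rw [image_image]; rfl
    rw [this]
    exact card_image_le.trans (by omega)
  have hUr : U ⊆ range r := by
    intro x hx
    obtain ⟨v, -, rfl⟩ := mem_image.1 hx
    exact mem_range.2 (Nat.mod_lt _ r0)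
  have hUne : U.Nonempty := by
    apply Finset.Nonempty.image
    rw [← card_pos]; omega
  obtain ⟨y, hyU, hy⟩ : ∃ y ∈ U, (0 ∈ U → y = 0) := by
    by_cases h0 : 0 ∈ U
    · exact ⟨0, h0, fun _ => rfl⟩
    · obtain ⟨y, hy⟩ := hUne
      exact ⟨y, hy, fun h => absurd h h0⟩
  have hUy : U.erase y ⊆ (range r).erase 0 := by
    intro x hx
    rw [mem_erase] at hx ⊢
    refine ⟨fun h0 => ?_, hUr hx.2⟩
    subst h0
    exact hx.1 (hy hx.2).symm
  obtain ⟨A, hA1, hA2, hA3⟩ := exists_subsuperset_card_eq hUy (n := h - 1)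
    (by rw [card_erase_of_mem hyU]; omega) (by rw [card_erase_of_mem (by simp [r0])]; simp; omega)
  have hAI : A ∈ I := mem_powersetCard.2 ⟨hA2, hA3⟩
  refine ⟨E ⟨A, hAI⟩, ?_⟩
  intro u hu v hv huv
  simp only [Equiv.symm_apply_apply] at huv
  have hfe := hG _ _ _ huv
  simp only [F, Prod.mk.injEq] at hfe
  have key : ∀ w ∈ e, w.1 % r = y ∨ w.1 % r ∈ A := by
    intro w hw
    by_cases h1 : w.1 % r = y
    · exact Or.inl h1
    · exact Or.inr (hA1 (mem_erase.2 ⟨h1, mem_image_of_mem _ hw⟩))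
  have n0 : ∀ w ∈ e, w.1 % r = 0 → y = 0 := fun w hw h1 =>
    hy (h1 ▸ mem_image_of_mem (fun v : Fin n => v.1 % r) hw)
  have ku := key u hu
  have kv := key v hv
  have nu := n0 u hu
  have nv := n0 v hv
  have hmod : u.1 % r = v.1 % r := by
    have hf1 := hfe.1
    simp only [mem_insert] at hf1
    split_ifs at hf1 with a b b <;> grind
  apply Fin.ext
  rw [← Nat.div_add_mod u.1 r, ← Nat.div_add_mod v.1 r, hmod, hfe.2]

/-- Injective-on-everything covers exist, so the cover number is attained. -/
theorem hasStrongCover_coverNumber {m k r p : ℕ} (hpr : p ≤ r) (hpk : p ≤ k) (hp : 1 ≤ p) :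
    HasStrongCover (completeEdges m k) r p (coverNumber (completeEdges m k) r p) := by
  apply Nat.sInf_mem (s := {t | HasStrongCover (completeEdges m k) r p t})
  let E := Fintype.equivFin (Fin m → Fin r)
  refine ⟨Fintype.card (Fin m → Fin r), fun i => E.symm i, fun e he => ?_⟩
  rw [completeEdges, mem_powersetCard] at he
  obtain ⟨e', he', hc⟩ := exists_subset_card_eq (s := e) (n := p) (by omega)
  let g := e'.equivFin
  have r0 : 0 < r := by omega
  let c : Fin m → Fin r := fun v => if h : v ∈ e' then
    Fin.castLE (by omega) (g ⟨v, h⟩) else ⟨0, r0⟩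
  refine ⟨E c, ?_⟩
  simp only [Equiv.symm_apply_apply]
  have hinj : Set.InjOn c (e' : Set (Fin m)) := by
    intro a ha b hb hab
    have ha' : a ∈ e' := ha
    have hb' : b ∈ e' := hb
    simp only [c, ha', hb', dif_pos] at hab
    have := g.injective (Fin.castLE_injective _ hab)
    simpa using this
  calc p = (e'.image c).card := by rw [card_image_of_injOn hinj, hc]
    _ ≤ _ := card_le_card (image_subset_image he')

/-- A set is good for a family of colorings if one of them gives it at least `p` colors. -/
def GoodFor {V : Type*} [DecidableEq V] {r t : ℕ} (p : ℕ) (C : Fin t → V → Fin r)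
    (e : Finset V) : Prop :=
  ∃ i, p ≤ (e.image (C i)).card

open Classical in
/-- The good `k`-sets of a family of colorings. -/
noncomputable def goodSets {n r t : ℕ} (k p : ℕ) (C : Fin t → Fin n → Fin r) :
    Finset (Finset (Fin n)) :=
  (powersetCard k univ).filter (fun e => GoodFor p C e)

theorem mem_goodSets {n r t k p : ℕ} {C : Fin t → Fin n → Fin r} {e : Finset (Fin n)} :
    e ∈ goodSets k p C ↔ e.card = k ∧ GoodFor p C e := by
  simp [goodSets, mem_powersetCard]

/-- There is a family of `t` colorings whose density of good `k`-sets is at least `a / b`. -/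
def Dens (n k r p t a b : ℕ) : Prop :=
  ∃ C : Fin t → Fin n → Fin r, a * n.choose k ≤ b * (goodSets k p C).card

/-- Some family of `c` colorings leaves at most `u` uncovered `k`-sets. -/
def Unc (n k r p c u : ℕ) : Prop :=
  ∃ C : Fin c → Fin n → Fin r, ∃ U : Finset (Finset (Fin n)), U ⊆ powersetCard k univ ∧
    U.card ≤ u ∧ ∀ e, e.card = k → e ∉ U → GoodFor p C e

theorem unc_zero (n k r p : ℕ) : Unc n k r p 0 (n.choose k) := by
  refine ⟨fun i => i.elim0, powersetCard k univ, Subset.rfl, ?_, ?_⟩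
  · simp
  · intro e he hne
    exact absurd (mem_powersetCard.2 ⟨subset_univ _, he⟩) hne

theorem hasStrongCover_of_unc {n k r p c : ℕ} (h : Unc n k r p c 0) :
    HasStrongCover (completeEdges n k) r p c := by
  obtain ⟨C, U, -, hU0, h⟩ := h
  refine ⟨C, fun e he => ?_⟩
  have : U = ∅ := card_eq_zero.1 (by omega)
  exact h e (mem_powersetCard.1 he).2 (by simp [this])

/-- Permutation averaging. -/
theorem exists_perm_dens {n k r p t a b : ℕ} (C : Fin t → Fin n → Fin r)
    (hC : a * n.choose k ≤ b * (goodSets k p C).card) (U : Finset (Finset (Fin n)))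
    (hU : U ⊆ powersetCard k univ) :
    ∃ σ : Equiv.Perm (Fin n),
      a * U.card ≤ b * (U.filter (fun e => e.map σ.toEmbedding ∈ goodSets k p C)).card := by
  classical
  by_contra hcon
  push Not at hcon
  rcases U.eq_empty_or_nonempty with rfl | ⟨e0, he0⟩
  · have := hcon 1; simp at this
  set G := goodSets k p C with hG
  let A : Finset (Fin n) → ℕ := fun e =>
    ((univ : Finset (Equiv.Perm (Fin n))).filter (fun σ => e.map σ.toEmbedding ∈ G)).card
  have hA : ∀ e e' : Finset (Fin n), e.card = k → e'.card = k → A e = A e' := by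
    intro e e' h1 h2
    obtain ⟨τ, hτ⟩ : ∃ τ : Equiv.Perm (Fin n), e.map τ.toEmbedding = e' := by
      have h12 : e.card = e'.card := by omega
      obtain ⟨f⟩ : Nonempty ({x // x ∈ e} ≃ {x // x ∈ e'}) :=
        ⟨Finset.equivOfCardEq h12⟩
      refine ⟨f.extendSubtype, ?_⟩
      apply Finset.eq_of_subset_of_card_le
      · intro y hy
        obtain ⟨x, hx, rfl⟩ := mem_map.1 hy
        exact f.extendSubtype_mem x hx
      · rw [card_map]; omega
    refine Finset.card_bij' (fun σ _ => τ.symm.trans σ) (fun σ _ => τ.trans σ) ?_ ?_ ?_ ?_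
    · intro σ hσ
      simp only [mem_filter, mem_univ, true_and] at hσ ⊢
      convert hσ using 1
      rw [← hτ, Finset.map_map]
      congr 1
      ext x; simp
    · intro σ hσ
      simp only [mem_filter, mem_univ, true_and] at hσ ⊢
      convert hσ using 1
      rw [← hτ, Finset.map_map]
      congr 1
    · intro σ _; ext x; simp
    · intro σ _; ext x; simp
  have hswap : ∀ W : Finset (Finset (Fin n)),
      ∑ σ : Equiv.Perm (Fin n), (W.filter (fun e => e.map σ.toEmbedding ∈ G)).card
        = ∑ e ∈ W, A e := by
    intro W
    simp only [A, card_filter]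
    rw [sum_comm]
  have hall : ∀ σ : Equiv.Perm (Fin n),
      ((powersetCard k univ).filter (fun e => e.map σ.toEmbedding ∈ G)).card = G.card := by
    intro σ
    refine Finset.card_bij' (fun e _ => e.map σ.toEmbedding) (fun e _ => e.map σ.symm.toEmbedding) ?_ ?_ ?_ ?_
    · intro e he; exact (mem_filter.1 he).2
    · intro e he
      rw [mem_filter]
      have : (e.map σ.symm.toEmbedding).map σ.toEmbedding = e := by
        rw [Finset.map_map]; convert Finset.map_refl; ext x; simp
      refine ⟨mem_powersetCard.2 ⟨subset_univ _, ?_⟩, by rw [this]; exact he⟩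
      rw [card_map]; exact (mem_goodSets.1 he).1
    · intro e he
      rw [Finset.map_map]; convert Finset.map_refl; ext x; simp
    · intro e he
      rw [Finset.map_map]; convert Finset.map_refl; ext x; simp
  have hk0 : e0.card = k := (mem_powersetCard.1 (hU he0)).2
  have hsumall := hswap (powersetCard k univ)
  rw [sum_congr rfl (fun σ _ => hall σ), sum_const,
    sum_congr rfl (fun e he => hA e e0 (mem_powersetCard.1 he).2 hk0), sum_const] at hsumall
  simp only [smul_eq_mul, card_powersetCard, card_univ, Fintype.card_fin] at hsumall
  have hsumU := hswap U
  rw [sum_congr rfl (fun e he => hA e e0 (mem_powersetCard.1 (hU he)).2 hk0), sum_const,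
    smul_eq_mul] at hsumU
  have hlt : ∑ σ : Equiv.Perm (Fin n), b * (U.filter (fun e => e.map σ.toEmbedding ∈ G)).card
      < ∑ σ : Equiv.Perm (Fin n), a * U.card :=
    sum_lt_sum_of_nonempty ⟨1, mem_univ _⟩ (fun σ _ => hcon σ)
  rw [← mul_sum, hsumU, sum_const, smul_eq_mul, card_univ] at hlt
  set F := Fintype.card (Equiv.Perm (Fin n))
  have hUpos : 0 < U.card := card_pos.2 ⟨e0, he0⟩
  have hck : 0 < n.choose k := by
    have := card_pos.2 ⟨e0, hU he0⟩
    simpa using this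
  have h1 : b * (U.card * A e0) * n.choose k < F * (a * U.card) * n.choose k :=
    Nat.mul_lt_mul_of_pos_right hlt hck
  have h2 : F * (a * U.card) * n.choose k ≤ b * (U.card * A e0) * n.choose k := by
    calc F * (a * U.card) * n.choose k = F * U.card * (a * n.choose k) := by ring
      _ ≤ F * U.card * (b * G.card) := Nat.mul_le_mul_left _ hC
      _ = b * U.card * (F * G.card) := by ring
      _ = b * U.card * (n.choose k * A e0) := by rw [hsumall]
      _ = _ := by ring
  omega

/-- One greedy step. -/
theorem unc_step {n k r p c t u a b : ℕ} (hb : 0 < b) (h : Unc n k r p c u)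
    (hd : Dens n k r p t a b) : Unc n k r p (c + t) (u * (b - a) / b) := by
  classical
  obtain ⟨C, U, hU, hUc, hC⟩ := h
  obtain ⟨C', hC'⟩ := hd
  obtain ⟨σ, hσ⟩ := exists_perm_dens C' hC' U hU
  refine ⟨Fin.addCases C (fun j v => C' j (σ v)),
    U.filter (fun e => ¬ e.map σ.toEmbedding ∈ goodSets k p C'), ?_, ?_, ?_⟩
  · exact (filter_subset _ _).trans hU
  · rw [Nat.le_div_iff_mul_le hb]
    have hs := card_filter_add_card_filter_not (s := U)
      (fun e => e.map σ.toEmbedding ∈ goodSets k p C')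
    set x := (U.filter (fun e => e.map σ.toEmbedding ∈ goodSets k p C')).card
    set y := (U.filter (fun e => ¬ e.map σ.toEmbedding ∈ goodSets k p C')).card
    calc y * b ≤ U.card * (b - a) := by
          rw [Nat.mul_sub]
          apply Nat.le_sub_of_add_le
          rw [← hs] at hσ ⊢
          nlinarith
      _ ≤ u * (b - a) := Nat.mul_le_mul_right _ hUc
  · intro e he hne
    by_cases heU : e ∈ U
    · have hm : e.map σ.toEmbedding ∈ goodSets k p C' := by
        by_contra h'
        exact hne (mem_filter.2 ⟨heU, h'⟩)
      obtain ⟨j, hj⟩ := (mem_goodSets.1 hm).2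
      refine ⟨Fin.natAdd _ j, ?_⟩
      simp only [Fin.addCases_right]
      rw [map_eq_image, image_image] at hj
      exact hj
    · obtain ⟨j, hj⟩ := hC e he heU
      exact ⟨Fin.castAdd _ j, by simpa using hj⟩

/-- Iterated greedy. -/
theorem unc_iterate {n k r p c t u a b : ℕ} (hb : 0 < b) (h : Unc n k r p c u)
    (hd : Dens n k r p t a b) (N : ℕ) :
    Unc n k r p (c + N * t) ((fun u => u * (b - a) / b)^[N] u) := by
  induction N with
  | zero => simpa using h
  | succ N ih =>
    rw [Function.iterate_succ_apply']
    have := unc_step hb ih hd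
    rwa [show c + (N + 1) * t = c + N * t + t by ring]

theorem iterate_bound (a b u N : ℕ) :
    ((fun u => u * (b - a) / b)^[N] u) * b ^ N ≤ u * (b - a) ^ N := by
  induction N with
  | zero => simp
  | succ N ih =>
    rw [Function.iterate_succ_apply']
    set v := ((fun u => u * (b - a) / b)^[N] u)
    calc v * (b - a) / b * b ^ (N + 1) = (v * (b - a) / b * b) * b ^ N := by ring
      _ ≤ v * (b - a) * b ^ N := Nat.mul_le_mul_right _ (Nat.div_mul_le_self _ _)
      _ = (v * b ^ N) * (b - a) := by ring
      _ ≤ u * (b - a) ^ N * (b - a) := Nat.mul_le_mul_right _ ih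
      _ = _ := by ring

theorem goodFor_pad {V : Type*} [DecidableEq V] {r t t' p : ℕ} (ht : 1 ≤ t) (htt : t ≤ t')
    (C : Fin t → V → Fin r) :
    ∃ C' : Fin t' → V → Fin r, ∀ e, GoodFor p C e → GoodFor p C' e := by
  refine ⟨fun i => if hi : i.1 < t then C ⟨i, hi⟩ else C ⟨0, ht⟩, fun e ⟨i, hi⟩ => ?_⟩
  exact ⟨⟨i, by omega⟩, by simpa using hi⟩

theorem HasStrongCover.mono {V : Type*} [DecidableEq V] {E : Finset (Finset V)} {r p t t' : ℕ}
    (h : HasStrongCover E r p t) (ht : 1 ≤ t) (htt : t ≤ t') : HasStrongCover E r p t' := by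
  obtain ⟨C, hC⟩ := h
  obtain ⟨C', hC'⟩ := goodFor_pad (p := p) ht htt C
  exact ⟨C', fun e he => hC' e (hC e he)⟩

/-- Greedy covering from a partial cover and a density, logarithmic form. -/
theorem cover_of_unc_exp {n k r p c u t a b N : ℕ} (hb : 0 < b)
    (hu : Unc n k r p c u) (hd : Dens n k r p t a b)
    (hab : a ≤ b)
    (h : (u : ℝ) < Real.exp ((N : ℝ) * ((a : ℝ) / b))) :
    HasStrongCover (completeEdges n k) r p (c + N * t) := by
  have h1 := unc_iterate hb hu hd N
  suffices h0 : (fun u => u * (b - a) / b)^[N] (u) = 0 by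
    rw [h0] at h1; exact hasStrongCover_of_unc h1
  have h2 := iterate_bound a b (u) N
  set v := (fun u => u * (b - a) / b)^[N] (u)
  by_contra hv
  have hv1 : 1 ≤ v := by omega
  have hbR : (0 : ℝ) < b := by exact_mod_cast hb
  have h3 : ((b : ℝ)) ^ N ≤ (u : ℝ) * ((b : ℝ) - a) ^ N := by
    have h4 : b ^ N ≤ u * (b - a) ^ N := le_trans (Nat.le_mul_of_pos_left _ hv1) h2
    have h5 : ((b ^ N : ℕ) : ℝ) ≤ ((u * (b - a) ^ N : ℕ) : ℝ) := by exact_mod_cast h4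
    push_cast [Nat.cast_sub hab] at h5
    exact h5
  have h6 : ((b : ℝ) - a) ≤ b * Real.exp (-((a : ℝ) / b)) := by
    have := Real.add_one_le_exp (-((a : ℝ) / b))
    have h7 : (b : ℝ) - a = b * (-((a : ℝ) / b) + 1) := by field_simp; ring
    rw [h7]
    exact mul_le_mul_of_nonneg_left this hbR.le
  have h8 : ((b : ℝ) - a) ^ N ≤ b ^ N * Real.exp (-((N : ℝ) * ((a : ℝ) / b))) := by
    have h9 : (0 : ℝ) ≤ (b : ℝ) - a := by
      have : (a : ℝ) ≤ b := by exact_mod_cast hab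
      linarith
    calc ((b : ℝ) - a) ^ N ≤ (b * Real.exp (-((a : ℝ) / b))) ^ N := pow_le_pow_left₀ h9 h6 N
      _ = b ^ N * Real.exp (-((N : ℝ) * ((a : ℝ) / b))) := by
        rw [mul_pow, ← Real.exp_nat_mul]; congr 2; ring
  have hbN : (0 : ℝ) < (b : ℝ) ^ N := pow_pos hbR N
  have h10 : (b : ℝ) ^ N < (b : ℝ) ^ N := by
    calc (b : ℝ) ^ N ≤ (u : ℝ) * ((b : ℝ) - a) ^ N := h3
      _ ≤ (u : ℝ) * (b ^ N * Real.exp (-((N : ℝ) * ((a : ℝ) / b)))) :=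
        mul_le_mul_of_nonneg_left h8 (Nat.cast_nonneg _)
      _ < Real.exp ((N : ℝ) * ((a : ℝ) / b)) *
          (b ^ N * Real.exp (-((N : ℝ) * ((a : ℝ) / b)))) :=
        mul_lt_mul_of_pos_right h (by positivity)
      _ = (b : ℝ) ^ N * (Real.exp ((N : ℝ) * ((a : ℝ) / b)) *
          Real.exp (-((N : ℝ) * ((a : ℝ) / b)))) := by ring
      _ = (b : ℝ) ^ N := by rw [← Real.exp_add]; simp
  exact lt_irrefl _ h10

/-- Greedy covering from a density, logarithmic form. -/
theorem cover_of_dens_exp {n k r p t a b N : ℕ} (hb : 0 < b) (hd : Dens n k r p t a b)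
    (hab : a ≤ b)
    (h : ((n.choose k : ℕ) : ℝ) < Real.exp ((N : ℝ) * ((a : ℝ) / b))) :
    HasStrongCover (completeEdges n k) r p (N * t) := by
  have := cover_of_unc_exp hb (unc_zero n k r p) hd hab h
  rwa [zero_add] at this
theorem goodFor_mono {V : Type*} [DecidableEq V] {r t p : ℕ} {C : Fin t → V → Fin r}
    {e e' : Finset V} (h : GoodFor p C e) (hs : e ⊆ e') : GoodFor p C e' := by
  obtain ⟨i, hi⟩ := h
  exact ⟨i, hi.trans (card_le_card (image_subset_image hs))⟩

/-- A rainbow subset of prescribed size. -/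
theorem exists_rainbow {V W : Type*} [DecidableEq V] [DecidableEq W] (f : V → W) (F : Finset V)
    (p : ℕ) (h : p ≤ (F.image f).card) :
    ∃ T ⊆ F, T.card = p ∧ Set.InjOn f (T : Set V) := by
  obtain ⟨c, hc, hcp⟩ := exists_subset_card_eq h
  have : ∀ y ∈ c, ∃ x ∈ F, f x = y := fun y hy => mem_image.1 (hc hy)
  rcases isEmpty_or_nonempty V with hV | hV
  · have hF : F = ∅ := Finset.eq_empty_of_isEmpty F
    subst hF
    refine ⟨∅, Subset.rfl, ?_, by simp⟩
    simp at h ⊢; omega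
  choose! g hg1 hg2 using this
  refine ⟨c.image g, ?_, ?_, ?_⟩
  · intro x hx
    obtain ⟨y, hy, rfl⟩ := mem_image.1 hx
    exact hg1 y hy
  · rw [card_image_of_injOn, hcp]
    intro a ha b hb hab
    rw [← hg2 a ha, ← hg2 b hb, hab]
  · intro a ha b hb hab
    obtain ⟨a', ha', rfl⟩ := mem_image.1 (mem_coe.1 ha)
    obtain ⟨b', hb', rfl⟩ := mem_image.1 (mem_coe.1 hb)
    rw [hg2 a' ha', hg2 b' hb'] at hab
    rw [hab]

theorem removable_card {V : Type*} [DecidableEq V] {r t h : ℕ} {C : Fin t → V → Fin r}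
    {F : Finset V} (hF : GoodFor (h + 1) C F) (hk : h + 1 < F.card) :
    ∃ X ⊆ F, F.card - h ≤ X.card ∧ ∀ x ∈ X, GoodFor (h + 1) C (F.erase x) := by
  obtain ⟨i, hi⟩ := hF
  obtain ⟨T, hTF, hTc, hTi⟩ := exists_rainbow (C i) F (h + 1) hi
  obtain ⟨y, hyF, hyT⟩ : ∃ y ∈ F, y ∉ T := by
    by_contra hcon
    push Not at hcon
    have := card_le_card (show F ⊆ T from hcon)
    omega
  have hrain : ∀ S ⊆ F, S.card = h + 1 → Set.InjOn (C i) (S : Set V) → ∀ x, x ∉ S →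
      GoodFor (h + 1) C (F.erase x) := by
    intro S hS hSc hSi x hx
    refine ⟨i, ?_⟩
    rw [← hSc, ← card_image_of_injOn hSi]
    apply card_le_card
    apply image_subset_image
    intro a ha
    exact mem_erase.2 ⟨fun h' => hx (h' ▸ ha), hS ha⟩
  obtain ⟨t0, ht0, ht0'⟩ : ∃ t0 ∈ T, ∀ x ∈ T, C i x = C i y → x = t0 := by
    by_cases hex : ∃ x ∈ T, C i x = C i y
    · obtain ⟨x, hx, hxy⟩ := hex
      exact ⟨x, hx, fun x' hx' h' => hTi hx' hx (h'.trans hxy.symm)⟩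
    · push Not at hex
      obtain ⟨x, hx⟩ := card_pos.1 (show 0 < T.card by omega)
      exact ⟨x, hx, fun x' hx' h' => absurd h' (hex x' hx')⟩
  have hyt : y ≠ t0 := fun h' => hyT (h' ▸ ht0)
  refine ⟨insert t0 (F \ T), ?_, ?_, ?_⟩
  · intro x hx
    rcases mem_insert.1 hx with rfl | hx
    · exact hTF ht0
    · exact (mem_sdiff.1 hx).1
  · rw [card_insert_of_notMem (by simp [ht0]), card_sdiff_of_subset hTF]
    omega
  · intro x hx
    rcases mem_insert.1 hx with rfl | hx
    · apply hrain (insert y (T.erase x))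
      · intro a ha
        rcases mem_insert.1 ha with rfl | ha
        · exact hyF
        · exact hTF (mem_of_mem_erase ha)
      · rw [card_insert_of_notMem (fun h' => hyT (mem_of_mem_erase h')), card_erase_of_mem ht0]
        omega
      · rw [coe_insert, Set.injOn_insert (by simp [hyT])]
        refine ⟨hTi.mono (by simp), ?_⟩
        rintro ⟨a, ha, hay⟩
        simp only [coe_erase, Set.mem_sdiff, mem_coe, Set.mem_singleton_iff] at ha
        exact ha.2 (ht0' a ha.1 hay)
      · simp only [mem_insert, mem_erase, ne_eq, not_true_eq_false, false_and, or_false]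
        exact fun h' => hyt h'.symm
    · exact hrain T hTF hTc hTi x (mem_sdiff.1 hx).2

theorem good_shadow {N k r h t : ℕ} (C : Fin t → Fin N → Fin r) (hk : h + 1 < k) :
    (goodSets k (h + 1) C).card * (k - h) ≤ (goodSets (k - 1) (h + 1) C).card * (N + 1 - k) := by
  classical
  apply Finset.card_mul_le_card_mul (fun F E => E ⊆ F)
  · intro F hF
    obtain ⟨hFk, hFg⟩ := mem_goodSets.1 hF
    obtain ⟨X, hXF, hXc, hX⟩ := removable_card hFg (by omega)
    rw [hFk] at hXc
    refine hXc.trans ?_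
    rw [← card_image_of_injOn (s := X) (f := fun x => F.erase x)]
    · apply card_le_card
      intro E hE
      obtain ⟨x, hx, rfl⟩ := mem_image.1 hE
      rw [mem_bipartiteAbove]
      refine ⟨mem_goodSets.2 ⟨?_, hX x hx⟩, erase_subset _ _⟩
      rw [card_erase_of_mem (hXF hx), hFk]
    · intro x hx y hy hxy
      exact (erase_inj F (hXF hx)).1 hxy
  · intro E hE
    obtain ⟨hEk, -⟩ := mem_goodSets.1 hE
    have : (Eᶜ.image (fun x => insert x E)).card ≤ N + 1 - k := by
      refine card_image_le.trans ?_
      rw [card_compl, Fintype.card_fin]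
      omega
    refine le_trans (card_le_card ?_) this
    intro F hF
    rw [mem_bipartiteBelow] at hF
    obtain ⟨hF, hEF⟩ := hF
    obtain ⟨hFk, -⟩ := mem_goodSets.1 hF
    have h1 : (F \ E).card = 1 := by rw [card_sdiff_of_subset hEF]; omega
    obtain ⟨x, hx⟩ := card_eq_one.1 h1
    refine mem_image.2 ⟨x, ?_, ?_⟩
    · have : x ∈ F \ E := by rw [hx]; simp
      simpa using (mem_sdiff.1 this).2
    · rw [← sdiff_union_of_subset hEF, hx]; rfl

/-- cloning `w` -/
def cloneMap {N : ℕ} (w : Fin N) : Fin (N + 1) → Fin N := Fin.snoc (α := fun _ => Fin N) id w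

theorem clone_count {N k r p t : ℕ} (C : Fin t → Fin N → Fin r) (hk : 1 ≤ k) [DecidablePred (GoodFor p C)] (w : Fin N) :
    (goodSets k p C).card +
      ((powersetCard (k - 1) univ).filter (fun E => GoodFor p C (insert w E))).card
      ≤ (goodSets k p (fun i v => C i (cloneMap w v))).card := by
  classical
  let ι : Fin N ↪ Fin (N + 1) := Fin.castSuccEmb
  have hι : ∀ x, ι x = Fin.castSucc x := fun x => rfl
  have hcl : ∀ x, cloneMap w (ι x) = x := fun x => by simp [cloneMap, hι]
  have hcw : cloneMap w (Fin.last N) = w := by simp [cloneMap]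
  have himg : ∀ (E : Finset (Fin N)), (E.map ι).image (cloneMap w) = E := by
    intro E
    ext x
    simp [hcl]
  have hgood : ∀ (S : Finset (Fin (N + 1))), GoodFor p C (S.image (cloneMap w)) →
      GoodFor p (fun i v => C i (cloneMap w v)) S := by
    rintro S ⟨i, hi⟩
    refine ⟨i, ?_⟩
    rw [image_image] at hi
    exact hi
  have hlast : ∀ E : Finset (Fin N), Fin.last N ∉ E.map ι := by
    intro E hE
    obtain ⟨x, -, hx⟩ := mem_map.1 hE
    exact (Fin.castSucc_lt_last x).ne hx
  let A := (goodSets k p C).image (fun E => E.map ι)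
  let B := ((powersetCard (k - 1) univ).filter (fun E => GoodFor p C (insert w E))).image
    (fun E => insert (Fin.last N) (E.map ι))
  have hA : A.card = (goodSets k p C).card :=
    card_image_of_injective _ (fun E E' h => Finset.map_injective ι h)
  have hB : B.card = ((powersetCard (k - 1) univ).filter
      (fun E => GoodFor p C (insert w E))).card := by
    apply card_image_of_injective
    intro E E' h
    apply Finset.map_injective ι
    have := congrArg (fun S => S.erase (Fin.last N)) h
    simpa [erase_insert (hlast _)] using this
  have hAB : Disjoint A B := by
    rw [disjoint_left]
    intro S hSA hSB
    obtain ⟨E, -, rfl⟩ := mem_image.1 hSA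
    obtain ⟨E', -, h'⟩ := mem_image.1 hSB
    exact hlast E (h' ▸ mem_insert_self _ _)
  rw [← hA, ← hB, ← card_union_of_disjoint hAB]
  apply card_le_card
  intro S hS
  rcases mem_union.1 hS with hS | hS
  · obtain ⟨E, hE, rfl⟩ := mem_image.1 hS
    obtain ⟨h1, h2⟩ := mem_goodSets.1 hE
    exact mem_goodSets.2 ⟨by simpa using h1, hgood _ (by rw [himg]; exact h2)⟩
  · obtain ⟨E, hE, rfl⟩ := mem_image.1 hS
    obtain ⟨h1, h2⟩ := mem_filter.1 hE
    refine mem_goodSets.2 ⟨?_, hgood _ ?_⟩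
    · rw [card_insert_of_notMem (hlast _), card_map, (mem_powersetCard.1 h1).2]; omega
    · rw [image_insert, himg, hcw]; exact h2

theorem clone_sum {N k r p t : ℕ} (C : Fin t → Fin N → Fin r) [DecidablePred (GoodFor p C)] :
    k * (goodSets k p C).card + (k - 1) * (goodSets (k - 1) p C).card
    ≤ ∑ w : Fin N,
      ((powersetCard (k - 1) univ).filter (fun E => GoodFor p C (insert w E))).card := by
  classical
  rw [← card_sigma]
  let S1 := (goodSets k p C).sigma (fun F => F)
  let S2 := (goodSets (k - 1) p C).sigma (fun F => F)
  have h1 : S1.card = k * (goodSets k p C).card := by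
    rw [card_sigma, sum_congr rfl (fun F hF => (mem_goodSets.1 hF).1), sum_const, smul_eq_mul,
      mul_comm]
  have h2 : S2.card = (k - 1) * (goodSets (k - 1) p C).card := by
    rw [card_sigma, sum_congr rfl (fun F hF => (mem_goodSets.1 hF).1), sum_const, smul_eq_mul,
      mul_comm]
  let f1 : (Σ _ : Finset (Fin N), Fin N) → (Σ _ : Fin N, Finset (Fin N)) :=
    fun x => ⟨x.2, x.1.erase x.2⟩
  let f2 : (Σ _ : Finset (Fin N), Fin N) → (Σ _ : Fin N, Finset (Fin N)) :=
    fun x => ⟨x.2, x.1⟩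
  have i1 : Set.InjOn f1 (S1 : Set _) := by
    rintro ⟨F, w⟩ hF ⟨F', w'⟩ hF' h
    simp only [S1, mem_coe, mem_sigma] at hF hF'
    simp only [f1, Sigma.mk.injEq, heq_eq_eq] at h
    obtain ⟨rfl, h⟩ := h
    have := congrArg (fun S => insert w S) h
    simp only [insert_erase hF.2, insert_erase hF'.2] at this
    rw [this]
  have i2 : Set.InjOn f2 (S2 : Set _) := by
    rintro ⟨F, w⟩ hF ⟨F', w'⟩ hF' h
    simp only [f2, Sigma.mk.injEq, heq_eq_eq] at h
    obtain ⟨rfl, rfl⟩ := h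
    rfl
  rw [← h1, ← h2, ← card_image_of_injOn i1, ← card_image_of_injOn i2, ← card_union_of_disjoint]
  · apply card_le_card
    intro x hx
    rcases mem_union.1 hx with hx | hx
    · obtain ⟨⟨F, w⟩, hF, rfl⟩ := mem_image.1 hx
      simp only [S1, mem_sigma] at hF
      obtain ⟨hF, hw⟩ := hF
      obtain ⟨hF1, hF2⟩ := mem_goodSets.1 hF
      simp only [f1, mem_sigma, mem_univ, true_and, mem_filter, mem_powersetCard, subset_univ,
        insert_erase hw, card_erase_of_mem hw, hF1, hF2, and_self]
    · obtain ⟨⟨F, w⟩, hF, rfl⟩ := mem_image.1 hx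
      simp only [S2, mem_sigma] at hF
      obtain ⟨hF, hw⟩ := hF
      obtain ⟨hF1, hF2⟩ := mem_goodSets.1 hF
      simp only [f2, mem_sigma, mem_univ, true_and, mem_filter, mem_powersetCard, subset_univ,
        insert_eq_self.2 hw, hF1, hF2, and_self]
  · rw [disjoint_left]
    intro x h1 h2
    obtain ⟨⟨F, w⟩, hF, rfl⟩ := mem_image.1 h1
    obtain ⟨⟨F', w'⟩, hF', h⟩ := mem_image.1 h2
    simp only [S2, mem_sigma] at hF'
    simp only [f1, f2, Sigma.mk.injEq, heq_eq_eq] at h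
    obtain ⟨rfl, rfl⟩ := h
    exact (notMem_erase _ _) hF'.2

theorem dens_clone {N k r h t a b : ℕ} (hk : h + 1 ≤ k) (hkN : k ≤ N)
    (hd : Dens N k r (h + 1) t a b) :
    Dens (N + 1) k r (h + 1) t (a * (N * (N + 1) - h * k)) (b * (N * (N + 1))) := by
  classical
  obtain ⟨C, hC⟩ := hd
  set G := (goodSets k (h + 1) C).card with hG
  set G1 := (goodSets (k - 1) (h + 1) C).card with hG1
  by_contra hcon
  have hcon' : ∀ C' : Fin t → Fin (N + 1) → Fin r, b * (N * (N + 1)) *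
      (goodSets k (h + 1) C').card < a * (N * (N + 1) - h * k) * (N + 1).choose k := by
    intro C'
    by_contra h'
    exact hcon ⟨C', not_lt.1 h'⟩
  have hN : 0 < N := by omega
  -- sum over w
  have hsum : (N + k) * G + (k - 1) * G1 ≤
      ∑ w : Fin N, (goodSets k (h + 1) (fun i v => C i (cloneMap w v))).card := by
    calc (N + k) * G + (k - 1) * G1 = N * G + (k * G + (k - 1) * G1) := by ring
      _ ≤ N * G + ∑ w : Fin N, ((powersetCard (k - 1) univ).filter
          (fun E => GoodFor (h + 1) C (insert w E))).card := by
        gcongr; exact clone_sum C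
      _ = ∑ w : Fin N, (G + ((powersetCard (k - 1) univ).filter
          (fun E => GoodFor (h + 1) C (insert w E))).card) := by
        rw [sum_add_distrib]; simp
      _ ≤ _ := sum_le_sum (fun w _ => clone_count C (by omega) w)
  have hlt : ∑ w : Fin N, b * (N * (N + 1)) *
      (goodSets k (h + 1) (fun i v => C i (cloneMap w v))).card <
      ∑ w : Fin N, a * (N * (N + 1) - h * k) * (N + 1).choose k :=
    sum_lt_sum_of_nonempty ⟨⟨0, hN⟩, mem_univ _⟩ (fun w _ => hcon' _)
  rw [← mul_sum, sum_const, card_univ, Fintype.card_fin, smul_eq_mul] at hlt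
  have h1 : b * (N * (N + 1)) * ((N + k) * G + (k - 1) * G1) <
      N * (a * (N * (N + 1) - h * k) * (N + 1).choose k) :=
    lt_of_le_of_lt (Nat.mul_le_mul_left _ hsum) hlt
  have hch : (N + 1).choose k * (N + 1 - k) = (N + 1) * N.choose k := by
    have := Nat.choose_mul_succ_eq N k
    rw [← this]; ring
  have hkey : (N * (N + 1) - h * k) * G ≤ (N + 1 - k) * ((N + k) * G + (k - 1) * G1) := by
    obtain ⟨x, rfl⟩ : ∃ x, k = h + 1 + x := ⟨k - (h + 1), by omega⟩
    obtain ⟨y, rfl⟩ : ∃ y, N = h + 1 + x + y := ⟨N - (h + 1 + x), by omega⟩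
    have e1 : h + 1 + x + y + 1 - (h + 1 + x) = y + 1 := by omega
    have e2 : h + 1 + x - 1 = h + x := by omega
    have e3 : (h + 1 + x + y) * (h + 1 + x + y + 1) - h * (h + 1 + x) =
        (y + 1) * (h + 1 + x + y + (h + 1 + x)) + (h + 1 + x) * x := by
      apply Nat.sub_eq_of_eq_add; ring
    rw [e1, e2, e3]
    rcases Nat.eq_zero_or_pos x with hx | hx
    · subst hx; simp only [Nat.mul_zero, Nat.add_zero]; nlinarith [Nat.zero_le ((y+1) * (h * G1))]
    · have hs := good_shadow C (k := h + 1 + x) (h := h) (by omega)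
      rw [← hG, ← hG1, e1, show h + 1 + x - h = x + 1 by omega] at hs
      have : (h + 1 + x) * x * G ≤ (h + x) * ((x + 1) * G) := by nlinarith [Nat.zero_le (h * G)]
      have h3 : (h + x) * (G * (x + 1)) ≤ (h + x) * (G1 * (y + 1)) := Nat.mul_le_mul_left _ hs
      nlinarith
  have h2 : N * (a * (N * (N + 1) - h * k) * (N + 1).choose k) * (N + 1 - k) ≤
      b * (N * (N + 1)) * ((N + k) * G + (k - 1) * G1) * (N + 1 - k) := by
    calc N * (a * (N * (N + 1) - h * k) * (N + 1).choose k) * (N + 1 - k)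
        = N * a * (N * (N + 1) - h * k) * ((N + 1).choose k * (N + 1 - k)) := by ring
      _ = N * (N + 1) * (N * (N + 1) - h * k) * (a * N.choose k) := by rw [hch]; ring
      _ ≤ N * (N + 1) * (N * (N + 1) - h * k) * (b * G) := Nat.mul_le_mul_left _ hC
      _ = b * (N * (N + 1)) * ((N * (N + 1) - h * k) * G) := by ring
      _ ≤ b * (N * (N + 1)) * ((N + 1 - k) * ((N + k) * G + (k - 1) * G1)) :=
        Nat.mul_le_mul_left _ hkey
      _ = _ := by ring
  have h3 := Nat.mul_lt_mul_of_pos_right h1 (show 0 < N + 1 - k by omega)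
  omega

/-- Iterated cloning: product form. -/
theorem dens_clone_iter {m k r h t : ℕ} (hk : h + 1 ≤ k) (hkm : k ≤ m) (K : ℕ)
    (hd : Dens m k r (h + 1) t 1 1) :
    Dens (m + K) k r (h + 1) t (∏ i ∈ range K, ((m + i) * (m + i + 1) - h * k))
      (∏ i ∈ range K, ((m + i) * (m + i + 1))) := by
  induction K with
  | zero => simpa using hd
  | succ K ih =>
    have := dens_clone hk (by omega) ih
    rwa [prod_range_succ, prod_range_succ]

theorem dens_of_cover {m k r p t : ℕ} (h : HasStrongCover (completeEdges m k) r p t) :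
    Dens m k r p t 1 1 := by
  obtain ⟨C, hC⟩ := h
  refine ⟨C, ?_⟩
  rw [one_mul, one_mul]
  have : goodSets k p C = completeEdges m k := by
    ext e
    rw [mem_goodSets]
    constructor
    · rintro ⟨h1, -⟩; exact mem_powersetCard.2 ⟨subset_univ _, h1⟩
    · intro he; exact ⟨(mem_powersetCard.1 he).2, hC e he⟩
  rw [this, completeEdges, card_powersetCard, card_univ, Fintype.card_fin]

theorem Dens.pad {n k r p t t' a b : ℕ} (h : Dens n k r p t a b) (ht : 1 ≤ t) (htt : t ≤ t') :
    Dens n k r p t' a b := by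
  classical
  obtain ⟨C, hC⟩ := h
  obtain ⟨C', hC'⟩ := goodFor_pad (p := p) ht htt C
  refine ⟨C', hC.trans (Nat.mul_le_mul_left _ (card_le_card ?_))⟩
  intro e he
  obtain ⟨h1, h2⟩ := mem_goodSets.1 he
  exact mem_goodSets.2 ⟨h1, hC' e h2⟩

/-- Weakening a density. -/
theorem Dens.weaken {n k r p t a b a' b' : ℕ} (h : Dens n k r p t a b) (hb : 0 < b)
    (hab : a' * b ≤ a * b') : Dens n k r p t a' b' := by
  obtain ⟨C, hC⟩ := h
  refine ⟨C, ?_⟩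
  apply Nat.le_of_mul_le_mul_left _ hb
  calc b * (a' * n.choose k) = (a' * b) * n.choose k := by ring
    _ ≤ (a * b') * n.choose k := Nat.mul_le_mul_right _ hab
    _ = b' * (a * n.choose k) := by ring
    _ ≤ b' * (b * (goodSets k p C).card) := Nat.mul_le_mul_left _ hC
    _ = _ := by ring

/-- Covers restrict to fewer vertices and extend to larger edges. -/
theorem cover_mono {n n' k k' r p t : ℕ} (hn : n' ≤ n) (hk : k ≤ k')
    (h : HasStrongCover (completeEdges n k) r p t) :
    HasStrongCover (completeEdges n' k') r p t := by
  obtain ⟨C, hC⟩ := h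
  refine ⟨fun i v => C i (Fin.castLE hn v), fun e he => ?_⟩
  have he' := (mem_powersetCard.1 he).2
  obtain ⟨e1, he1, he1c⟩ := exists_subset_card_eq (s := e) (n := k) (by omega)
  have hmem : e1.map (Fin.castLEEmb hn) ∈ completeEdges n k :=
    mem_powersetCard.2 ⟨subset_univ _, by simpa using he1c⟩
  obtain ⟨i, hi⟩ := hC _ hmem
  refine ⟨i, hi.trans ?_⟩
  rw [map_eq_image, image_image]
  exact card_le_card (image_subset_image he1)

/-- Random colorings: density of rainbow `p`-sets. -/
theorem dens_random (n r p : ℕ) (hr : 0 < r) (hpn : p ≤ n) :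
    Dens n p r p 1 (r.descFactorial p) (r ^ p) := by
  classical
  by_contra hcon
  have hcon' : ∀ f : Fin n → Fin r, r ^ p * (goodSets p p (fun _ : Fin 1 => f)).card <
      r.descFactorial p * n.choose p := fun f => by
    by_contra h'
    exact hcon ⟨fun _ => f, not_lt.1 h'⟩
  have hinj : ∀ e : Finset (Fin n), e.card = p →
      ((univ : Finset (Fin n → Fin r)).filter (fun f => p ≤ (e.image f).card)).card
        = r.descFactorial p * r ^ (n - p) := by
    intro e he
    let E := Equiv.piEquivPiSubtypeProd (fun x => x ∈ e) (fun _ : Fin n => Fin r)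
    have hcard : Fintype.card (({x // x ∈ e} ↪ Fin r) × ({x // ¬ x ∈ e} → Fin r)) =
        r.descFactorial p * r ^ (n - p) := by
      rw [Fintype.card_prod, Fintype.card_embedding_eq, Fintype.card_fun]
      simp [he, Fintype.card_subtype_compl]
    rw [← hcard, ← Fintype.card_subtype]
    apply Fintype.card_congr
    have hiff : ∀ f : Fin n → Fin r, p ≤ (e.image f).card ↔ Function.Injective (E f).1 := by
      intro f
      have h1 : p ≤ (e.image f).card ↔ Set.InjOn f (e : Set (Fin n)) := by
        rw [← card_image_iff, he]
        constructor
        · intro h; exact le_antisymm (card_image_le.trans he.le) h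
        · intro h; exact h.ge
      rw [h1]
      constructor
      · intro h a b hab
        exact Subtype.ext (h a.2 b.2 hab)
      · intro h a ha b hb hab
        have := @h ⟨a, ha⟩ ⟨b, hb⟩ hab
        exact congrArg Subtype.val this
    exact (E.subtypeEquiv (p := fun f => p ≤ (e.image f).card)
      (q := fun y => Function.Injective y.1) hiff).trans
      ((Equiv.prodSubtypeFstEquivSubtypeProd (p := fun g : {x // x ∈ e} → Fin r =>
        Function.Injective g)).trans
        (Equiv.prodCongr (Equiv.subtypeInjectiveEquivEmbedding _ _) (Equiv.refl _)))
  have hsw : ∑ f : Fin n → Fin r, (goodSets p p (fun _ : Fin 1 => f)).card =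
      n.choose p * (r.descFactorial p * r ^ (n - p)) := by
    have h1 : ∀ f : Fin n → Fin r, goodSets p p (fun _ : Fin 1 => f) =
        (powersetCard p univ).filter (fun e => p ≤ (e.image f).card) := by
      intro f
      ext e
      rw [mem_goodSets, mem_filter, mem_powersetCard]
      constructor
      · rintro ⟨h1, _, h2⟩; exact ⟨⟨subset_univ _, h1⟩, h2⟩
      · rintro ⟨⟨_, h1⟩, h2⟩; exact ⟨h1, 0, h2⟩
    simp_rw [h1, card_filter]
    rw [sum_comm]
    simp_rw [← card_filter]
    rw [sum_congr rfl (fun e he => hinj e (mem_powersetCard.1 he).2), sum_const, card_powersetCard]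
    simp
  have : Nonempty (Fin r) := ⟨⟨0, hr⟩⟩
  have hlt := sum_lt_sum_of_nonempty (s := (univ : Finset (Fin n → Fin r))) univ_nonempty
    (fun f _ => hcon' f)
  rw [← mul_sum, hsw, sum_const, card_univ, Fintype.card_fun, Fintype.card_fin, Fintype.card_fin,
    smul_eq_mul] at hlt
  have hrn : r ^ n = r ^ p * r ^ (n - p) := by rw [← pow_add]; congr 1; omega
  rw [hrn] at hlt
  have : r ^ p * (n.choose p * (r.descFactorial p * r ^ (n - p))) =
    r ^ p * r ^ (n - p) * (r.descFactorial p * n.choose p) := by ring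
  omega

/-- The sets left over by the balanced coloring. -/
theorem base_bad {n k r h : ℕ} (hr : h < r) :
    ∃ C : Fin 1 → Fin n → Fin r, ∃ U : Finset (Finset (Fin n)), U ⊆ powersetCard k univ ∧
      U.card ≤ r.choose h * (h * (n / r) + min (n % r) h).choose k ∧
      ∀ e, e.card = k → e ∉ U → GoodFor (h + 1) C e := by
  classical
  have r0 : 0 < r := by omega
  set q := n / r with hq
  set s := n % r with hs
  set M := h * q + min s h
  have hn : n = r * q + s := (Nat.div_add_mod n r).symm
  let I := powersetCard h (range r)
  let cl : Finset ℕ → Finset (Fin n) := fun A => univ.filter (fun v => v.1 % r ∈ A)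
  have hcl : ∀ A ∈ I, (cl A).card ≤ M := by
    intro A hA
    rw [mem_powersetCard] at hA
    let F : Fin n → ℕ × ℕ := fun v => (v.1 % r, v.1 / r)
    have hFi : Function.Injective F := by
      intro u v huv
      simp only [F, Prod.mk.injEq] at huv
      apply Fin.ext
      rw [← Nat.div_add_mod u.1 r, ← Nat.div_add_mod v.1 r, huv.1, huv.2]
    have hsub : (cl A).image F ⊆ (A ×ˢ range q) ∪ ((A.filter (· < s)) ×ˢ {q}) := by
      intro x hx
      obtain ⟨v, hvA, rfl⟩ := mem_image.1 hx
      have hmem : v.1 % r ∈ A := (mem_filter.1 hvA).2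
      have hv := v.2
      have hd : r * (v.1 / r) + v.1 % r = v.1 := Nat.div_add_mod v.1 r
      have hle : v.1 / r ≤ q := Nat.div_le_div_right hv.le
      have hlt : v.1 / r = q → v.1 % r < s := by
        intro h1; rw [h1] at hd; omega
      rw [mem_union]
      rcases hle.lt_or_eq with h1 | h1
      · left; exact mem_product.2 ⟨hmem, mem_range.2 h1⟩
      · right
        exact mem_product.2 ⟨mem_filter.2 ⟨hmem, hlt h1⟩, mem_singleton.2 h1⟩
    rw [← card_image_of_injective _ hFi]
    refine (card_le_card hsub).trans ((card_union_le _ _).trans ?_)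
    rw [card_product, card_product, card_range, hA.2, card_singleton, mul_one]
    have h1 : (A.filter (· < s)).card ≤ h := hA.2 ▸ card_filter_le _ _
    have h2 : (A.filter (· < s)).card ≤ s := by
      refine (card_le_card (t := range s) ?_).trans (by simp)
      intro x hx; simpa using (mem_filter.1 hx).2
    have := le_min h2 h1
    omega
  refine ⟨fun _ v => ⟨v.1 % r, Nat.mod_lt _ r0⟩, I.biUnion (fun A => powersetCard k (cl A)),
    ?_, ?_, ?_⟩
  · intro e he
    obtain ⟨A, -, he⟩ := mem_biUnion.1 he
    exact mem_powersetCard.2 ⟨subset_univ _, (mem_powersetCard.1 he).2⟩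
  · refine card_biUnion_le.trans ?_
    calc ∑ A ∈ I, (powersetCard k (cl A)).card ≤ ∑ A ∈ I, M.choose k := by
          apply sum_le_sum
          intro A hA
          rw [card_powersetCard]
          exact Nat.choose_le_choose _ (hcl A hA)
      _ = _ := by simp [I, card_powersetCard]
  · intro e hek heU
    by_contra hbad
    apply heU
    set U := e.image (fun v : Fin n => v.1 % r) with hU
    have hUc : U.card ≤ h := by
      have : U = (e.image (fun v : Fin n => (⟨v.1 % r, Nat.mod_lt _ r0⟩ : Fin r))).image
          Fin.val := by rw [image_image]; rfl
      rw [this]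
      refine card_image_le.trans ?_
      by_contra hc
      exact hbad ⟨0, Nat.lt_of_not_le hc⟩
    have hUr : U ⊆ range r := by
      intro x hx
      obtain ⟨v, -, rfl⟩ := mem_image.1 hx
      exact mem_range.2 (Nat.mod_lt _ r0)
    obtain ⟨A, hA1, hA2, hA3⟩ := exists_subsuperset_card_eq hUr hUc (by simp; omega)
    refine mem_biUnion.2 ⟨A, mem_powersetCard.2 ⟨hA2, hA3⟩, mem_powersetCard.2 ⟨?_, hek⟩⟩
    intro v hv
    exact mem_filter.2 ⟨mem_univ _, hA1 (mem_image_of_mem _ hv)⟩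

theorem base_unc {n k r h : ℕ} (hr : h < r) :
    Unc n k r (h + 1) 1 (r.choose h * (h * (n / r) + min (n % r) h).choose k) :=
  base_bad hr

theorem base_dens {n k r h : ℕ} (hr : h < r) :
    Dens n k r (h + 1) 1 (n.choose k - r.choose h * (h * (n / r) + min (n % r) h).choose k)
      (n.choose k) := by
  obtain ⟨C, U, hU, hUc, hC⟩ := base_bad (n := n) (k := k) hr
  refine ⟨C, ?_⟩
  rw [mul_comm]
  apply Nat.mul_le_mul_left
  have h1 : (powersetCard k (univ : Finset (Fin n))) \ U ⊆ goodSets k (h + 1) C := by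
    intro e he
    obtain ⟨h1, h2⟩ := mem_sdiff.1 he
    have h3 := (mem_powersetCard.1 h1).2
    exact mem_goodSets.2 ⟨h3, hC e h3 h2⟩
  have h2 := card_le_card h1
  rw [card_sdiff_of_subset hU, card_powersetCard, card_univ, Fintype.card_fin] at h2
  omega
/-- The vertex grid: `r` classes, the first `s` of size `q + 1`, the others of size `q`. -/
def grid (r q s : ℕ) : Finset (ℕ × ℕ) := (range r ×ˢ range q) ∪ (range s ×ˢ {q})

theorem mem_grid {r q s : ℕ} (hs : s ≤ r) {v : ℕ × ℕ} :
    v ∈ grid r q s ↔ v.1 < r ∧ (v.2 < q ∨ (v.2 = q ∧ v.1 < s)) := by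
  simp only [grid, mem_union, mem_product, mem_range, mem_singleton]
  constructor
  · rintro (h | h) <;> omega
  · rintro ⟨h1, h2 | h2⟩ <;> omega

/-- The pull-back machine on the grid. -/
theorem machine_grid {n m k r p t : ℕ} {α β T : Type*} [DecidableEq T] (hr : 0 < r)
    (Ic : Finset α) (χ : α → ℕ × ℕ → ℕ) (Im : Finset β) (φ : β → ℕ × ℕ → T)
    (hχ : ∀ a ∈ Ic, ∀ v ∈ grid r (n / r) (n % r), χ a v < r)
    (hφ : ∀ b ∈ Im, ((grid r (n / r) (n % r)).image (φ b)).card ≤ m)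
    (h : ∀ e ⊆ grid r (n / r) (n % r), e.card = k →
      (∃ a ∈ Ic, p ≤ (e.image (χ a)).card) ∨ ∃ b ∈ Im, Set.InjOn (φ b) (e : Set (ℕ × ℕ)))
    (ht : HasStrongCover (completeEdges m k) r p t) :
    HasStrongCover (completeEdges n k) r p (Ic.card + Im.card * t) := by
  classical
  set q := n / r with hq
  set s := n % r with hs
  have hsr : s ≤ r := (Nat.mod_lt _ hr).le
  let F : Fin n → ℕ × ℕ := fun v => (v.1 % r, v.1 / r)
  have hFi : Function.Injective F := by
    intro u v huv
    simp only [F, Prod.mk.injEq] at huv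
    apply Fin.ext
    rw [← Nat.div_add_mod u.1 r, ← Nat.div_add_mod v.1 r, huv.1, huv.2]
  have hF : ∀ v, F v ∈ grid r q s := by
    intro v
    rw [mem_grid hsr]
    have hd : r * (v.1 / r) + v.1 % r = v.1 := Nat.div_add_mod v.1 r
    have hd' : r * q + s = n := Nat.div_add_mod n r
    have hle : v.1 / r ≤ q := Nat.div_le_div_right v.2.le
    refine ⟨Nat.mod_lt _ hr, ?_⟩
    rcases hle.lt_or_eq with h1 | h1
    · exact Or.inl h1
    · refine Or.inr ⟨h1, ?_⟩
      have hv := v.2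
      change v.1 % r < s
      rw [h1] at hd; omega
  let C : Ic → Fin n → Fin r := fun a v => ⟨χ a (F v), hχ a a.2 _ (hF v)⟩
  have hG : ∀ b : Im, ∃ g : Fin n → Fin m, ∀ x y, g x = g y → φ b (F x) = φ b (F y) := by
    intro b
    apply exists_fin_map (fun x => φ b (F x))
    refine (card_le_card ?_).trans (hφ b b.2)
    intro y hy
    obtain ⟨x, -, rfl⟩ := mem_image.1 hy
    exact mem_image_of_mem _ (hF x)
  choose G hG using hG
  refine hasStrongCover_machine (fun i => C (Ic.equivFin.symm i))
    (fun j => G (Im.equivFin.symm j)) ?_ ht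
  intro e he
  have hek := (mem_powersetCard.1 he).2
  rcases h (e.image F) (by
      intro y hy
      obtain ⟨x, -, rfl⟩ := mem_image.1 hy
      exact hF x) (by rw [card_image_of_injective _ hFi, hek]) with ⟨a, ha, h1⟩ | ⟨b, hb, h1⟩
  · left
    refine ⟨Ic.equivFin ⟨a, ha⟩, h1.trans ?_⟩
    have : (e.image F).image (χ a) =
        (e.image (C (Ic.equivFin.symm (Ic.equivFin ⟨a, ha⟩)))).image Fin.val := by
      rw [image_image, image_image, Equiv.symm_apply_apply]; rfl
    rw [this]
    exact card_image_le
  · right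
    refine ⟨Im.equivFin ⟨b, hb⟩, ?_⟩
    intro x hx y hy hxy
    have h2 := hG _ _ _ hxy
    rw [Equiv.symm_apply_apply] at h2
    exact hFi (h1 (mem_coe.2 (mem_image_of_mem F hx)) (mem_coe.2 (mem_image_of_mem F hy)) h2)

theorem cover_pos {m k r p t : ℕ} (hkm : k ≤ m) (ht : HasStrongCover (completeEdges m k) r p t) :
    1 ≤ t := by
  obtain ⟨C, hC⟩ := ht
  obtain ⟨e, -, he⟩ := exists_subset_card_eq (s := (univ : Finset (Fin m))) (n := k) (by simpa)
  obtain ⟨i, -⟩ := hC e (mem_powersetCard.2 ⟨subset_univ _, he⟩)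
  have := i.2
  omega

theorem exists_testBit_ne {a b lam : ℕ} (ha : a < 2 ^ lam) (hb : b < 2 ^ lam) (hab : a ≠ b) :
    ∃ i < lam, a.testBit i ≠ b.testBit i := by
  by_contra hcon
  push Not at hcon
  apply hab
  apply Nat.eq_of_testBit_eq
  intro i
  by_cases hi : i < lam
  · exact hcon i hi
  · rw [Nat.testBit_lt_two_pow (ha.trans_le (Nat.pow_le_pow_right (by norm_num) (by omega))),
      Nat.testBit_lt_two_pow (hb.trans_le (Nat.pow_le_pow_right (by norm_num) (by omega)))]

theorem h2_arith (x : ℕ) (hx : x = 4 ∨ 6 ≤ x) : x ≤ 2 ^ (x / 2) := by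
  have : ∀ y, 3 ≤ y → 2 * y + 1 ≤ 2 ^ y := by
    intro y hy
    induction y, hy using Nat.le_induction with
    | base => norm_num
    | succ y hy ih => rw [pow_succ]; omega
  rcases hx with rfl | hx
  · norm_num
  · have := this (x / 2) (by omega)
    omega

/-- The case `h = 2`. -/
theorem case_h2 {n k r m t D : ℕ} (hk : 3 ≤ k) (hkm : k ≤ m) (hs2 : 2 ≤ n % r)
    (hsr : 2 * (n % r) ≤ r) (hq : 1 ≤ n / r) (hm : m = 2 * (n / r) + 1)
    (hD : D = (r.choose 2) ⌈/⌉ (r / 2))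
    (ht : HasStrongCover (completeEdges m k) r 3 t) :
    HasStrongCover (completeEdges n k) r 3 (1 + D * t) := by
  classical
  set q := n / r with hqd
  set s := n % r with hsd
  have ht1 := cover_pos hkm ht
  have hlam : ∃ lam, r - 2 ≤ 2 ^ lam ∧ 1 + 2 * lam ≤ D := by
    have hDge := choose_le_D (by norm_num) (by omega) hD
    simp only [Nat.add_one_sub_one, Nat.choose_one_right] at hDge
    by_cases h5 : r = 5
    · subst h5
      refine ⟨2, by norm_num, ?_⟩
      rw [hD]; decide
    by_cases h7 : r = 7
    · subst h7
      refine ⟨3, by norm_num, ?_⟩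
      rw [hD]; decide
    by_cases h4 : r = 4
    · subst h4
      exact ⟨1, by norm_num, by omega⟩
    exact ⟨(r - 2) / 2, h2_arith _ (by omega), by omega⟩
  obtain ⟨lam, hlam, hlamD⟩ := hlam
  let bit : ℕ → ℕ → Bool := fun b i => if i < s then i.testBit b else (i - s).testBit b
  let χ : Option ℕ → ℕ × ℕ → ℕ := fun a v => match a with
    | none => v.1
    | some b => if v.2 = q ∧ bit b v.1 = false then s else v.1
  let φ : Option ℕ → ℕ × ℕ → ℕ × ℕ := fun a v => match a with
    | none => if v.1 < s then (1, v.2) else (0, v.2)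
    | some b => if bit b v.1 then (1, v.2) else (0, v.2 % q)
  let I : Finset (Option ℕ) := insert none ((range lam).image some)
  have hI : I.card = 1 + lam := by
    rw [card_insert_of_notMem (by simp), card_image_of_injective _ (Option.some_injective _),
      card_range, add_comm]
  have hsr' : s ≤ r := by omega
  have key := machine_grid (n := n) (m := m) (k := k) (r := r) (p := 3) (t := t) (by omega)
    I χ I φ ?_ ?_ ?_ ht
  · refine key.mono ?_ ?_
    · rw [hI]; omega
    · rw [hI]; nlinarith
  · intro a _ v hv
    rw [mem_grid hsr'] at hv
    rcases a with _ | b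
    · exact hv.1
    · simp only [χ]; split_ifs <;> omega
  · intro b _
    have hsub : (grid r q s).image (φ b) ⊆ ({0} ×ˢ range q) ∪ ({1} ×ˢ range (q + 1)) := by
      intro y hy
      obtain ⟨v, hv, rfl⟩ := mem_image.1 hy
      rw [mem_grid hsr'] at hv
      have hmod : v.2 % q < q := Nat.mod_lt _ hq
      rcases b with _ | b
      · simp only [φ]; split_ifs with h1
        · simp; omega
        · simp; omega
      · simp only [φ]; split_ifs with h1
        · simp; omega
        · simp; omega
    refine (card_le_card hsub).trans ((card_union_le _ _).trans ?_)
    simp only [card_product, card_singleton, card_range]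
    omega
  · intro e heV hek
    by_cases hbase : 3 ≤ (e.image Prod.fst).card
    · exact Or.inl ⟨none, mem_insert_self _ _, hbase⟩
    have hcls : ∃ i j, i < r ∧ j < r ∧ (∀ v ∈ e, v.1 = i ∨ v.1 = j) ∧ (∃ v ∈ e, v.1 = i) ∧
        (∃ v ∈ e, v.1 = j) := by
      have hne : (e.image Prod.fst).Nonempty := by
        apply Finset.Nonempty.image; rw [← card_pos]; omega
      obtain ⟨i, hi⟩ := hne
      have hir : ∀ i ∈ e.image Prod.fst, i < r ∧ ∃ v ∈ e, v.1 = i := by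
        intro i hi
        obtain ⟨v, hv, rfl⟩ := mem_image.1 hi
        exact ⟨((mem_grid hsr').1 (heV hv)).1, v, hv, rfl⟩
      have h1 : ((e.image Prod.fst).erase i).card ≤ 1 := by
        rw [card_erase_of_mem hi]; omega
      by_cases hE : ((e.image Prod.fst).erase i).Nonempty
      · obtain ⟨j, hj⟩ := hE
        refine ⟨i, j, (hir i hi).1, (hir j (mem_of_mem_erase hj)).1, ?_, (hir i hi).2,
          (hir j (mem_of_mem_erase hj)).2⟩
        intro v hv
        by_cases hvi : v.1 = i
        · exact Or.inl hvi
        · exact Or.inr (card_le_one.1 h1 _ (mem_erase.2 ⟨hvi, mem_image_of_mem _ hv⟩) _ hj)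
      · refine ⟨i, i, (hir i hi).1, (hir i hi).1, ?_, (hir i hi).2, (hir i hi).2⟩
        intro v hv
        by_contra hvi
        exact hE ⟨v.1, mem_erase.2 ⟨fun h => hvi (Or.inl h), mem_image_of_mem _ hv⟩⟩
    obtain ⟨i, j, hi, hj, hij, ⟨vi, hvi, hvi1⟩, ⟨vj, hvj, hvj1⟩⟩ := hcls
    have hpair : ∀ u v : ℕ × ℕ, u.1 = v.1 → u.2 = v.2 → u = v := fun u v => Prod.ext
    by_cases hA : i = j ∨ ((i < s) ≠ (j < s))
    · right
      refine ⟨none, mem_insert_self _ _, ?_⟩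
      intro u hu v hv huv
      have h1 := hij u hu
      have h2 := hij v hv
      simp only [φ] at huv
      apply hpair
      · grind
      · split_ifs at huv <;> simpa using huv
    push Not at hA
    obtain ⟨hne, hss⟩ := hA
    obtain ⟨b, hb, hbb⟩ : ∃ b < lam, bit b i ≠ bit b j := by
      by_cases h1 : i < s
      · have h2 : j < s := hss ▸ h1
        obtain ⟨b, hb, hbb⟩ := exists_testBit_ne (a := i) (b := j) (lam := lam) (by omega) (by omega)
          hne
        exact ⟨b, hb, by simpa [bit, h1, h2] using hbb⟩
      · have h2 : ¬ j < s := hss ▸ h1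
        obtain ⟨b, hb, hbb⟩ := exists_testBit_ne (a := i - s) (b := j - s) (lam := lam) (by omega)
          (by omega) (by omega)
        exact ⟨b, hb, by simpa [bit, h1, h2] using hbb⟩
    have hbI : some b ∈ I := mem_insert_of_mem (mem_image_of_mem _ (mem_range.2 hb))
    -- wlog `i` has bit `0`
    obtain ⟨i, j, hi, hj, hij, vj, hvj, hvj1, hbi, hbj, hne⟩ : ∃ i j, i < r ∧ j < r ∧
        (∀ v ∈ e, v.1 = i ∨ v.1 = j) ∧ ∃ vj ∈ e, vj.1 = j ∧ bit b i = false ∧ bit b j = true ∧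
        ((i < s) = (j < s)) := by
      rcases hbi : bit b i with _ | _
      · refine ⟨i, j, hi, hj, hij, vj, hvj, hvj1, hbi, ?_, hss⟩
        rw [hbi] at hbb
        simpa using hbb.symm
      · refine ⟨j, i, hj, hi, fun v hv => (hij v hv).symm, vi, hvi, hvi1, ?_, hbi, hss.symm⟩
        rw [hbi] at hbb
        simpa using hbb.symm
    by_cases hbad : i < s ∧ (i, 0) ∈ e ∧ (i, q) ∈ e
    · left
      refine ⟨some b, hbI, ?_⟩
      have hjs : j < s := hne ▸ hbad.1
      have hsub : {i, s, j} ⊆ e.image (χ (some b)) := by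
        intro x hx
        simp only [mem_insert, mem_singleton] at hx
        rcases hx with rfl | rfl | rfl
        · refine mem_image.2 ⟨_, hbad.2.1, ?_⟩
          simp only [χ]; rw [if_neg (by omega)]
        · refine mem_image.2 ⟨_, hbad.2.2, ?_⟩
          simp only [χ]; rw [if_pos (by exact ⟨trivial, hbi⟩)]
        · refine mem_image.2 ⟨_, hvj, ?_⟩
          simp only [χ]; rw [if_neg (by rw [hvj1, hbj]; simp), hvj1]
      have hij' : i ≠ j := fun h => by rw [h, hbj] at hbi; simp at hbi
      have : ({i, s, j} : Finset ℕ).card = 3 := by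
        rw [card_eq_three]
        exact ⟨i, s, j, by omega, hij', by omega, rfl⟩
      rw [← this]
      exact card_le_card hsub
    · right
      refine ⟨some b, hbI, ?_⟩
      intro u hu v hv huv
      have hu' := (mem_grid hsr').1 (heV hu)
      have hv' := (mem_grid hsr').1 (heV hv)
      have h1 := hij u hu
      have h2 := hij v hv
      simp only [φ] at huv
      rcases h1 with h1 | h1 <;> rcases h2 with h2 | h2 <;> rw [h1, h2] at huv <;>
        simp only [hbi, hbj, if_true, Bool.false_eq_true, if_false, Prod.mk.injEq, true_and] at huv
      · apply hpair _ _ (h1.trans h2.symm)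
        rw [h1] at hu'
        rw [h2] at hv'
        have e1 : u = (i, u.2) := hpair _ _ h1 rfl
        have e2 : v = (i, v.2) := hpair _ _ h2 rfl
        rcases hu'.2 with hu2 | ⟨hu2, hus⟩ <;> rcases hv'.2 with hv2 | ⟨hv2, hvs⟩
        · rwa [Nat.mod_eq_of_lt hu2, Nat.mod_eq_of_lt hv2] at huv
        · exfalso
          rw [Nat.mod_eq_of_lt hu2, hv2, Nat.mod_self] at huv
          rw [huv] at e1; rw [hv2] at e2
          exact hbad ⟨hvs, e1 ▸ hu, e2 ▸ hv⟩
        · exfalso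
          rw [Nat.mod_eq_of_lt hv2, hu2, Nat.mod_self] at huv
          rw [← huv] at e2; rw [hu2] at e1
          exact hbad ⟨hus, e2 ▸ hv, e1 ▸ hu⟩
        · omega
      · omega
      · omega
      · exact hpair _ _ (h1.trans h2.symm) huv
theorem card_gridOn (r q s : ℕ) (W : Finset ℕ) :
    ((grid r q s).filter (fun v => v.1 ∈ W)).card ≤ W.card * q + (W.filter (· < s)).card := by
  have hsub : (grid r q s).filter (fun v => v.1 ∈ W) ⊆
      (W ×ˢ range q) ∪ ((W.filter (· < s)) ×ˢ {q}) := by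
    intro v hv
    simp only [grid, mem_filter, mem_union, mem_product, mem_range, mem_singleton] at hv ⊢
    tauto
  refine (card_le_card hsub).trans ((card_union_le _ _).trans ?_)
  simp

/-- The case `l = 2` with many hosts. -/
theorem case_l2 {n k r m t z D : ℕ} (hr5 : 5 ≤ r) (hk : r - 1 ≤ k) (hkm : k ≤ m)
    (hs1 : r ≤ 2 * (n % r)) (hs2 : n % r + 2 ≤ r) (hq : 1 ≤ n / r)
    (hm : m = (r - 2) * (n / r) + (n % r - 1)) (hz : 2 ^ z ≤ r)
    (hzq : r - n % r - 1 ≤ z * (n / r)) (hD : D = r.choose 2)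
    (ht : HasStrongCover (completeEdges m k) r (r - 1) t) :
    HasStrongCover (completeEdges n k) r (r - 1) (1 + D * t) := by
  classical
  set q := n / r with hqd
  set s := n % r with hsd
  have ht1 := cover_pos hkm ht
  have hsr : s ≤ r := by omega
  have hzs : z ≤ s := by
    have h1 : ∀ z, 2 * z ≤ 2 ^ z := by
      intro z
      induction z with
      | zero => simp
      | succ z ih =>
        rcases Nat.eq_zero_or_pos z with rfl | hz
        · simp
        · rw [pow_succ]; omega
    have := h1 z
    omega
  let host : ℕ → ℕ := fun i => (i - s) / q
  let gp : ℕ → ℕ := fun i => (i - s) % q + 1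
  let χ : Finset ℕ → ℕ × ℕ → ℕ := fun Y v =>
    if v.1 ∈ Y ∧ 1 ≤ v.2 ∧ s + (v.1 * q + (v.2 - 1)) < r then s + (v.1 * q + (v.2 - 1)) else v.1
  let Ic := (range z).powerset
  let Im : Finset (Σ _ : ℕ, ℕ) := (range (r - 1)).sigma (fun j => range j)
  let φ : (Σ _ : ℕ, ℕ) → ℕ × ℕ → ℕ × ℕ := fun L v =>
    if v.1 = L.2 + 1 ∨ v.1 = L.1 + 1 then
      (if L.2 + 1 < s then (0, v.2) else (0, 0))
    else if ¬ L.2 + 1 < s ∧ v = (host (L.2 + 1), gp (L.2 + 1)) then (host (L.2 + 1), 0)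
    else v
  have hIm : Im.card = (r - 1).choose 2 := by
    rw [card_sigma, Nat.choose_two_right, ← sum_range_id]
    simp
  have hDr : D = (r - 1).choose 2 + (r - 1) := by
    obtain ⟨r', rfl⟩ : ∃ r', r = r' + 1 := ⟨r - 1, by omega⟩
    rw [hD, Nat.choose_succ_succ' r' 1]; simp; ring
  have hIc : Ic.card = 2 ^ z := by simp [Ic]
  have hhost : ∀ i j, s ≤ i → i < j → j < r → host i < z ∧ gp i ≤ q ∧ 1 ≤ gp i ∧
      s + (host i * q + (gp i - 1)) = i := by
    intro i j hi hij hj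
    have h1 : (i - s) / q < z := by
      rw [Nat.div_lt_iff_lt_mul hq]; omega
    have h2 : (i - s) % q < q := Nat.mod_lt _ hq
    have h3 := Nat.div_add_mod (i - s) q
    have h4 : q * ((i - s) / q) = (i - s) / q * q := mul_comm _ _
    simp only [host, gp]
    omega
  have key := machine_grid (n := n) (m := m) (k := k) (r := r) (p := r - 1) (t := t) (by omega)
    Ic χ Im φ ?_ ?_ ?_ ht
  · refine key.mono ?_ ?_
    · rw [hIc]; have := Nat.one_le_two_pow (n := z); omega
    · rw [hIc, hIm, hDr, add_mul]
      have : (r - 1) * 1 ≤ (r - 1) * t := Nat.mul_le_mul_left _ ht1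
      omega
  · intro a _ v hv
    rw [mem_grid hsr] at hv
    simp only [χ]; split_ifs <;> omega
  · rintro ⟨j, i⟩ hL
    simp only [Im, mem_sigma, mem_range] at hL
    let W := (range r \ {i + 1, j + 1})
    have hW0 : 0 ∈ W := by simp [W]; omega
    have hWc : W.card = r - 2 := by
      rw [card_sdiff_of_subset, card_range, card_pair (by omega)]
      intro x; simp; omega
    have h0 : ∀ x, x < q ∨ x = q → (0, x) ∈ (grid r q s).filter (fun v => v.1 ∈ W) := by
      intro x hx
      refine mem_filter.2 ⟨(mem_grid hsr).2 ⟨by simp; omega, ?_⟩, hW0⟩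
      rcases hx with hx | hx
      · exact Or.inl hx
      · exact Or.inr ⟨hx, by simp; omega⟩
    have hWm : ∀ x, x < r → ¬ (x = i + 1 ∨ x = j + 1) → x ∈ W := by
      intro x hx hx'
      simp [W]; omega
    by_cases hi : i + 1 < s
    · have hsub : (grid r q s).image (φ ⟨j, i⟩) ⊆ (grid r q s).filter (fun v => v.1 ∈ W) := by
        intro y hy
        obtain ⟨v, hv, rfl⟩ := mem_image.1 hy
        have hv' := (mem_grid hsr).1 hv
        simp only [φ]
        split_ifs with h1 h2 h2
        · exact h0 _ (by omega)
        · exact absurd hi h2.1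
        · exact mem_filter.2 ⟨hv, hWm _ hv'.1 h1⟩
      have hWs : (W.filter (· < s)).card ≤ s - 1 := by
        have : W.filter (· < s) ⊆ (range s).erase (i + 1) := by
          intro x; simp [W]; omega
        refine (card_le_card this).trans ?_
        rw [card_erase_of_mem (by simpa using hi), card_range]
      refine (card_le_card hsub).trans ((card_gridOn _ _ _ _).trans ?_)
      rw [hWc]; omega
    · obtain ⟨g1, g2, g3, g4⟩ := hhost (i + 1) (j + 1) (by omega) (by omega) (by omega)
      have hHW : host (i + 1) ∈ W := hWm _ (by omega) (by omega)
      have hsub : (grid r q s).image (φ ⟨j, i⟩) ⊆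
          ((grid r q s).filter (fun v => v.1 ∈ W)).erase (host (i + 1), gp (i + 1)) := by
        intro y hy
        obtain ⟨v, hv, rfl⟩ := mem_image.1 hy
        have hv' := (mem_grid hsr).1 hv
        rw [mem_erase]
        simp only [φ]
        split_ifs with h1 h2
        · refine ⟨?_, h0 _ (by omega)⟩
          simp only [ne_eq, Prod.mk.injEq]; omega
        · refine ⟨by simp only [ne_eq, Prod.mk.injEq]; omega, mem_filter.2 ⟨(mem_grid hsr).2 ?_, hHW⟩⟩
          simp only; omega
        · exact ⟨fun h => h2 ⟨hi, h⟩, mem_filter.2 ⟨hv, hWm _ hv'.1 h1⟩⟩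
      have hmem : (host (i + 1), gp (i + 1)) ∈ (grid r q s).filter (fun v => v.1 ∈ W) := by
        refine mem_filter.2 ⟨(mem_grid hsr).2 ?_, hHW⟩
        simp only; omega
      refine (card_le_card hsub).trans ?_
      rw [card_erase_of_mem hmem]
      have h3 := card_gridOn r q s W
      have h4 : (W.filter (· < s)).card ≤ s := by
        refine (card_le_card (t := range s) ?_).trans (by simp)
        intro x; simp
      rw [hWc] at h3
      omega
  · intro e heV hek
    set U := e.image Prod.fst with hU
    have hUr : U ⊆ range r := by
      intro x hx
      obtain ⟨v, hv, rfl⟩ := mem_image.1 hx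
      exact mem_range.2 ((mem_grid hsr).1 (heV hv)).1
    have hUe : ∀ v ∈ e, v.1 ∈ U := fun v hv => mem_image_of_mem _ hv
    by_cases hbase : r - 1 ≤ U.card
    · left
      refine ⟨∅, by simp [Ic], ?_⟩
      have : χ ∅ = Prod.fst := by
        funext v; simp [χ]
      rw [this]; exact hbase
    set M := range r \ U with hM
    have hMc : 2 ≤ M.card := by
      rw [card_sdiff_of_subset hUr, card_range]; omega
    have hMr : ∀ x ∈ M, x < r := fun x hx => by simpa using (mem_sdiff.1 hx).1
    have hMU : ∀ x ∈ M, ∀ v ∈ e, v.1 ≠ x := fun x hx v hv h =>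
      (mem_sdiff.1 hx).2 (h ▸ hUe v hv)
    have hpair : ∀ u v : ℕ × ℕ, u.1 = v.1 → u.2 = v.2 → u = v := fun u v => Prod.ext
    -- using a pair `L` containing a big class
    have hbigL : ∀ i j, 1 ≤ i → 1 ≤ j → i < r → j < r → i ≠ j → (i < s ∨ j < s) →
        (∀ v ∈ e, v.1 ≠ i) → ((∀ v ∈ e, v.1 ≠ j) ∨ ∀ v ∈ e, v.1 ≠ 0) →
        ∃ b ∈ Im, Set.InjOn (φ b) (e : Set (ℕ × ℕ)) := by
      intro i j hi hj hir hjr hij his hmi hmj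
      obtain ⟨a, b, hab, hLab⟩ : ∃ a b, a < b ∧ ((a + 1 = i ∧ b + 1 = j) ∨ (a + 1 = j ∧ b + 1 = i)) := by
        rcases lt_or_gt_of_ne hij with h | h
        · exact ⟨i - 1, j - 1, by omega, by omega⟩
        · exact ⟨j - 1, i - 1, by omega, by omega⟩
      have has : a + 1 < s := by omega
      refine ⟨⟨b, a⟩, ?_, ?_⟩
      · simp only [Im, mem_sigma, mem_range]; omega
      · intro u hu v hv huv
        simp only [φ, if_pos has, has, not_true_eq_false, false_and, if_false] at huv
        have e1 := hmi u hu
        have e2 := hmi v hv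
        split_ifs at huv with h1 h2 h2
        · have : u.1 = v.1 := by omega
          exact hpair _ _ this (by simpa using huv)
        · exfalso
          have e3 : v.1 = 0 := by rw [← huv]
          rcases hmj with hmj | hmj
          · have := hmj u hu; omega
          · exact hmj v hv e3
        · exfalso
          have e3 : u.1 = 0 := by rw [huv]
          rcases hmj with hmj | hmj
          · have := hmj v hv; omega
          · exact hmj u hu e3
        · exact huv
    by_cases h0 : 0 ∈ M
    · right
      obtain ⟨y, hy⟩ := card_pos.1 (show 0 < (M.erase 0).card by rw [card_erase_of_mem h0]; omega)
      obtain ⟨hy0, hyM⟩ := mem_erase.1 hy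
      by_cases hy1 : y = 1
      · exact hbigL y 2 (by omega) (by omega) (hMr y hyM) (by omega) (by omega) (by omega)
          (hMU y hyM) (Or.inr (hMU 0 h0))
      · exact hbigL y 1 (by omega) (by omega) (hMr y hyM) (by omega) (by omega) (by omega)
          (hMU y hyM) (Or.inr (hMU 0 h0))
    by_cases hbig : ∃ y ∈ M, y < s
    · right
      obtain ⟨y, hyM, hys⟩ := hbig
      obtain ⟨x, hx⟩ := card_pos.1 (show 0 < (M.erase y).card by rw [card_erase_of_mem hyM]; omega)
      obtain ⟨hxy, hxM⟩ := mem_erase.1 hx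
      have a1 : y ≠ 0 := fun h => h0 (h ▸ hyM)
      have a2 : x ≠ 0 := fun h => h0 (h ▸ hxM)
      exact hbigL y x (by omega) (by omega) (hMr y hyM) (hMr x hxM) (Ne.symm hxy) (Or.inl hys)
        (hMU y hyM) (Or.inl (hMU x hxM))
    push Not at hbig
    have hMne : M.Nonempty := by rw [← card_pos]; omega
    set μ := M.max' hMne with hμ
    have hμM : μ ∈ M := M.max'_mem hMne
    set M0 := M.erase μ with hM0
    have hM0lt : ∀ i ∈ M0, i < μ := by
      intro i hi
      obtain ⟨h1, h2⟩ := mem_erase.1 hi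
      exact lt_of_le_of_ne (M.le_max' i h2) h1
    have hM0M : ∀ i ∈ M0, i ∈ M := fun i hi => mem_of_mem_erase hi
    by_cases hex : ∃ i ∈ M0, ¬ ((host i, 0) ∈ e ∧ (host i, gp i) ∈ e)
    · right
      obtain ⟨i, hi, hne⟩ := hex
      have his := hbig i (hM0M i hi)
      have hiμ := hM0lt i hi
      have hμr := hMr μ hμM
      obtain ⟨g1, g2, g3, g4⟩ := hhost i μ his hiμ hμr
      have ei : i - 1 + 1 = i := by omega
      refine ⟨⟨μ - 1, i - 1⟩, ?_, ?_⟩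
      · simp only [Im, mem_sigma, mem_range]; omega
      · have hval : ∀ u ∈ e, φ ⟨μ - 1, i - 1⟩ u = if u = (host i, gp i) then (host i, 0) else u := by
          intro u hu
          have e1 := hMU i (hM0M i hi) u hu
          have e2 := hMU μ hμM u hu
          simp only [φ, ei]
          rw [if_neg (by omega)]
          simp only [not_lt.2 his, not_false_eq_true, true_and]
        intro u hu v hv huv
        rw [hval u hu, hval v hv] at huv
        split_ifs at huv with h1 h2 h2
        · rw [h1, h2]
        · exact absurd ⟨huv ▸ hv, h1 ▸ hu⟩ hne
        · exact absurd ⟨huv ▸ hu, h2 ▸ hv⟩ hne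
        · exact huv
    · left
      push Not at hex
      refine ⟨M0.image host, ?_, ?_⟩
      · rw [mem_powerset]
        intro x hx
        obtain ⟨i, hi, rfl⟩ := mem_image.1 hx
        exact mem_range.2 (hhost i μ (hbig i (hM0M i hi)) (hM0lt i hi) (hMr μ hμM)).1
      · have hsub : U ∪ M0 ⊆ e.image (χ (M0.image host)) := by
          intro x hx
          rcases mem_union.1 hx with hx | hx
          · by_cases hxY : x ∈ M0.image host
            · obtain ⟨i, hi, rfl⟩ := mem_image.1 hxY
              refine mem_image.2 ⟨_, (hex i hi).1, ?_⟩
              simp only [χ]; rw [if_neg (by omega)]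
            · obtain ⟨v, hv, rfl⟩ := mem_image.1 hx
              refine mem_image.2 ⟨v, hv, ?_⟩
              simp only [χ]; rw [if_neg (fun h => hxY h.1)]
          · obtain ⟨g1, g2, g3, g4⟩ := hhost x μ (hbig x (hM0M x hx)) (hM0lt x hx) (hMr μ hμM)
            refine mem_image.2 ⟨_, (hex x hx).2, ?_⟩
            have hxr := hMr x (hM0M x hx)
            simp only [χ]
            rw [if_pos ⟨mem_image_of_mem _ hx, g3, by omega⟩, g4]
        refine le_trans ?_ (card_le_card hsub)
        rw [card_union_of_disjoint, card_erase_of_mem hμM]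
        · have : M.card = r - U.card := by rw [card_sdiff_of_subset hUr, card_range]
          omega
        · rw [disjoint_right]
          intro x hx hxU
          exact (mem_sdiff.1 (hM0M x hx)).2 hxU
/-- Rank function collapsing the set `A`. -/
def rk (A : Finset ℕ) (x : ℕ) : ℕ := if x ∈ A then 0 else ((Icc 1 x) \ A).card

theorem rk_inj {A : Finset ℕ} (h0 : 0 ∈ A) {x y : ℕ} (h : rk A x = rk A y)
    (hA : x ∈ A → y ∈ A → x = y) : x = y := by
  have hpos : ∀ x, x ∉ A → x ∈ (Icc 1 x) \ A := by
    intro x hx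
    have : x ≠ 0 := fun h => hx (h ▸ h0)
    simp [hx]; omega
  have hlt : ∀ x y, x < y → y ∉ A → ((Icc 1 x) \ A).card < ((Icc 1 y) \ A).card := by
    intro x y hxy hy
    apply card_lt_card
    rw [Finset.ssubset_iff_of_subset]
    · exact ⟨y, hpos y hy, by simp; omega⟩
    · intro z hz
      obtain ⟨h1, h2⟩ := mem_sdiff.1 hz
      rw [mem_Icc] at h1
      exact mem_sdiff.2 ⟨mem_Icc.2 ⟨h1.1, by omega⟩, h2⟩
  unfold rk at h
  split_ifs at h with h1 h2 h2
  · exact hA h1 h2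
  · have := card_pos.2 ⟨y, hpos y h2⟩; omega
  · have := card_pos.2 ⟨x, hpos x h1⟩; omega
  · rcases lt_trichotomy x y with h3 | h3 | h3
    · have := hlt x y h3 h2; omega
    · exact h3
    · have := hlt y x h3 h1; omega

/-- The main structural scheme, with an abstract saving family. -/
theorem case3_abs {n k r h l m t c σ ε : ℕ} (hrl : r = h + l) (hh : 3 ≤ h) (hk : h + 1 ≤ k)
    (hkm : k ≤ m) (hsc : n % r = c + σ) (hσ1 : 1 ≤ σ) (hσl : σ < l) (hc1 : 1 ≤ c) (hch : c < h)
    (hqh : h - c ≤ n / r) (hm : m = h * (n / r) + c)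
    (R 𝒯 : Finset ℕ) (hR : R ⊆ Ico 1 r) (h𝒯 : 𝒯 ⊆ Ico 1 r) (hRc : R.card = h - 2)
    (hR𝒯 : Disjoint R 𝒯) (h𝒯c : σ + 1 ≤ 𝒯.card) (hε : ∀ x ∈ 𝒯, x < n % r → 1 ≤ ε)
    (hbR : 1 + (R.filter (· < n % r)).card + ε ≤ c)
    (ht : HasStrongCover (completeEdges m k) r (h + 1) t) :
    HasStrongCover (completeEdges n k) r (h + 1) (1 + (r - 1).choose (h - 1) * t) := by
  classical
  set q := n / r with hqd
  set s := n % r with hsd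
  have ht1 := cover_pos hkm ht
  have hsr : s < r := Nat.mod_lt _ (by omega)
  have hsr' : s ≤ r := hsr.le
  have hq1 : 1 ≤ q := by omega
  let st := s + l - σ
  have hst : st + (h - c) = r := by omega
  let Lset := powersetCard l (Ico 1 r)
  let bg : Finset ℕ → ℕ := fun L => (L.filter (· < s)).card
  let τ : Finset ℕ → ℕ := fun L => σ - bg L
  let pos : ℕ → ℕ := fun i => i - st + 1
  have hCex : ∀ L, ∃ C, L ∈ Lset → C ⊆ L.filter (fun i => st ≤ i) ∧ C.card = τ L := by
    intro L
    by_cases hL : L ∈ Lset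
    · obtain ⟨hL1, hL2⟩ := mem_powersetCard.1 hL
      have h1 : L.card ≤ bg L + (l - σ) + (L.filter (fun i => st ≤ i)).card := by
        have hsub : L ⊆ (L.filter (· < s)) ∪ (Ico s st) ∪ (L.filter (fun i => st ≤ i)) := by
          intro x hx
          simp only [mem_union, mem_filter, mem_Ico, hx, true_and]; omega
        refine (card_le_card hsub).trans ((card_union_le _ _).trans ?_)
        refine Nat.add_le_add_right ((card_union_le _ _).trans ?_) _
        simp only [bg, Nat.card_Ico, st]; omega
      obtain ⟨C, hC1, hC2⟩ := exists_subset_card_eq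
        (s := L.filter (fun i => st ≤ i)) (n := τ L) (by simp only [τ]; omega)
      exact ⟨C, fun _ => ⟨hC1, hC2⟩⟩
    · exact ⟨∅, fun h => absurd h hL⟩
  choose C hC using hCex
  let A : Finset ℕ → Finset ℕ := fun L => insert 0 ((C L).image pos)
  let χ : ℕ → ℕ × ℕ → ℕ := fun b v =>
    if b = 0 then (if v.1 = 0 ∧ 1 ≤ v.2 ∧ v.2 ≤ h - c then st + (v.2 - 1) else v.1)
    else if b = σ then v.1
    else if v.2 = b ∧ v.1 < s then 0 else v.1
  let φ : Option (Finset ℕ) → ℕ × ℕ → ℕ × ℕ := fun o v => match o with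
    | none => if v.1 = 0 ∨ v.1 ∈ R then v else if v.1 ∈ 𝒯 then (r, v.2) else (0, 0)
    | some L => if v.1 = 0 then (0, rk (A L) v.2) else if v.1 ∈ L then
        (if v.1 < s then (0, v.2 - τ L) else (0, v.2 - (τ L - 1))) else v
  let Ic := range (σ + 1)
  let Lgood := Lset.filter (fun L => ¬ (Disjoint R L ∧ ∃ x ∈ 𝒯, x ∉ L))
  let Im : Finset (Option (Finset ℕ)) := insert none (Lgood.image some)
  have hLset : Lset.card = (r - 1).choose (h - 1) := by
    rw [card_powersetCard, Nat.card_Ico, ← Nat.choose_symm (by omega)]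
    congr 1; omega
  have hLgood : Lgood.card + 𝒯.card ≤ Lset.card := by
    let f : ℕ → Finset ℕ := fun x => (Ico 1 r \ R).erase x
    have hxm : ∀ x ∈ 𝒯, x ∈ Ico 1 r \ R := fun x hx =>
      mem_sdiff.2 ⟨h𝒯 hx, fun h => (disjoint_left.1 hR𝒯) h hx⟩
    have hfi : Set.InjOn f (𝒯 : Set ℕ) := by
      intro x hx y hy hxy
      exact (erase_inj _ (hxm x hx)).1 hxy
    rw [← card_image_of_injOn hfi, ← card_union_of_disjoint]
    · apply card_le_card
      apply union_subset (filter_subset _ _)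
      intro L hL
      obtain ⟨x, hx, rfl⟩ := mem_image.1 hL
      refine mem_powersetCard.2 ⟨(erase_subset _ _).trans sdiff_subset, ?_⟩
      rw [card_erase_of_mem (hxm x hx), card_sdiff_of_subset hR, Nat.card_Ico]; omega
    · rw [disjoint_left]
      intro L hL1 hL2
      obtain ⟨x, hx, rfl⟩ := mem_image.1 hL2
      refine (mem_filter.1 hL1).2 ⟨?_, x, hx, by simp [f]⟩
      rw [disjoint_right]
      intro y hy
      exact (mem_sdiff.1 (mem_of_mem_erase hy)).2
  have hImc : Im.card ≤ Lgood.card + 1 := by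
    refine (card_insert_le _ _).trans ?_
    exact Nat.add_le_add_right card_image_le _
  have hposA : ∀ L ∈ Lset, (C L).image pos ⊆ Icc 1 q ∧ ((C L).image pos).card = τ L := by
    intro L hL
    obtain ⟨h1, h2⟩ := hC L hL
    have h3 : ∀ i ∈ C L, st ≤ i ∧ i < r := by
      intro i hi
      obtain ⟨h4, h5⟩ := mem_filter.1 (h1 hi)
      exact ⟨h5, by simpa using ((mem_Ico.1 ((mem_powersetCard.1 hL).1 h4)).2)⟩
    constructor
    · intro x hx
      obtain ⟨i, hi, rfl⟩ := mem_image.1 hx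
      have := h3 i hi
      simp only [pos, mem_Icc]; omega
    · rw [card_image_of_injOn, h2]
      intro i hi j hj hij
      have := h3 i hi
      have := h3 j hj
      simp only [pos] at hij; omega
  have key := machine_grid (n := n) (m := m) (k := k) (r := r) (p := h + 1) (t := t) (by omega)
    Ic χ Im φ ?_ ?_ ?_ ht
  · refine key.mono ?_ ?_
    · simp [Ic]; omega
    · have hle : Im.card + σ ≤ (r - 1).choose (h - 1) := by rw [← hLset]; omega
      have h1 : (Im.card + σ) * t ≤ (r - 1).choose (h - 1) * t := Nat.mul_le_mul_right _ hle
      have h2 : σ * 1 ≤ σ * t := Nat.mul_le_mul_left _ ht1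
      simp only [Ic, card_range]
      rw [add_mul] at h1
      omega
  · intro b _ v hv
    rw [mem_grid hsr'] at hv
    simp only [χ]; split_ifs <;> omega
  · intro o ho
    rcases o with _ | L
    · have hsub : (grid r q s).image (φ none) ⊆
          ((grid r q s).filter (fun v => v.1 ∈ insert 0 R)) ∪ ({r} ×ˢ range (q + ε)) := by
        intro y hy
        obtain ⟨v, hv, rfl⟩ := mem_image.1 hy
        have hv' := (mem_grid hsr').1 hv
        rw [mem_union]
        simp only [φ]
        split_ifs with h1 h2
        · left; exact mem_filter.2 ⟨hv, mem_insert.2 h1⟩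
        · right
          refine mem_product.2 ⟨mem_singleton.2 rfl, mem_range.2 ?_⟩
          have := hε _ h2
          simp only; omega
        · left
          refine mem_filter.2 ⟨(mem_grid hsr').2 ⟨by simp only; omega, Or.inl hq1⟩, by simp⟩
      have h0R : 0 ∉ R := fun h => by simpa using hR h
      refine (card_le_card hsub).trans ((card_union_le _ _).trans ?_)
      have h1 := card_gridOn r q s (insert 0 R)
      rw [card_insert_of_notMem h0R, hRc, filter_insert, if_pos (by omega),
        card_insert_of_notMem (by simp [h0R])] at h1
      rw [card_product, card_singleton, card_range]
      have h2 : h * q = (h - 2 + 1) * q + q := by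
        obtain ⟨h', rfl⟩ : ∃ h', h = h' + 2 := ⟨h - 2, by omega⟩
        simp; ring
      omega
    · have hL : L ∈ Lset := by
        rcases mem_insert.1 ho with h1 | h1
        · simp at h1
        · obtain ⟨L', hL', h2⟩ := mem_image.1 h1
          rw [← Option.some.inj h2]
          exact (mem_filter.1 hL').1
      obtain ⟨hL1, hL2⟩ := mem_powersetCard.1 hL
      obtain ⟨hp1, hp2⟩ := hposA L hL
      have hτq : τ L ≤ q := by
        rw [← hp2]; exact (card_le_card hp1).trans (by simp)
      have hrk : ∀ x ≤ q, rk (A L) x < q + 1 - τ L := by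
        intro x hx
        unfold rk
        split_ifs with h1
        · omega
        · have : ((Icc 1 x) \ A L) ⊆ (Icc 1 q) \ ((C L).image pos) := by
            intro y hy
            obtain ⟨h3, h4⟩ := mem_sdiff.1 hy
            refine mem_sdiff.2 ⟨?_, fun h5 => h4 (mem_insert_of_mem h5)⟩
            rw [mem_Icc] at h3 ⊢; omega
          have := card_le_card this
          rw [card_sdiff_of_subset hp1, hp2, Nat.card_Icc] at this
          omega
      let W := (Ico 1 r) \ L
      have hsub : (grid r q s).image (φ (some L)) ⊆
          ((grid r q s).filter (fun v => v.1 ∈ W)) ∪ ({0} ×ˢ range (q + 1 - τ L)) := by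
        intro y hy
        obtain ⟨v, hv, rfl⟩ := mem_image.1 hy
        have hv' := (mem_grid hsr').1 hv
        rw [mem_union]
        simp only [φ]
        split_ifs with h1 h2 h3
        · right; simp; exact hrk _ (by omega)
        · right; simp; omega
        · right; simp; omega
        · left
          refine mem_filter.2 ⟨hv, mem_sdiff.2 ⟨?_, h2⟩⟩
          simp; omega
      refine (card_le_card hsub).trans ((card_union_le _ _).trans ?_)
      have h1 := card_gridOn r q s W
      have hWc : W.card = h - 1 := by
        rw [card_sdiff_of_subset hL1, Nat.card_Ico, hL2]; omega
      have hWb : (W.filter (· < s)).card + bg L ≤ s - 1 := by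
        have hd : Disjoint (W.filter (· < s)) (L.filter (· < s)) := by
          rw [disjoint_left]
          intro x hx1 hx2
          exact (mem_sdiff.1 (mem_filter.1 hx1).1).2 (mem_filter.1 hx2).1
        rw [← card_union_of_disjoint hd]
        refine (card_le_card (t := Ico 1 s) ?_).trans (by simp)
        intro x hx
        rcases mem_union.1 hx with hx | hx
        · obtain ⟨h3, h4⟩ := mem_filter.1 hx
          have := mem_Ico.1 (mem_sdiff.1 h3).1
          exact mem_Ico.2 ⟨this.1, h4⟩
        · obtain ⟨h3, h4⟩ := mem_filter.1 hx
          have := mem_Ico.1 (hL1 h3)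
          exact mem_Ico.2 ⟨this.1, h4⟩
      rw [hWc] at h1
      rw [card_product, card_singleton, card_range]
      have h2 : h * q = (h - 1) * q + q := by
        obtain ⟨h', rfl⟩ : ∃ h', h = h' + 1 := ⟨h - 1, by omega⟩
        simp; ring
      simp only [τ] at *
      omega
  · intro e heV hek
    set U := e.image Prod.fst with hU
    have hUr : U ⊆ range r := by
      intro x hx
      obtain ⟨v, hv, rfl⟩ := mem_image.1 hx
      exact mem_range.2 ((mem_grid hsr').1 (heV hv)).1
    have hUe : ∀ v ∈ e, v.1 ∈ U := fun v hv => mem_image_of_mem _ hv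
    by_cases hbase : h + 1 ≤ U.card
    · left
      refine ⟨σ, by simp [Ic], ?_⟩
      have : χ σ = Prod.fst := by
        funext v; simp only [χ]; rw [if_neg (by omega), if_pos trivial]
      rw [this]; exact hbase
    set M := range r \ U with hM
    have hMc : M.card = r - U.card := by rw [card_sdiff_of_subset hUr, card_range]
    have hUc : U.card ≤ r := by simpa using card_le_card hUr
    have hMr : ∀ x ∈ M, x < r := fun x hx => by simpa using (mem_sdiff.1 hx).1
    have hMU : ∀ x ∈ M, ∀ v ∈ e, v.1 ≠ x := fun x hx v hv h =>
      (mem_sdiff.1 hx).2 (h ▸ hUe v hv)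
    have hpair : ∀ u v : ℕ × ℕ, u.1 = v.1 → u.2 = v.2 → u = v := fun u v => Prod.ext
    -- I1
    have hI1 : ∀ L ∈ Lset, (∀ v ∈ e, v.1 ∉ L) →
        (∀ x y, (0, x) ∈ e → (0, y) ∈ e → x ∈ A L → y ∈ A L → x = y) →
        ∃ b ∈ Im, Set.InjOn (φ b) (e : Set (ℕ × ℕ)) := by
      intro L hL hmiss hA
      obtain ⟨hL1, hL2⟩ := mem_powersetCard.1 hL
      by_cases hLg : L ∈ Lgood
      · refine ⟨some L, mem_insert_of_mem (mem_image_of_mem _ hLg), ?_⟩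
        intro u hu v hv huv
        simp only [φ, if_neg (hmiss u hu), if_neg (hmiss v hv)] at huv
        split_ifs at huv with h1 h2 h2
        · apply hpair _ _ (h1.trans h2.symm)
          have e1 : u = (0, u.2) := hpair _ _ h1 rfl
          have e2 : v = (0, v.2) := hpair _ _ h2 rfl
          exact rk_inj (mem_insert_self _ _) (by simpa using huv) (hA _ _ (e1 ▸ hu) (e2 ▸ hv))
        · exact absurd (by rw [← huv]) h2
        · exact absurd (by rw [huv]) h1
        · exact huv
      · refine ⟨none, mem_insert_self _ _, ?_⟩
        have hL' : Disjoint R L ∧ ∃ x ∈ 𝒯, x ∉ L := by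
          by_contra hcon
          exact hLg (mem_filter.2 ⟨hL, hcon⟩)
        obtain ⟨hRL, x, hx, hxL⟩ := hL'
        have hxR : x ∉ R := fun h => (disjoint_left.1 hR𝒯) h hx
        have hWeq : (Ico 1 r) \ L = insert x R := by
          symm
          apply eq_of_subset_of_card_le
          · intro y hy
            rcases mem_insert.1 hy with rfl | hy
            · exact mem_sdiff.2 ⟨h𝒯 hx, hxL⟩
            · exact mem_sdiff.2 ⟨hR hy, disjoint_left.1 hRL hy⟩
          · rw [card_sdiff_of_subset hL1, card_insert_of_notMem hxR, hRc, hL2, Nat.card_Ico]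
            omega
        have hcl : ∀ v ∈ e, (v.1 = 0 ∨ v.1 ∈ R) ∨ v.1 = x := by
          intro v hv
          by_cases h0 : v.1 = 0
          · exact Or.inl (Or.inl h0)
          · have : v.1 ∈ (Ico 1 r) \ L := mem_sdiff.2 ⟨mem_Ico.2 ⟨by omega,
              ((mem_grid hsr').1 (heV hv)).1⟩, hmiss v hv⟩
            rw [hWeq, mem_insert] at this
            tauto
        have hx0 : x ≠ 0 := by have := mem_Ico.1 (h𝒯 hx); omega
        have hval : ∀ v ∈ e, φ none v = if v.1 = x then (r, v.2) else v := by
          intro v hv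
          simp only [φ]
          by_cases h1 : v.1 = x
          · rw [if_neg (by rw [h1]; tauto), if_pos (h1 ▸ hx), if_pos h1]
          · rw [if_pos ((hcl v hv).resolve_right h1), if_neg h1]
        intro u hu v hv huv
        rw [hval u hu, hval v hv] at huv
        have hur := ((mem_grid hsr').1 (heV hu)).1
        have hvr := ((mem_grid hsr').1 (heV hv)).1
        split_ifs at huv with h1 h2 h2
        · exact hpair _ _ (h1.trans h2.symm) (by simpa using huv)
        · rw [← huv] at hvr; simp at hvr
        · rw [huv] at hur; simp at hur
        · exact huv
    -- I2
    have hI2 : ∀ L ∈ Lgood, ∀ y, (∀ v ∈ e, v.1 ≠ 0) → (∀ v ∈ e, v.1 ∈ L → v.1 = y) →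
        (y < s → ∀ u ∈ e, ∀ v ∈ e, u.1 = y → v.1 = y → u.2 ≤ τ L → v.2 ≤ τ L → u.2 = v.2) →
        (¬ y < s → τ L ≤ 1) →
        ∃ b ∈ Im, Set.InjOn (φ b) (e : Set (ℕ × ℕ)) := by
      intro L hLg y h0 hy hyb hys
      refine ⟨some L, mem_insert_of_mem (mem_image_of_mem _ hLg), ?_⟩
      intro u hu v hv huv
      have u0 := h0 u hu
      have v0 := h0 v hv
      simp only [φ, if_neg u0, if_neg v0] at huv
      by_cases h1 : u.1 ∈ L <;> by_cases h2 : v.1 ∈ L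
      · have e1 := hy u hu h1
        have e2 := hy v hv h2
        apply hpair _ _ (e1.trans e2.symm)
        rw [if_pos h1, if_pos h2, e1, e2] at huv
        by_cases h3 : y < s
        · have := hyb h3 u hu v hv e1 e2
          simp only [if_pos h3, Prod.mk.injEq, true_and] at huv
          omega
        · have := hys h3
          simp only [if_neg h3, Prod.mk.injEq, true_and] at huv
          omega
      · rw [if_pos h1, if_neg h2] at huv
        exfalso; apply v0; rw [← huv]; split_ifs <;> rfl
      · rw [if_neg h1, if_pos h2] at huv
        exfalso; apply u0; rw [huv]; split_ifs <;> rfl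
      · rwa [if_neg h1, if_neg h2] at huv
    by_cases h0 : 0 ∈ M
    · have h0e := hMU 0 h0
      by_cases hMl : l + 1 ≤ M.card
      · right
        obtain ⟨L, hL1, hL2⟩ := exists_subset_card_eq (s := M.erase 0) (n := l)
          (by rw [card_erase_of_mem h0]; omega)
        refine hI1 L (mem_powersetCard.2 ⟨?_, hL2⟩) ?_ ?_
        · intro x hx
          obtain ⟨h1, h2⟩ := mem_erase.1 (hL1 hx)
          exact mem_Ico.2 ⟨by omega, hMr x h2⟩
        · intro v hv hvL
          exact hMU _ (mem_of_mem_erase (hL1 hvL)) v hv rfl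
        · intro x y hx
          exact absurd rfl (h0e _ hx)
      have hUh : U.card = h := by omega
      have h0U : 0 ∉ U := (mem_sdiff.1 h0).2
      let Lf : ℕ → Finset ℕ := fun y => (Ico 1 r) \ (U.erase y)
      have hU1 : U ⊆ Ico 1 r := by
        intro x hx
        have : x ≠ 0 := fun h => h0U (h ▸ hx)
        exact mem_Ico.2 ⟨by omega, by simpa using hUr hx⟩
      have hLf : ∀ y ∈ U, Lf y ∈ Lset := by
        intro y hy
        refine mem_powersetCard.2 ⟨sdiff_subset, ?_⟩
        rw [card_sdiff_of_subset ((erase_subset _ _).trans hU1), card_erase_of_mem hy,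
          Nat.card_Ico]; omega
      have hLfy : ∀ y, ∀ v ∈ e, v.1 ∈ Lf y → v.1 = y := by
        intro y v hv hvL
        by_contra hne
        exact (mem_sdiff.1 hvL).2 (mem_erase.2 ⟨hne, hUe v hv⟩)
      -- number of big classes in Lf y
      have hbg : ∀ y ∈ U, bg (Lf y) + (U.filter (· < s)).card = s - 1 + (if y < s then 1 else 0) := by
        intro y hy
        have h1 : (Lf y).filter (· < s) = (Ico 1 s) \ ((U.filter (· < s)).erase y) := by
          ext x
          simp only [Lf, mem_filter, mem_sdiff, mem_Ico, mem_erase]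
          constructor
          · rintro ⟨⟨a, b⟩, d⟩; exact ⟨by omega, fun h => b ⟨h.1, h.2.1⟩⟩
          · rintro ⟨a, b⟩
            exact ⟨⟨by omega, fun h => b ⟨h.1, h.2, by omega⟩⟩, by omega⟩
        have hsubU : U.filter (· < s) ⊆ Ico 1 s := by
          intro x hx
          obtain ⟨a, b⟩ := mem_filter.1 hx
          exact mem_Ico.2 ⟨(mem_Ico.1 (hU1 a)).1, b⟩
        have hle := card_le_card hsubU
        rw [Nat.card_Ico] at hle
        simp only [bg, h1]
        rw [card_sdiff_of_subset ((erase_subset _ _).trans hsubU), Nat.card_Ico]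
        split_ifs with hys
        · have hym : y ∈ U.filter (· < s) := mem_filter.2 ⟨hy, hys⟩
          have := card_pos.2 ⟨y, hym⟩
          rw [card_erase_of_mem hym]; omega
        · rw [erase_eq_of_notMem (by simp [hys])]; omega
      have hUne : U.Nonempty := by rw [← card_pos]; omega
      have hRne : R.Nonempty := by rw [← card_pos]; omega
      by_cases hbU : (U.filter (· < s)).card ≤ c
      · right
        obtain ⟨y, hyU, hyR⟩ : ∃ y ∈ U, (R ⊆ U → y ∈ R) := by
          by_cases hRU : R ⊆ U
          · obtain ⟨y, hy⟩ := hRne; exact ⟨y, hRU hy, fun _ => hy⟩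
          · obtain ⟨y, hy⟩ := hUne; exact ⟨y, hy, fun h => absurd h hRU⟩
        have hb := hbg y hyU
        refine hI2 (Lf y) (mem_filter.2 ⟨hLf y hyU, ?_⟩) y h0e (hLfy y) ?_ ?_
        · rintro ⟨hd, -⟩
          have hRU : ∀ x ∈ R, x ∈ U.erase y := by
            intro x hx
            by_contra hx'
            exact (disjoint_left.1 hd) hx (mem_sdiff.2 ⟨hR hx, hx'⟩)
          have := hyR (fun x hx => mem_of_mem_erase (hRU x hx))
          exact absurd (hRU y this) (notMem_erase _ _)
        · intro hys u hu v hv _ _ h1 h2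
          rw [if_pos hys] at hb
          simp only [τ] at h1 h2; omega
        · intro hys
          rw [if_neg hys] at hb
          simp only [τ]; omega
      · have hbUs : (U.filter (· < s)).card ≤ s - 1 := by
          refine (card_le_card (t := Ico 1 s) ?_).trans (by simp)
          intro x hx
          obtain ⟨a, b⟩ := mem_filter.1 hx
          exact mem_Ico.2 ⟨(mem_Ico.1 (hU1 a)).1, b⟩
        set T := (U.filter (· < s)).card - c with hT
        have hτ : ∀ y ∈ U, y < s → τ (Lf y) = T := by
          intro y hy hys
          have hb := hbg y hy
          rw [if_pos hys] at hb
          simp only [τ]; omega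
        by_cases hex : ∃ y ∈ U, y < s ∧ ∀ u ∈ e, ∀ v ∈ e, u.1 = y → v.1 = y → u.2 ≤ T → v.2 ≤ T →
            u.2 = v.2
        · right
          obtain ⟨y, hyU, hys, hyy⟩ := hex
          refine hI2 (Lf y) (mem_filter.2 ⟨hLf y hyU, ?_⟩) y h0e (hLfy y) ?_ (fun h => absurd hys h)
          · rintro ⟨hd, x, hx, hxL⟩
            have hRU : ∀ x ∈ R, x ∈ U.erase y := by
              intro x hx
              by_contra hx'
              exact (disjoint_left.1 hd) hx (mem_sdiff.2 ⟨hR hx, hx'⟩)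
            have hxU : x ∈ U.erase y := by
              by_contra hx'
              exact hxL (mem_sdiff.2 ⟨h𝒯 hx, hx'⟩)
            have hxR : x ∉ R := fun h => (disjoint_left.1 hR𝒯) h hx
            have hUeq : U.erase y = insert x R := by
              symm
              apply eq_of_subset_of_card_le
              · intro z hz
                rcases mem_insert.1 hz with rfl | hz
                · exact hxU
                · exact hRU z hz
              · rw [card_erase_of_mem hyU, card_insert_of_notMem hxR]; omega
            have hUeq' : U = insert y (insert x R) := by rw [← hUeq, insert_erase hyU]
            have : (U.filter (· < s)).card ≤ 1 + (R.filter (· < s)).card + ε := by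
              rw [hUeq', filter_insert, if_pos hys, filter_insert]
              refine (card_insert_le _ _).trans ?_
              split_ifs with hxs
              · have := hε x hx hxs
                have := card_insert_le x (R.filter (· < s))
                omega
              · omega
            omega
          · intro _
            rw [hτ y hyU hys]; exact hyy
        · left
          push Not at hex
          obtain ⟨y, hy⟩ := card_pos.1 (show 0 < (U.filter (· < s)).card by omega)
          obtain ⟨hyU, hys⟩ := mem_filter.1 hy
          obtain ⟨u, hu, v, hv, hu1, hv1, huT, hvT, huv⟩ := hex y hyU hys
          obtain ⟨w, hw, hw1, hwT, hw0⟩ : ∃ w ∈ e, w.1 = y ∧ w.2 ≤ T ∧ 1 ≤ w.2 := by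
            by_cases h1 : u.2 = 0
            · exact ⟨v, hv, hv1, hvT, by omega⟩
            · exact ⟨u, hu, hu1, huT, by omega⟩
          refine ⟨w.2, by simp [Ic]; omega, ?_⟩
          have hsub : insert 0 U ⊆ e.image (χ w.2) := by
            intro x hx
            rcases mem_insert.1 hx with rfl | hx
            · refine mem_image.2 ⟨w, hw, ?_⟩
              simp only [χ]
              rw [if_neg (by omega), if_neg (by omega), if_pos (by exact ⟨trivial, by omega⟩)]
            · by_cases hxs : x < s
              · obtain ⟨u, hu, v, hv, hu1, hv1, huT, hvT, huv⟩ := hex x hx hxs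
                obtain ⟨w', hw', hw1', hwn⟩ : ∃ w' ∈ e, w'.1 = x ∧ w'.2 ≠ w.2 := by
                  by_cases h1 : u.2 = w.2
                  · exact ⟨v, hv, hv1, by omega⟩
                  · exact ⟨u, hu, hu1, h1⟩
                refine mem_image.2 ⟨w', hw', ?_⟩
                simp only [χ]
                rw [if_neg (by omega), if_neg (by omega), if_neg (by omega), hw1']
              · obtain ⟨v, hv, rfl⟩ := mem_image.1 hx
                refine mem_image.2 ⟨v, hv, ?_⟩
                simp only [χ]
                rw [if_neg (by omega), if_neg (by omega), if_neg (by omega)]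
          refine le_trans ?_ (card_le_card hsub)
          rw [card_insert_of_notMem h0U]; omega
    · have h0U : 0 ∈ U := by
        by_contra h
        exact h0 (mem_sdiff.2 ⟨by simp; omega, h⟩)
      set B := M.filter (fun i => st ≤ i ∧ (0, pos i) ∈ e) with hB
      have hBm : ∀ i ∈ B, i ∈ M ∧ st ≤ i ∧ i < r ∧ (0, pos i) ∈ e := by
        intro i hi
        obtain ⟨h1, h2, h3⟩ := mem_filter.1 hi
        exact ⟨h1, h2, hMr i h1, h3⟩
      have hχB : ∀ i ∈ B, i ∈ e.image (χ 0) := by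
        intro i hi
        obtain ⟨h1, h2, h3, h4⟩ := hBm i hi
        refine mem_image.2 ⟨_, h4, ?_⟩
        simp only [χ, pos]
        rw [if_pos (by simp), if_pos (by simp; omega)]
        omega
      have hχU : ∀ x ∈ U, x ≠ 0 → x ∈ e.image (χ 0) := by
        intro x hx hx0
        obtain ⟨v, hv, rfl⟩ := mem_image.1 hx
        refine mem_image.2 ⟨v, hv, ?_⟩
        simp only [χ]
        rw [if_pos (by simp), if_neg (fun h => hx0 h.1)]
      have hUB : Disjoint U B := by
        rw [disjoint_right]
        intro x hx hxU
        exact (mem_sdiff.1 (hBm x hx).1).2 hxU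
      -- the set `B1` of avoided classes
      obtain ⟨B1, hB1, hB1c, hB1A⟩ : ∃ B1 ⊆ B, (B1.Nonempty → U.card + B1.card ≤ (e.image (χ 0)).card) ∧
          ∀ x y, (0, x) ∈ e → (0, y) ∈ e → (x = 0 ∨ ∃ i ∈ M \ B1, st ≤ i ∧ x = pos i) →
            (y = 0 ∨ ∃ i ∈ M \ B1, st ≤ i ∧ y = pos i) → x = y := by
        by_cases hg0 : (0, 0) ∈ e
        · refine ⟨B, Subset.rfl, fun _ => ?_, ?_⟩
          · rw [← card_union_of_disjoint hUB]
            apply card_le_card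
            intro x hx
            rcases mem_union.1 hx with hx | hx
            · by_cases hx0 : x = 0
              · refine mem_image.2 ⟨_, hg0, ?_⟩
                simp only [χ]
                rw [if_pos (by simp), if_neg (by simp)]
                exact hx0.symm
              · exact hχU x hx hx0
            · exact hχB x hx
          · have hno : ∀ x, (0, x) ∈ e → (x = 0 ∨ ∃ i ∈ M \ B, st ≤ i ∧ x = pos i) → x = 0 := by
              rintro x hx (h1 | ⟨i, hi, hi2, rfl⟩)
              · exact h1
              · exact absurd (mem_filter.2 ⟨(mem_sdiff.1 hi).1, hi2, hx⟩) (mem_sdiff.1 hi).2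
            intro x y hx hy h1 h2
            rw [hno x hx h1, hno y hy h2]
        · rcases B.eq_empty_or_nonempty with hBe | ⟨b0, hb0⟩
          · refine ⟨∅, empty_subset _, fun h => absurd h (by simp), ?_⟩
            rintro x y hx hy (h1 | ⟨i, hi, hi2, rfl⟩)
            · exact absurd (h1 ▸ hx) hg0
            · have : i ∈ B := mem_filter.2 ⟨(mem_sdiff.1 hi).1, hi2, hx⟩
              rw [hBe] at this; simp at this
          · refine ⟨B.erase b0, erase_subset _ _, fun _ => ?_, ?_⟩
            · have h1 : (U.erase 0 ∪ B).card ≤ (e.image (χ 0)).card := by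
                apply card_le_card
                intro x hx
                rcases mem_union.1 hx with hx | hx
                · exact hχU x (mem_of_mem_erase hx) (ne_of_mem_erase hx)
                · exact hχB x hx
              rw [card_union_of_disjoint (hUB.mono_left (erase_subset _ _)),
                card_erase_of_mem h0U] at h1
              rw [card_erase_of_mem hb0]
              have := card_pos.2 ⟨_, hb0⟩
              have := card_pos.2 ⟨_, h0U⟩
              omega
            · have hno : ∀ x, (0, x) ∈ e → (x = 0 ∨ ∃ i ∈ M \ B.erase b0, st ≤ i ∧ x = pos i) →
                  x = pos b0 := by
                rintro x hx (h1 | ⟨i, hi, hi2, rfl⟩)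
                · exact absurd (h1 ▸ hx) hg0
                · have h3 : i ∈ B := mem_filter.2 ⟨(mem_sdiff.1 hi).1, hi2, hx⟩
                  by_contra hne
                  exact (mem_sdiff.1 hi).2 (mem_erase.2 ⟨fun h => hne (by rw [h]), h3⟩)
              intro x y hx hy h1 h2
              rw [hno x hx h1, hno y hy h2]
      by_cases hgood : B1.Nonempty ∧ h + 1 ≤ U.card + B1.card
      · left
        exact ⟨0, by simp [Ic], hgood.2.trans (hB1c hgood.1)⟩
      · right
        have hB1M : B1 ⊆ M := hB1.trans (filter_subset _ _)
        have hcard : l ≤ (M \ B1).card := by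
          rw [card_sdiff_of_subset hB1M]
          rcases B1.eq_empty_or_nonempty with h1 | h1
          · rw [h1, card_empty]; omega
          · have : ¬ (h + 1 ≤ U.card + B1.card) := fun h2 => hgood ⟨h1, h2⟩
            omega
        obtain ⟨L, hL1, hL2⟩ := exists_subset_card_eq hcard
        have hLM : ∀ x ∈ L, x ∈ M := fun x hx => (mem_sdiff.1 (hL1 hx)).1
        have hL : L ∈ Lset := by
          refine mem_powersetCard.2 ⟨?_, hL2⟩
          intro x hx
          have : x ≠ 0 := fun h => h0 (h ▸ hLM x hx)
          exact mem_Ico.2 ⟨by omega, hMr x (hLM x hx)⟩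
        refine hI1 L hL (fun v hv hvL => hMU _ (hLM _ hvL) v hv rfl) ?_
        have hA : ∀ x ∈ A L, x = 0 ∨ ∃ i ∈ M \ B1, st ≤ i ∧ x = pos i := by
          intro x hx
          rcases mem_insert.1 hx with h1 | h1
          · exact Or.inl h1
          · obtain ⟨i, hi, rfl⟩ := mem_image.1 h1
            obtain ⟨h2, h3⟩ := mem_filter.1 ((hC L hL).1 hi)
            exact Or.inr ⟨i, hL1 h2, h3, rfl⟩
        intro x y hx hy hxA hyA
        exact hB1A x y hx hy (hA x hxA) (hA y hyA)

/-- The main structural scheme. -/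
theorem case3 {n k r h l m t c σ : ℕ} (hrl : r = h + l) (hh : 3 ≤ h) (hk : h + 1 ≤ k)
    (hkm : k ≤ m) (hsc : n % r = c + σ) (hσ1 : 1 ≤ σ) (hσl : σ < l) (hc1 : 1 ≤ c) (hch : c < h)
    (hqh : h - c ≤ n / r) (hm : m = h * (n / r) + c) (hc : c = 1 → 2 * σ ≤ l)
    (ht : HasStrongCover (completeEdges m k) r (h + 1) t) :
    HasStrongCover (completeEdges n k) r (h + 1) (1 + (r - 1).choose (h - 1) * t) := by
  by_cases hc2 : 2 ≤ c
  · let R := Ico 1 (c - 1) ∪ Ico (n % r) (n % r + (h - c))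
    have hRm : ∀ x, x ∈ R ↔ (1 ≤ x ∧ x < c - 1) ∨ (n % r ≤ x ∧ x < n % r + (h - c)) := by
      intro x; simp [R]
    have hdis : Disjoint (Ico 1 (c - 1)) (Ico (n % r) (n % r + (h - c))) := by
      rw [disjoint_left]; intro x; simp; omega
    have hRsub : R ⊆ Ico 1 r := by
      intro x hx
      have := (hRm x).1 hx
      rw [mem_Ico]; omega
    have hRc : R.card = h - 2 := by
      rw [card_union_of_disjoint hdis, Nat.card_Ico, Nat.card_Ico]; omega
    refine case3_abs (ε := 1) hrl hh hk hkm hsc hσ1 hσl hc1 hch hqh hm R (Ico 1 r \ R) hRsub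
      sdiff_subset hRc disjoint_sdiff ?_ (fun _ _ _ => le_rfl) ?_ ht
    · rw [card_sdiff_of_subset hRsub, hRc, Nat.card_Ico]; omega
    · have : R.filter (· < n % r) ⊆ Ico 1 (c - 1) := by
        intro x hx
        obtain ⟨h1, h2⟩ := mem_filter.1 hx
        have := (hRm x).1 h1
        rw [mem_Ico]; omega
      have := card_le_card this
      rw [Nat.card_Ico] at this
      omega
  · have hc1' : c = 1 := by omega
    have hl := hc hc1'
    have hRc : (Ico (n % r) (n % r + (h - 2))).card = h - 2 := by rw [Nat.card_Ico]; omega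
    refine case3_abs (ε := 0) hrl hh hk hkm hsc hσ1 hσl hc1 hch hqh hm
      (Ico (n % r) (n % r + (h - 2))) (Ico (n % r + (h - 2)) r) ?_ ?_ hRc ?_ ?_ ?_ ?_ ht
    · intro x; simp only [mem_Ico]; omega
    · intro x; simp only [mem_Ico]; omega
    · rw [disjoint_left]; intro x; simp only [mem_Ico]; omega
    · rw [Nat.card_Ico]; omega
    · intro x; simp only [mem_Ico]; omega
    · have : (Ico (n % r) (n % r + (h - 2))).filter (· < n % r) = ∅ := by
        apply filter_eq_empty_iff.2
        intro x; simp only [mem_Ico]; omega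
      rw [this, card_empty]; omega
theorem base_unc_min {n k r h : ℕ} (hr : h < r) :
    Unc n k r (h + 1) 1 (min (n.choose k)
      (r.choose h * (h * (n / r) + min (n % r) h).choose k)) := by
  obtain ⟨C, U, hU, hc, hg⟩ := base_bad (n := n) (k := k) hr
  refine ⟨C, U, hU, le_min ?_ hc, hg⟩
  simpa using card_le_card hU

theorem unc_mono {n k r p c u u' : ℕ} (h : Unc n k r p c u) (hu : u ≤ u') : Unc n k r p c u' := by
  obtain ⟨C, U, hU, hc, hg⟩ := h
  exact ⟨C, U, hU, hc.trans hu, hg⟩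

theorem two_pow_lt_exp {u w a b D : ℕ} (hb : 0 < b) (hu : u ≤ 2 ^ w)
    (h : 6932 * w * b < 10000 * D * a) : (u : ℝ) < Real.exp ((D : ℝ) * ((a : ℝ) / b)) := by
  have h1 : (u : ℝ) ≤ Real.exp (w * Real.log 2) := by
    rw [mul_comm, Real.exp_mul, Real.exp_log (by norm_num), Real.rpow_natCast]
    exact_mod_cast hu
  refine h1.trans_lt (Real.exp_lt_exp.2 ?_)
  have h2 : Real.log 2 < 0.6932 := lt_of_lt_of_le Real.log_two_lt_d9 (by norm_num)
  have hb' : (0 : ℝ) < b := by exact_mod_cast hb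
  have h3 : (6932 : ℝ) * w * b < 10000 * D * a := by exact_mod_cast h
  have h4 : (w : ℝ) * Real.log 2 ≤ w * 0.6932 := by gcongr
  refine h4.trans_lt ?_
  rw [← mul_div_assoc, lt_div_iff₀ hb']
  linarith

/-- Random colorings, edges of size `h+1`. -/
theorem cover_T0_exp {n n0 k r h t D : ℕ} (hr : h < r) (hk : h + 1 ≤ k) (hn : n ≤ n0)
    (hn0 : h + 1 ≤ n0) (ht : 1 ≤ t)
    (hx : ((n0.choose (h + 1) : ℕ) : ℝ)
      < Real.exp ((D : ℝ) * (((r.descFactorial (h + 1) : ℕ) : ℝ) / ((r ^ (h + 1) : ℕ) : ℝ)))) :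
    HasStrongCover (completeEdges n k) r (h + 1) (1 + D * t) := by
  have hd := dens_random n0 r (h + 1) (by omega) hn0
  have h1 := cover_of_dens_exp (N := D) (pow_pos (by omega) _) hd (Nat.descFactorial_le_pow _ _) hx
  have h2 := cover_mono hn hk h1
  have hD : 1 ≤ D := by
    rcases Nat.eq_zero_or_pos D with h0 | h0
    · subst h0
      have : 1 ≤ n0.choose (h + 1) := Nat.choose_pos hn0
      have : (1 : ℝ) ≤ (n0.choose (h + 1) : ℕ) := by exact_mod_cast this
      simp at hx
      omega
    · exact h0
  exact h2.mono (by omega) (by nlinarith)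

theorem cover_T0 {n n0 k r h t D w : ℕ} (hr : h < r) (hk : h + 1 ≤ k) (hn : n ≤ n0)
    (hn0 : h + 1 ≤ n0) (ht : 1 ≤ t) (hw : n0.choose (h + 1) ≤ 2 ^ w)
    (hx : 6932 * w * r ^ (h + 1) < 10000 * D * r.descFactorial (h + 1)) :
    HasStrongCover (completeEdges n k) r (h + 1) (1 + D * t) :=
  cover_T0_exp hr hk hn hn0 ht (two_pow_lt_exp (pow_pos (by omega) _) hw hx)

/-- the product of clone factors -/
def cloneNum (m h k K : ℕ) : ℕ := ∏ i ∈ range K, ((m + i) * (m + i + 1) - h * k)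
def cloneDen (m K : ℕ) : ℕ := ∏ i ∈ range K, ((m + i) * (m + i + 1))

theorem cloneDen_pos {m K : ℕ} (hm : 0 < m) : 0 < cloneDen m K :=
  prod_pos fun i _ => by positivity

theorem cloneNum_le (m h k K : ℕ) : cloneNum m h k K ≤ cloneDen m K :=
  prod_le_prod' fun i _ => Nat.sub_le _ _

theorem cloneNum_anti {m h k k' K : ℕ} (hk : k ≤ k') : cloneNum m h k' K ≤ cloneNum m h k K :=
  prod_le_prod' fun i _ => Nat.sub_le_sub_left (Nat.mul_le_mul_left _ hk) _

theorem dens_P {n m k r h t : ℕ} (hk : h + 1 ≤ k) (hkm : k ≤ m) (hmn : m ≤ n)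
    (ht : HasStrongCover (completeEdges m k) r (h + 1) t) :
    Dens n k r (h + 1) t (cloneNum m h k (n - m)) (cloneDen m (n - m)) := by
  have := dens_clone_iter hk hkm (n - m) (dens_of_cover ht)
  rwa [Nat.add_sub_cancel' hmn] at this

theorem clone_ratio {m h k : ℕ} (hk : h + 1 ≤ k) (hkm : k ≤ m) (K : ℕ) :
    m.descFactorial h * cloneDen m K ≤ cloneNum m h k K * (m + K).descFactorial h := by
  induction K with
  | zero => simp [cloneDen, cloneNum]
  | succ K ih =>
    have e1 : cloneDen m (K + 1) = cloneDen m K * ((m + K) * (m + K + 1)) := prod_range_succ _ _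
    have e2 : cloneNum m h k (K + 1) = cloneNum m h k K * ((m + K) * (m + K + 1) - h * k) :=
      prod_range_succ _ _
    rw [e1, e2]
    have e3 : (m + K + 1 - h) * (m + K + 1).descFactorial h
        = (m + K + 1) * (m + K).descFactorial h := by
      have := Nat.succ_descFactorial (m + K) h
      simpa using this
    have e4 : (m + K) * (m + K + 1 - h) ≤ (m + K) * (m + K + 1) - h * k := by
      rw [Nat.mul_sub]
      apply Nat.sub_le_sub_left
      rw [mul_comm]
      exact Nat.mul_le_mul_right _ (by omega)
    calc m.descFactorial h * (cloneDen m K * ((m + K) * (m + K + 1)))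
        = (m.descFactorial h * cloneDen m K) * ((m + K) * (m + K + 1)) := by ring
      _ ≤ (cloneNum m h k K * (m + K).descFactorial h) * ((m + K) * (m + K + 1)) :=
          Nat.mul_le_mul_right _ ih
      _ = cloneNum m h k K * (m + K) * ((m + K + 1) * (m + K).descFactorial h) := by ring
      _ = cloneNum m h k K * ((m + K) * (m + K + 1 - h)) * (m + K + 1).descFactorial h := by
          rw [← e3]; ring
      _ ≤ cloneNum m h k K * ((m + K) * (m + K + 1) - h * k) * (m + (K + 1)).descFactorial h := by
          rw [← add_assoc]
          exact Nat.mul_le_mul_right _ (Nat.mul_le_mul_left _ e4)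

theorem desc_ratio {A B m n : ℕ} (h1 : A * n ≤ m * B) (hAB : A ≤ B) (hBn : B ≤ n)
    (h : ℕ) : A.descFactorial h * n.descFactorial h ≤ m.descFactorial h * B.descFactorial h := by
  induction h with
  | zero => simp
  | succ i ih =>
    rw [Nat.descFactorial_succ, Nat.descFactorial_succ, Nat.descFactorial_succ,
      Nat.descFactorial_succ]
    have key : (A - i) * (n - i) ≤ (m - i) * (B - i) := by
      rcases Nat.lt_or_ge i A with hi | hi
      · have hB : 0 < B := by omega
        have hAm : A ≤ m := by
          by_contra hc
          have : m * B < A * n := by nlinarith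
          omega
        obtain ⟨a, rfl⟩ := Nat.exists_eq_add_of_lt hi
        obtain ⟨b, rfl⟩ := Nat.exists_eq_add_of_le hAB
        obtain ⟨d, rfl⟩ := Nat.exists_eq_add_of_le hBn
        obtain ⟨c, rfl⟩ := Nat.exists_eq_add_of_le hAm
        have q1 : i + a + 1 - i = a + 1 := by omega
        have q2 : i + a + 1 + b + d - i = a + 1 + b + d := by omega
        have q3 : i + a + 1 + c - i = a + 1 + c := by omega
        have q4 : i + a + 1 + b - i = a + 1 + b := by omega
        rw [q1, q2, q3, q4]
        have h2 : (i + a + 1) * d ≤ c * (i + a + 1 + b) := by nlinarith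
        suffices (a + 1) * d ≤ c * (a + 1 + b) by nlinarith
        by_contra hc
        push Not at hc
        have hcd : c ≤ d := by
          by_contra hcc
          push Not at hcc
          nlinarith
        nlinarith
      · rw [Nat.sub_eq_zero_of_le hi]; simp
    calc (A - i) * A.descFactorial i * ((n - i) * n.descFactorial i)
        = ((A - i) * (n - i)) * (A.descFactorial i * n.descFactorial i) := by ring
      _ ≤ ((m - i) * (B - i)) * (m.descFactorial i * B.descFactorial i) := Nat.mul_le_mul key ih
      _ = _ := by ring

/-- Greedy with the cloned cover of `[m]`, density bound `a/b`. -/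
theorem cover_P {n m k r h t D a b : ℕ} (hk : h + 1 ≤ k) (hkm : k ≤ m) (hmn : m ≤ n)
    (ht : HasStrongCover (completeEdges m k) r (h + 1) t) (ht1 : 1 ≤ t)
    (hb : 0 < b) (hab : a * n.descFactorial h ≤ b * m.descFactorial h)
    (hx : 6932 * n * b < 10000 * D * a) :
    HasStrongCover (completeEdges n k) r (h + 1) (1 + D * t) := by
  have hd := dens_P hk hkm hmn ht
  have hpos : 0 < n.descFactorial h := Nat.descFactorial_pos.2 (by omega)
  have hle : m.descFactorial h ≤ n.descFactorial h := Nat.descFactorial_le _ hmn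
  have hab' : a ≤ b := by
    have : a * n.descFactorial h ≤ b * n.descFactorial h :=
      hab.trans (Nat.mul_le_mul_left _ hle)
    exact Nat.le_of_mul_le_mul_right this hpos
  have hr := clone_ratio hk hkm (n - m)
  rw [Nat.add_sub_cancel' hmn] at hr
  have hd' : Dens n k r (h + 1) t a b := by
    refine hd.weaken (cloneDen_pos (by omega)) ?_
    have : a * cloneDen m (n - m) * n.descFactorial h
        ≤ cloneNum m h k (n - m) * b * n.descFactorial h := by
      calc a * cloneDen m (n - m) * n.descFactorial h
          = (a * n.descFactorial h) * cloneDen m (n - m) := by ring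
        _ ≤ (b * m.descFactorial h) * cloneDen m (n - m) := Nat.mul_le_mul_right _ hab
        _ = b * (m.descFactorial h * cloneDen m (n - m)) := by ring
        _ ≤ b * (cloneNum m h k (n - m) * n.descFactorial h) := Nat.mul_le_mul_left _ hr
        _ = _ := by ring
    exact Nat.le_of_mul_le_mul_right this hpos
  have hD : 1 ≤ D := by
    rcases Nat.eq_zero_or_pos D with h0 | h0
    · subst h0; simp at hx
    · exact h0
  have h1 := cover_of_dens_exp (N := D) hb hd' hab'
    (two_pow_lt_exp hb (Nat.choose_le_two_pow n k) hx)
  exact h1.mono (by nlinarith) (by omega)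

/-- Greedy after the base coloring. -/
theorem cover_base {n k r h t D a b u w : ℕ} (hr : h < r)
    (hd : Dens n k r (h + 1) t a b) (hb : 0 < b) (hab : a ≤ b)
    (hu : min (n.choose k) (r.choose h * (h * (n / r) + min (n % r) h).choose k) ≤ u)
    (hw : u ≤ 2 ^ w)
    (hx : 6932 * w * b < 10000 * D * a) :
    HasStrongCover (completeEdges n k) r (h + 1) (1 + D * t) :=
  cover_of_unc_exp hb (unc_mono (base_unc_min hr) hu) hd hab (two_pow_lt_exp hb hw hx)

theorem cover_base_iter {n k r h t D a b u : ℕ} (hr : h < r)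
    (hd : Dens n k r (h + 1) t a b) (hb : 0 < b)
    (hu : min (n.choose k) (r.choose h * (h * (n / r) + min (n % r) h).choose k) ≤ u)
    (hx : ((fun u => u * (b - a) / b)^[D] u) = 0) :
    HasStrongCover (completeEdges n k) r (h + 1) (1 + D * t) := by
  have := unc_iterate hb (unc_mono (base_unc_min hr) hu) hd D
  rw [hx] at this
  exact hasStrongCover_of_unc this

/-- A density-one single coloring of `max k r` points. -/
theorem dens_one {k r h : ℕ} (hr : h < r) (hk : h + 1 ≤ k) :
    Dens (max k r) k r (h + 1) 1 1 1 := by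
  rcases le_total k r with h1 | h1
  · rw [max_eq_right h1]
    exact dens_of_cover (hasStrongCover_one_of_le le_rfl hk)
  · rw [max_eq_left h1]
    have h2 := base_unc (n := k) (k := k) (r := r) (h := h) hr
    apply dens_of_cover
    apply hasStrongCover_of_unc
    have : h * (k / r) + min (k % r) h < k := by
      have e := Nat.div_add_mod k r
      have : 1 ≤ k / r := Nat.div_pos h1 (by omega)
      have : (h + 1) * (k / r) ≤ r * (k / r) := Nat.mul_le_mul_right _ hr
      have := min_le_left (k % r) h
      nlinarith
    rwa [Nat.choose_eq_zero_of_lt this, mul_zero] at h2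

theorem dens_P2 {n k r h t : ℕ} (hr : h < r) (hk : h + 1 ≤ k) (hn : max k r ≤ n) (ht : 1 ≤ t) :
    Dens n k r (h + 1) t (cloneNum (max k r) h k (n - max k r)) (cloneDen (max k r) (n - max k r)) := by
  have := dens_clone_iter hk (le_max_left k r) (n - max k r) (dens_one hr hk)
  rw [Nat.add_sub_cancel' hn] at this
  exact Dens.pad this le_rfl ht
theorem log_bound_128 {r : ℕ} (hr : 128 ≤ r) : Real.log r ≤ r / 128 + 3.853 := by
  have h1 : (0 : ℝ) < r := by exact_mod_cast (by omega : 0 < r)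
  have h2 := Real.log_le_sub_one_of_pos (show (0 : ℝ) < r / 128 by positivity)
  rw [Real.log_div h1.ne' (by norm_num)] at h2
  have h3 : Real.log 128 = 7 * Real.log 2 := by
    rw [show (128 : ℝ) = 2 ^ 7 by norm_num, Real.log_pow]; norm_num
  have := Real.log_two_lt_d9
  rw [h3] at h2
  linarith

theorem T0_of_B {n k r h t D : ℕ} (hr : 128 ≤ r) (hh : 3 ≤ h) (hhr : h < r) (hk : h + 1 ≤ k)
    (hn : n ≤ r * h) (ht : 1 ≤ t) (hD : (r - 1).choose (h - 1) ≤ D)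
    (hB : r ^ 2 * r ^ (h + 1) ≤ 12 * (r.choose h * r.descFactorial (h + 1))) :
    HasStrongCover (completeEdges n k) r (h + 1) (1 + D * t) := by
  have hr0 : (0 : ℝ) < r := by exact_mod_cast (by omega : 0 < r)
  refine cover_T0_exp hhr hk hn (by nlinarith) ht ?_
  -- lower bound for D * W
  have e1 : r * (r - 1).choose (h - 1) = r.choose h * h := by
    obtain ⟨r', rfl⟩ := Nat.exists_eq_add_of_le' (show 1 ≤ r by omega)
    obtain ⟨h', rfl⟩ := Nat.exists_eq_add_of_le' (show 1 ≤ h by omega)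
    exact Nat.add_one_mul_choose_eq r' h'
  have hW : (h : ℝ) * r / 12 ≤
      D * (((r.descFactorial (h + 1) : ℕ) : ℝ) / ((r ^ (h + 1) : ℕ) : ℝ)) := by
    rw [← mul_div_assoc, le_div_iff₀ (by positivity)]
    have hB' : (r : ℝ) ^ 2 * ((r ^ (h + 1) : ℕ) : ℝ) ≤
        12 * (r.choose h * (r.descFactorial (h + 1) : ℕ)) := by exact_mod_cast hB
    have hD' : ((r - 1).choose (h - 1) : ℝ) ≤ D := by exact_mod_cast hD
    have e1' : (r : ℝ) * (r - 1).choose (h - 1) = r.choose h * h := by exact_mod_cast e1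
    have hd0 : (0 : ℝ) ≤ (r.descFactorial (h + 1) : ℕ) := by positivity
    have h2 : (h : ℝ) * ((r : ℝ) ^ 2 * ((r ^ (h + 1) : ℕ) : ℝ)) ≤
        h * (12 * (r.choose h * (r.descFactorial (h + 1) : ℕ))) := by gcongr
    have h3 : (h : ℝ) * (12 * (r.choose h * (r.descFactorial (h + 1) : ℕ)))
        = 12 * (r * (r - 1).choose (h - 1)) * (r.descFactorial (h + 1) : ℕ) := by rw [e1']; ring
    have h4 : (12 : ℝ) * (r * (r - 1).choose (h - 1)) * (r.descFactorial (h + 1) : ℕ) ≤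
        12 * (r * D) * (r.descFactorial (h + 1) : ℕ) := by gcongr
    have h5 : r * ((h : ℝ) * r / 12 * ((r ^ (h + 1) : ℕ) : ℝ)) ≤
        r * (D * (r.descFactorial (h + 1) : ℕ)) := by linarith
    exact le_of_mul_le_mul_left h5 hr0
  -- upper bound for the binomial
  have hC : (((r * h).choose (h + 1) : ℕ) : ℝ) ≤ r ^ (h + 1) * Real.exp h := by
    have h1 : (((r * h).choose (h + 1) : ℕ) : ℝ) ≤ ((r * h : ℕ) : ℝ) ^ (h + 1) / (h + 1).factorial :=
      Nat.choose_le_pow_div (h + 1) (r * h)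
    have h2 := Real.pow_div_factorial_le_exp (h : ℝ) (by positivity) (h + 1)
    refine h1.trans ?_
    push_cast
    rw [mul_pow, mul_div_assoc]
    gcongr
  refine hC.trans_lt (lt_of_lt_of_le ?_ (Real.exp_le_exp.2 hW))
  have : (r : ℝ) ^ (h + 1) = Real.exp ((h + 1) * Real.log r) := by
    rw [mul_comm, Real.exp_mul, Real.exp_log hr0]; norm_cast
  rw [this, ← Real.exp_add, Real.exp_lt_exp]
  have hl := log_bound_128 hr
  have hr' : (128 : ℝ) ≤ r := by exact_mod_cast hr
  have hh' : (3 : ℝ) ≤ h := by exact_mod_cast hh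
  have h1 : (h + 1 : ℝ) * Real.log r ≤ (4 / 3 * h) * (r / 128 + 3.853) := by
    have : 0 ≤ Real.log r := Real.log_nonneg (by linarith)
    gcongr
    linarith
  nlinarith

/-- Partial products -/
noncomputable def Bf (r i : ℕ) : ℝ := ((r : ℝ) - i) * ((r : ℝ) - i - 1) / ((i + 1) * r)

theorem B_eq {r h : ℕ} (hr : h < r) :
    (r.choose h : ℝ) * (r.descFactorial (h + 1) : ℕ) = r ^ (h + 1) * ∏ i ∈ range h, Bf r i := by
  have hr0 : (0 : ℝ) < r := by exact_mod_cast (by omega : 0 < r)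
  induction h with
  | zero => simp [Nat.descFactorial]
  | succ h ih =>
    rw [prod_range_succ]
    have ih := ih (by omega)
    have e1 : (r.choose (h + 1) : ℝ) * (h + 1) = r.choose h * (r - h) := by
      have := Nat.choose_succ_right_eq r h
      rw [← Nat.cast_sub (by omega)]
      exact_mod_cast this
    have e2 : ((r.descFactorial (h + 1 + 1) : ℕ) : ℝ)
        = (r - h - 1) * (r.descFactorial (h + 1) : ℕ) := by
      rw [Nat.descFactorial_succ r (h + 1)]
      push_cast
      rw [Nat.cast_sub (by omega)]; push_cast; ring
    have hh : (0 : ℝ) < (h : ℝ) + 1 := by positivity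
    have e3 : (r.choose (h + 1) : ℝ) = r.choose h * (r - h) / (h + 1) := by
      rw [eq_div_iff hh.ne', e1]
    rw [e3, e2]
    calc (r.choose h : ℝ) * (r - h) / (h + 1) * ((r - h - 1) * (r.descFactorial (h + 1) : ℕ))
        = (r.choose h * (r.descFactorial (h + 1) : ℕ)) * ((r - h) * (r - h - 1) / (h + 1)) := by
          ring
      _ = _ := by
          rw [ih, Bf]
          field_simp
          ring

theorem T0_of_prod {n k r h t D : ℕ} (hr : 128 ≤ r) (hh : 3 ≤ h) (hhr : h < r) (hk : h + 1 ≤ k)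
    (hn : n ≤ r * h) (ht : 1 ≤ t) (hD : (r - 1).choose (h - 1) ≤ D)
    (hB : (r : ℝ) ^ 2 / 12 ≤ ∏ i ∈ range h, Bf r i) :
    HasStrongCover (completeEdges n k) r (h + 1) (1 + D * t) := by
  refine T0_of_B hr hh hhr hk hn ht hD ?_
  have hr0 : (0 : ℝ) < r := by exact_mod_cast (by omega : 0 < r)
  have e := B_eq hhr
  have : (r : ℝ) ^ 2 * r ^ (h + 1) ≤ 12 * (r.choose h * (r.descFactorial (h + 1) : ℕ)) := by
    rw [e]
    have : (r : ℝ) ^ (h + 1) * ((r : ℝ) ^ 2 / 12) ≤ r ^ (h + 1) * ∏ i ∈ range h, Bf r i := by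
      gcongr
    linarith
  exact_mod_cast this
theorem seg_up {f : ℕ → ℝ} {a b : ℕ} {c Q : ℝ} (hab : a ≤ b) (hc : 0 ≤ c)
    (hf : ∀ i, a ≤ i → i < b → c ≤ f i) (hQ0 : 0 ≤ Q) (hQ : Q ≤ ∏ i ∈ range a, f i) :
    Q * c ^ (b - a) ≤ ∏ i ∈ range b, f i := by
  induction b, hab using Nat.le_induction with
  | base => simpa using hQ
  | succ b hab ih =>
    rw [prod_range_succ, Nat.succ_sub hab, pow_succ, ← mul_assoc]
    have := ih (fun i h1 h2 => hf i h1 (by omega))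
    have h2 := hf b hab (by omega)
    have : 0 ≤ Q * c ^ (b - a) := by positivity
    exact mul_le_mul (ih (fun i h1 h2 => hf i h1 (by omega))) h2 hc (le_trans this (ih (fun i h1 h2 => hf i h1 (by omega))))

theorem seg_down {f : ℕ → ℝ} {a b d : ℕ} {c Q : ℝ} (hab : a ≤ b) (hbd : b ≤ a + d) (hc : 0 ≤ c)
    (hc1 : c ≤ 1)
    (hf : ∀ i, a ≤ i → i < b → c ≤ f i) (hQ0 : 0 ≤ Q) (hQ : Q ≤ ∏ i ∈ range a, f i) :
    Q * c ^ d ≤ ∏ i ∈ range b, f i := by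
  refine le_trans ?_ (seg_up hab hc hf hQ0 hQ)
  have := pow_le_pow_of_le_one hc hc1 (show b - a ≤ d by omega)
  gcongr

theorem seg_one {f : ℕ → ℝ} {a b : ℕ} {Q : ℝ} (hab : a ≤ b)
    (hf : ∀ i, a ≤ i → i < b → 1 ≤ f i) (hQ0 : 0 ≤ Q) (hQ : Q ≤ ∏ i ∈ range a, f i) :
    Q ≤ ∏ i ∈ range b, f i := by
  have := seg_up hab zero_le_one hf hQ0 hQ
  simpa using this

theorem Bf_ge {r i : ℕ} {x c : ℝ} (hr : 0 < r) (hx : ((i : ℝ) + 1) ≤ x * r) (hx1 : x ≤ 1)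
    (hc0 : 0 ≤ c)
    (hc : c * x ≤ (1 - x) ^ 2) : c ≤ Bf r i := by
  have hr0 : (0 : ℝ) < r := by exact_mod_cast hr
  have hi : (0 : ℝ) ≤ i := by positivity
  rw [Bf, le_div_iff₀ (by positivity)]
  have h1 : (1 - x) * r ≤ (r : ℝ) - i - 1 := by linarith
  have h0 : 0 ≤ (1 - x) * r := mul_nonneg (by linarith) hr0.le
  have h2 : ((1 - x) * r) * ((1 - x) * r) ≤ ((r : ℝ) - i) * ((r : ℝ) - i - 1) :=
    mul_le_mul (by linarith) h1 h0 (by linarith)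
  calc c * ((i + 1) * r) ≤ c * (x * r * r) := by gcongr
    _ = (c * x) * (r * r) := by ring
    _ ≤ (1 - x) ^ 2 * (r * r) := by gcongr
    _ = ((1 - x) * r) * ((1 - x) * r) := by ring
    _ ≤ _ := h2

theorem Bprod_ge {r h : ℕ} (hr : 512 ≤ r) (hh : 3 ≤ h) (hhr : 3 * h ≤ 2 * r) :
    (r : ℝ) ^ 2 / 12 ≤ ∏ i ∈ range h, Bf r i := by
  have hr' : (512 : ℝ) ≤ r := by exact_mod_cast hr
  have h3 : (r : ℝ) ^ 3 / 8 ≤ ∏ i ∈ range 3, Bf r i := by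
    simp only [prod_range_succ, prod_range_zero, Bf]
    push_cast
    have e : (1 : ℝ) * ((r - 0) * (r - 0 - 1) / ((0 + 1) * r)) *
      ((r - 1) * (r - 1 - 1) / ((1 + 1) * r)) * ((r - 2) * (r - 2 - 1) / ((2 + 1) * r))
      = (r - 1) ^ 2 * (r - 2) ^ 2 * (r - 3) / (6 * r ^ 2) := by
      field_simp
      ring
    rw [e, le_div_iff₀ (by positivity)]
    have a1 : (0.99 : ℝ) * r ≤ r - 3 := by linarith
    have a2 : (0.99 : ℝ) * r ≤ r - 2 := by linarith
    have a3 : (0.99 : ℝ) * r ≤ r - 1 := by linarith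
    calc (r : ℝ) ^ 3 / 8 * (6 * r ^ 2) ≤ (0.99 * r) ^ 2 * (0.99 * r) ^ 2 * (0.99 * r) := by
          have : (0 : ℝ) ≤ r ^ 5 := by positivity
          nlinarith
      _ ≤ _ := by gcongr
  have hQ0 : (0 : ℝ) ≤ (r : ℝ) ^ 3 / 8 := by positivity
  obtain ⟨j, hj⟩ : ∃ j, j = r / 12 := ⟨_, rfl⟩
  have hj1 : 12 * j ≤ r := by omega
  have hj2 : r < 12 * j + 12 := by omega
  have hj3 : 42 ≤ j := by omega
  have hjr : 12 * (j : ℝ) ≤ r := by exact_mod_cast hj1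
  have blk : ∀ (b : ℕ) (c : ℝ), b ≤ 12 → 0 ≤ c → c * (b / 12) ≤ (1 - (b : ℝ) / 12) ^ 2 →
      ∀ i, i < b * j → c ≤ Bf r i := by
    intro b c hb hc hcx i hi
    refine Bf_ge (by omega) (x := b / 12) ?_ ?_ hc hcx
    · have : ((i : ℝ) + 1) ≤ b * j := by exact_mod_cast hi
      have : (b : ℝ) * (12 * j) ≤ b * r := by gcongr
      linarith
    · rw [div_le_one (by norm_num)]; exact_mod_cast hb
  have b1 := blk 1 10 (by norm_num) (by norm_num) (by norm_num)
  have b2 := blk 2 4 (by norm_num) (by norm_num) (by norm_num)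
  have b3 := blk 3 (9/4) (by norm_num) (by norm_num) (by norm_num)
  have b4 := blk 4 (4/3) (by norm_num) (by norm_num) (by norm_num)
  have b4' := blk 4 1 (by norm_num) (by norm_num) (by norm_num)
  have b5 := blk 5 (4/5) (by norm_num) (by norm_num) (by norm_num)
  have b6 := blk 6 (1/2) (by norm_num) (by norm_num) (by norm_num)
  have b7 := blk 7 (2/7) (by norm_num) (by norm_num) (by norm_num)
  have b8 : ∀ i, i < h → (1/6 : ℝ) ≤ Bf r i := by
    intro i hi
    refine Bf_ge (by omega) (x := 2 / 3) ?_ (by norm_num) (by norm_num) (by norm_num)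
    have h1 : ((i : ℝ) + 1) ≤ h := by exact_mod_cast hi
    have h2 : 3 * (h : ℝ) ≤ 2 * r := by exact_mod_cast hhr
    linarith
  rcases le_or_gt h (4 * j) with hc | hc
  · refine le_trans ?_ (seg_one hh (fun i _ hi => b4' i (by omega)) hQ0 h3)
    have : (0 : ℝ) ≤ r ^ 2 := by positivity
    nlinarith
  have q1 := seg_up (b := 1 * j) (by omega) (by norm_num) (fun i _ hi => b1 i hi) hQ0 h3
  have q2 := seg_up (b := 2 * j) (by omega) (by norm_num) (fun i _ hi => b2 i hi) (by positivity) q1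
  have q3 := seg_up (b := 3 * j) (by omega) (by norm_num) (fun i _ hi => b3 i hi) (by positivity) q2
  have q4 := seg_up (b := 4 * j) (by omega) (by norm_num) (fun i _ hi => b4 i hi) (by positivity) q3
  rw [show 1 * j - 3 = j - 3 by omega, show 2 * j - 1 * j = j by omega,
    show 3 * j - 2 * j = j by omega, show 4 * j - 3 * j = j by omega] at q4
  have e4 : (r : ℝ) ^ 3 / 8 * 10 ^ (j - 3) * 4 ^ j * (9 / 4) ^ j * (4 / 3) ^ j
      = r ^ 3 / 8000 * 120 ^ j := by
    have : (10 : ℝ) ^ j = 10 ^ (j - 3) * 1000 := by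
      rw [show (1000 : ℝ) = 10 ^ 3 by norm_num, ← pow_add]; congr 1; omega
    have h120 : (120 : ℝ) ^ j = 10 ^ j * 4 ^ j * (9 / 4) ^ j * (4 / 3) ^ j := by
      rw [← mul_pow, ← mul_pow, ← mul_pow]; norm_num
    rw [h120, this]; ring
  rw [e4] at q4
  have q5 : ∀ b, 4 * j ≤ b → b ≤ 5 * j → (r : ℝ) ^ 3 / 8000 * 120 ^ j * (4 / 5) ^ j ≤
      ∏ i ∈ range b, Bf r i := fun b h1 h2 =>
    seg_down h1 (by omega) (by norm_num) (by norm_num) (fun i _ hi => b5 i (by omega))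
      (by positivity) q4
  have q6 : ∀ b, 5 * j ≤ b → b ≤ 6 * j → (r : ℝ) ^ 3 / 8000 * 120 ^ j * (4 / 5) ^ j * (1 / 2) ^ j ≤
      ∏ i ∈ range b, Bf r i := fun b h1 h2 =>
    seg_down h1 (by omega) (by norm_num) (by norm_num) (fun i _ hi => b6 i (by omega))
      (by positivity) (q5 (5 * j) (by omega) le_rfl)
  have q7 : ∀ b, 6 * j ≤ b → b ≤ 7 * j →
      (r : ℝ) ^ 3 / 8000 * 120 ^ j * (4 / 5) ^ j * (1 / 2) ^ j * (2 / 7) ^ j ≤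
      ∏ i ∈ range b, Bf r i := fun b h1 h2 =>
    seg_down h1 (by omega) (by norm_num) (by norm_num) (fun i _ hi => b7 i (by omega))
      (by positivity) (q6 (6 * j) (by omega) le_rfl)
  have q8 : 7 * j ≤ h →
      (r : ℝ) ^ 3 / 8000 * 120 ^ j * (4 / 5) ^ j * (1 / 2) ^ j * (2 / 7) ^ j * (1 / 6) ^ (j + 8) ≤
      ∏ i ∈ range h, Bf r i := fun h1 =>
    seg_down h1 (by omega) (by norm_num) (by norm_num) (fun i _ hi => b8 i (by omega))
      (by positivity) (q7 (7 * j) (by omega) le_rfl)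
  have fin8 : (r : ℝ) ^ 2 / 12 ≤
      (r : ℝ) ^ 3 / 8000 * 120 ^ j * (4 / 5) ^ j * (1 / 2) ^ j * (2 / 7) ^ j * (1 / 6) ^ (j + 8) := by
    have e : (r : ℝ) ^ 3 / 8000 * 120 ^ j * (4 / 5) ^ j * (1 / 2) ^ j * (2 / 7) ^ j *
        (1 / 6) ^ (j + 8) = r ^ 3 / 8000 * (16 / 7) ^ j * (1 / 6) ^ 8 := by
      rw [pow_add, show (16 / 7 : ℝ) = 120 * (4 / 5) * (1 / 2) * (2 / 7) * (1 / 6) by norm_num]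
      simp only [mul_pow]; ring
    rw [e]
    have h42 : (16 / 7 : ℝ) ^ 42 ≤ (16 / 7) ^ j := pow_le_pow_right₀ (by norm_num) hj3
    have h43 : (8000 * 6 ^ 8 : ℝ) ≤ (16 / 7 : ℝ) ^ 42 := by norm_num
    have h44 : (r : ℝ) ^ 3 / 8000 * (8000 * 6 ^ 8) * (1 / 6) ^ 8 ≤
        r ^ 3 / 8000 * (16 / 7) ^ j * (1 / 6) ^ 8 := by
      gcongr; exact h43.trans h42
    refine le_trans ?_ h44
    have : (0 : ℝ) ≤ r ^ 2 := by positivity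
    nlinarith
  have le1 : ∀ c : ℝ, 0 ≤ c → c ≤ 1 → ∀ d : ℕ, ∀ Q : ℝ, 0 ≤ Q → Q * c ^ d ≤ Q := by
    intro c h0 h1 d Q hQ
    have := pow_le_one₀ (n := d) h0 h1
    nlinarith
  have fin7 := fin8.trans (le1 (1/6) (by norm_num) (by norm_num) _ _ (by positivity))
  have fin6 := fin7.trans (le1 (2/7) (by norm_num) (by norm_num) _ _ (by positivity))
  have fin5 := fin6.trans (le1 (1/2) (by norm_num) (by norm_num) _ _ (by positivity))
  rcases le_total h (5 * j) with h5 | h5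
  · exact fin5.trans (q5 h (by omega) h5)
  rcases le_total h (6 * j) with h6 | h6
  · exact fin6.trans (q6 h h5 h6)
  rcases le_total h (7 * j) with h7 | h7
  · exact fin7.trans (q7 h h6 h7)
  · exact fin8.trans (q8 h7)

noncomputable def Xf (r i : ℕ) : ℝ := ((r : ℝ) - i) / (4 * (i + 1))

theorem X_eq {r l : ℕ} (hr : l ≤ r) :
    (r.choose l : ℝ) = 4 ^ l * ∏ i ∈ range l, Xf r i := by
  induction l with
  | zero => simp
  | succ l ih =>
    rw [prod_range_succ]
    have ih := ih (by omega)
    have e1 : (r.choose (l + 1) : ℝ) * (l + 1) = r.choose l * (r - l) := by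
      have := Nat.choose_succ_right_eq r l
      rw [← Nat.cast_sub (by omega)]
      exact_mod_cast this
    have hh : (0 : ℝ) < (l : ℝ) + 1 := by positivity
    have e3 : (r.choose (l + 1) : ℝ) = r.choose l * (r - l) / (l + 1) := by
      rw [eq_div_iff hh.ne', e1]
    rw [e3, ih, Xf]
    field_simp
    ring

theorem Xf_ge {r i : ℕ} {x c : ℝ} (hx : ((i : ℝ) + 1) ≤ x * r)
    (hc0 : 0 ≤ c) (hc : c * (4 * x) ≤ 1 - x) : c ≤ Xf r i := by
  have hi : (0 : ℝ) ≤ i := by positivity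
  have hr : (0 : ℝ) ≤ r := by positivity
  rw [Xf, le_div_iff₀ (by positivity)]
  calc c * (4 * ((i : ℝ) + 1)) ≤ c * (4 * (x * r)) := by gcongr
    _ = (c * (4 * x)) * r := by ring
    _ ≤ (1 - x) * r := by gcongr
    _ ≤ r - i := by linarith

theorem Xprod_ge {r l : ℕ} (hr : 512 ≤ r) (hh : 4 ≤ l) (hhr : 3 * l ≤ r) :
    (r : ℝ) ^ 2 ≤ ∏ i ∈ range l, Xf r i := by
  have hr' : (512 : ℝ) ≤ r := by exact_mod_cast hr
  have h3 : 40 * (r : ℝ) ^ 2 ≤ ∏ i ∈ range 4, Xf r i := by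
    simp only [prod_range_succ, prod_range_zero, Xf]
    push_cast
    have e : (1 : ℝ) * ((r - 0) / (4 * (0 + 1))) * ((r - 1) / (4 * (1 + 1))) *
       ((r - 2) / (4 * (2 + 1))) * ((r - 3) / (4 * (3 + 1)))
      = r * (r - 1) * (r - 2) * (r - 3) / 6144 := by
      field_simp
      ring
    rw [e, le_div_iff₀ (by positivity)]
    have a1 : (0.99 : ℝ) * r ≤ r - 3 := by linarith
    have a2 : (0.99 : ℝ) * r ≤ r - 2 := by linarith
    have a3 : (0.99 : ℝ) * r ≤ r - 1 := by linarith
    calc 40 * (r : ℝ) ^ 2 * 6144 ≤ r * (0.99 * r) * (0.99 * r) * (0.99 * r) := by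
          have : (0 : ℝ) ≤ r ^ 2 := by positivity
          have : (262144 : ℝ) ≤ r ^ 2 := by nlinarith
          nlinarith
      _ ≤ _ := by
          have p1 : 0 ≤ (r : ℝ) * (r - 1) := mul_nonneg (by linarith) (by linarith)
          have p2 : 0 ≤ (r : ℝ) * (r - 1) * (r - 2) := mul_nonneg p1 (by linarith)
          gcongr
  have hQ0 : (0 : ℝ) ≤ 40 * (r : ℝ) ^ 2 := by positivity
  obtain ⟨j, hj⟩ : ∃ j, j = r / 15 := ⟨_, rfl⟩
  have hj1 : 15 * j ≤ r := by omega
  have hj2 : r < 15 * j + 15 := by omega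
  have hj3 : 34 ≤ j := by omega
  have hjr : 15 * (j : ℝ) ≤ r := by exact_mod_cast hj1
  have blk : ∀ (b : ℕ) (c : ℝ), 0 ≤ c → c * (4 * (b / 15)) ≤ 1 - (b : ℝ) / 15 →
      ∀ i, i < b * j → c ≤ Xf r i := by
    intro b c hc hcx i hi
    refine Xf_ge (x := b / 15) ?_ hc hcx
    have : ((i : ℝ) + 1) ≤ b * j := by exact_mod_cast hi
    have : (b : ℝ) * (15 * j) ≤ b * r := by gcongr
    linarith
  have b1 := blk 1 (7/2) (by norm_num) (by norm_num)
  have b2 := blk 2 (13/8) (by norm_num) (by norm_num)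
  have b3 := blk 3 1 (by norm_num) (by norm_num)
  have b4 := blk 4 (11/16) (by norm_num) (by norm_num)
  have b8 : ∀ i, i < l → (1/2 : ℝ) ≤ Xf r i := by
    intro i hi
    refine Xf_ge (x := 1 / 3) ?_ (by norm_num) (by norm_num)
    have h1 : ((i : ℝ) + 1) ≤ l := by exact_mod_cast hi
    have h2 : 3 * (l : ℝ) ≤ r := by exact_mod_cast hhr
    linarith
  rcases le_or_gt l (3 * j) with hc | hc
  · refine le_trans ?_ (seg_one hh (fun i _ hi => b3 i (by omega)) hQ0 h3)
    have : (0 : ℝ) ≤ r ^ 2 := by positivity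
    nlinarith
  have q1 := seg_up (b := 1 * j) (by omega) (by norm_num) (fun i _ hi => b1 i hi) hQ0 h3
  have q2 := seg_up (b := 2 * j) (by omega) (by norm_num) (fun i _ hi => b2 i hi) (by positivity) q1
  have q3 := seg_one (b := 3 * j) (by omega) (fun i _ hi => b3 i hi) (by positivity) q2
  rw [show 1 * j - 4 = j - 4 by omega, show 2 * j - 1 * j = j by omega] at q3
  have q4 : ∀ b, 3 * j ≤ b → b ≤ 4 * j → 40 * (r : ℝ) ^ 2 * (7 / 2) ^ (j - 4) * (13 / 8) ^ j *
      (11 / 16) ^ j ≤ ∏ i ∈ range b, Xf r i := fun b h1 h2 =>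
    seg_down h1 (by omega) (by norm_num) (by norm_num) (fun i _ hi => b4 i (by omega))
      (by positivity) q3
  have q5 : 4 * j ≤ l → 40 * (r : ℝ) ^ 2 * (7 / 2) ^ (j - 4) * (13 / 8) ^ j *
      (11 / 16) ^ j * (1 / 2) ^ (j + 5) ≤ ∏ i ∈ range l, Xf r i := fun h1 =>
    seg_down h1 (by omega) (by norm_num) (by norm_num) (fun i _ hi => b8 i (by omega))
      (by positivity) (q4 (4 * j) (by omega) le_rfl)
  have fin5 : (r : ℝ) ^ 2 ≤ 40 * (r : ℝ) ^ 2 * (7 / 2) ^ (j - 4) * (13 / 8) ^ j *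
      (11 / 16) ^ j * (1 / 2) ^ (j + 5) := by
    obtain ⟨i, rfl⟩ := Nat.exists_eq_add_of_le' (show 4 ≤ j by omega)
    rw [Nat.add_sub_cancel]
    have e : 40 * (r : ℝ) ^ 2 * (7 / 2) ^ i * (13 / 8) ^ (i + 4) *
      (11 / 16) ^ (i + 4) * (1 / 2) ^ (i + 4 + 5) = 40 * r ^ 2 * (1001 / 512) ^ i *
        ((13 / 8) ^ 4 * (11 / 16) ^ 4 * (1 / 2) ^ 9) := by
      rw [show (1001 / 512 : ℝ) = (7 / 2) * (13 / 8) * (11 / 16) * (1 / 2) by norm_num]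
      simp only [pow_add, mul_pow]; ring
    rw [e]
    have h42 : (1001 / 512 : ℝ) ^ 30 ≤ (1001 / 512) ^ i := pow_le_pow_right₀ (by norm_num) (by omega)
    have h43 : (1000 : ℝ) ≤ (1001 / 512) ^ i := le_trans (by norm_num) h42
    have h44 : 40 * (r : ℝ) ^ 2 * 1000 * ((13 / 8) ^ 4 * (11 / 16) ^ 4 * (1 / 2) ^ 9) ≤ 40 * r ^ 2 * (1001 / 512) ^ i *
        ((13 / 8) ^ 4 * (11 / 16) ^ 4 * (1 / 2) ^ 9) := by
      gcongr
    refine le_trans ?_ h44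
    have : (0 : ℝ) ≤ r ^ 2 := by positivity
    nlinarith
  rcases le_total l (4 * j) with h5 | h5
  · refine fin5.trans (le_trans ?_ (q4 l (by omega) h5))
    have := pow_le_one₀ (n := j + 5) (show (0 : ℝ) ≤ 1 / 2 by norm_num) (by norm_num)
    have h0 : 0 ≤ 40 * (r : ℝ) ^ 2 * (7 / 2) ^ (j - 4) * (13 / 8) ^ j * (11 / 16) ^ j := by positivity
    nlinarith
  · exact fin5.trans (q5 h5)
theorem c2_eq (n : ℕ) : 2 * (n + 2).choose 2 = (n + 1) * (n + 2) := by
  have := Nat.ascFactorial_eq_factorial_mul_choose (n) 2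
  simp [Nat.ascFactorial, Nat.factorial] at this
  linarith

theorem c3_eq (n : ℕ) : 6 * (n + 3).choose 3 = (n + 1) * (n + 2) * (n + 3) := by
  have := Nat.ascFactorial_eq_factorial_mul_choose (n) 3
  simp [Nat.ascFactorial, Nat.factorial] at this
  linarith

theorem c4_eq (n : ℕ) : 24 * (n + 4).choose 4 = (n + 1) * (n + 2) * (n + 3) * (n + 4) := by
  have := Nat.ascFactorial_eq_factorial_mul_choose (n) 4
  simp [Nat.ascFactorial, Nat.factorial] at this
  linarith

theorem vand3 (l y : ℕ) (hl : 3 ≤ l) : l.choose 3 * y.choose 3 ≤ (l + y).choose l := by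
  rw [Nat.add_choose_eq]
  have : l.choose 3 * y.choose 3 = l.choose ((l - 3, 3) : ℕ × ℕ).1 * y.choose ((l - 3, 3) : ℕ × ℕ).2 := by
    simp only
    rw [Nat.choose_symm hl]
  rw [this]
  exact single_le_sum (f := fun x : ℕ × ℕ => l.choose x.1 * y.choose x.2)
    (fun _ _ => Nat.zero_le _) (mem_antidiagonal.2 (by simp; omega))

theorem F_large {r l y : ℕ} (hr : 512 ≤ r) (hl : 2 ≤ l) (hlr : 3 * l ≤ r) (hy : y = r / l) :
    3769 * (r * (r + y)) ≤ 1000 * (y * (l + y).choose l) := by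
  have hy1 : l * y ≤ r := by rw [hy]; exact Nat.mul_div_le r l
  have hy2 : r < l * (y + 1) := by
    rw [hy]; exact Nat.lt_mul_div_succ r (by omega)
  have hy3 : 3 ≤ y := by rw [hy, Nat.le_div_iff_mul_le (by omega)]; omega
  clear hy
  -- small cases
  rcases Nat.lt_or_ge l 4 with h4 | h4
  · interval_cases l
    · have e := c2_eq y
      rw [add_comm 2 y]
      have : 255 ≤ y := by omega
      have h1 : r * (r + y) ≤ (2 * y + 1) * (3 * y + 1) := Nat.mul_le_mul (by omega) (by omega)
      have h2 : 3769 * ((2 * y + 1) * (3 * y + 1)) ≤ 500 * (y * ((y + 1) * (y + 2))) := by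
        obtain ⟨x, rfl⟩ := Nat.exists_eq_add_of_le this
        nlinarith [sq_nonneg x]
      rw [← e] at h2
      nlinarith
    · have e := c3_eq y
      rw [add_comm 3 y]
      have : 170 ≤ y := by omega
      have h1 : r * (r + y) ≤ (3 * y + 2) * (4 * y + 2) := Nat.mul_le_mul (by omega) (by omega)
      have h2 : 6 * 3769 * ((3 * y + 2) * (4 * y + 2)) ≤ 1000 * (y * ((y + 1) * (y + 2) * (y + 3))) := by
        have : 6 * 3769 * ((3 * y + 2) * (4 * y + 2)) ≤ 6 * 3769 * (20 * (y * (y + 1))) :=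
          Nat.mul_le_mul_left _ (by nlinarith)
        refine this.trans ?_
        have : 1000 * (172 * 173) ≤ 1000 * ((y + 2) * (y + 3)) :=
          Nat.mul_le_mul_left _ (Nat.mul_le_mul (by omega) (by omega))
        calc 6 * 3769 * (20 * (y * (y + 1))) ≤ (1000 * (172 * 173)) * (y * (y + 1)) := by
              rw [← mul_assoc]; exact Nat.mul_le_mul_right _ (by norm_num)
          _ ≤ 1000 * ((y + 2) * (y + 3)) * (y * (y + 1)) := Nat.mul_le_mul_right _ this
          _ = _ := by ring
      rw [← e] at h2
      nlinarith
  rcases Nat.lt_or_ge y 5 with h5 | h5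
  · have hsym : (l + y).choose l = (l + y).choose y := by
      rw [← Nat.choose_symm_add]
    rw [hsym]
    interval_cases y
    · have e := c3_eq l
      have : 129 ≤ l := by omega
      have h1 : r * (r + 3) ≤ (4 * l) * (4 * l + 3) := Nat.mul_le_mul (by omega) (by omega)
      have h2 : 3769 * ((4 * l) * (4 * l + 3)) ≤ 500 * ((l + 1) * (l + 2) * (l + 3)) := by
        obtain ⟨x, rfl⟩ := Nat.exists_eq_add_of_le this
        nlinarith [sq_nonneg x]
      rw [← e] at h2
      omega
    · have e := c4_eq l
      have : 103 ≤ l := by omega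
      have h1 : r * (r + 4) ≤ (5 * l) * (5 * l + 4) := Nat.mul_le_mul (by omega) (by omega)
      have h2 : 6 * 3769 * ((5 * l) * (5 * l + 4)) ≤ 1000 * ((l + 1) * (l + 2) * (l + 3) * (l + 4)) := by
        have a1 : (5 * l) * (5 * l + 4) ≤ 25 * ((l + 1) * (l + 2)) := by nlinarith
        have a2 : 100 * 100 ≤ (l + 3) * (l + 4) := Nat.mul_le_mul (by omega) (by omega)
        nlinarith
      rw [← e] at h2
      omega
  have hv := vand3 l y (by omega)
  obtain ⟨a, rfl⟩ := Nat.exists_eq_add_of_le' (show 3 ≤ l by omega)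
  obtain ⟨b, rfl⟩ := Nat.exists_eq_add_of_le' (show 3 ≤ y by omega)
  have ea := c3_eq a
  have eb := c3_eq b
  -- set real-ish bounds
  have ca : 3 * (a + 3) ^ 3 ≤ 48 * (a + 3).choose 3 := by
    have : 3 * (a + 3) ^ 2 ≤ 8 * ((a + 1) * (a + 2)) := by nlinarith
    calc 3 * (a + 3) ^ 3 = 3 * (a + 3) ^ 2 * (a + 3) := by ring
      _ ≤ 8 * ((a + 1) * (a + 2)) * (a + 3) := Nat.mul_le_mul_right _ this
      _ = 8 * (6 * (a + 3).choose 3) := by rw [ea]; ring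
      _ = _ := by ring
  have cb : 3 * (b + 3) ^ 3 ≤ 48 * (b + 3).choose 3 := by
    have : 3 * (b + 3) ^ 2 ≤ 8 * ((b + 1) * (b + 2)) := by nlinarith
    calc 3 * (b + 3) ^ 3 = 3 * (b + 3) ^ 2 * (b + 3) := by ring
      _ ≤ 8 * ((b + 1) * (b + 2)) * (b + 3) := Nat.mul_le_mul_right _ this
      _ = 8 * (6 * (b + 3).choose 3) := by rw [eb]; ring
      _ = _ := by ring
  generalize hA : a + 3 = A at *
  generalize hB : b + 3 = B at *
  have hcc : A ^ 3 * B ^ 3 ≤ 256 * (A + B).choose A := by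
    have h1 := Nat.mul_le_mul ca cb
    have : 9 * (A ^ 3 * B ^ 3) ≤ 2304 * (A.choose 3 * B.choose 3) := by nlinarith
    omega
  have hAB : 4 * r ≤ 5 * (A * B) := by nlinarith
  have hAB2 : 4 * (r + B) ≤ 6 * (A * B) := by nlinarith
  have hABn : 426 ≤ A * B := by nlinarith
  have h16 : 16 * (r * (r + B)) ≤ 30 * (A * B) ^ 2 := by
    have := Nat.mul_le_mul hAB hAB2
    nlinarith
  have hfin : 3769 * 30 * 16 * (A * B) ^ 2 ≤ 1000 * B * (A ^ 3 * B ^ 3) := by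
    have : 5 * 426 ≤ B * (A * B) := Nat.mul_le_mul h5 hABn
    calc 3769 * 30 * 16 * (A * B) ^ 2 ≤ 1000 * (5 * 426) * (A * B) ^ 2 :=
          Nat.mul_le_mul_right _ (by norm_num)
      _ ≤ 1000 * (B * (A * B)) * (A * B) ^ 2 :=
          Nat.mul_le_mul_right _ (Nat.mul_le_mul_left _ this)
      _ = _ := by ring
  have h6 : 1000 * B * (A ^ 3 * B ^ 3) ≤ 1000 * B * (256 * (A + B).choose A) :=
    Nat.mul_le_mul_left _ hcc
  nlinarith

theorem F_ind {r h l : ℕ} (hr : r = h + l) (i : ℕ) :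
    ((i + 1) * (l + i + 1).choose l * h ^ i * (r + i + 1).descFactorial h : ℕ) ≤
      r.choose h * (h + i).descFactorial h * (r + i + 1) * r ^ i := by
  induction i with
  | zero =>
    have e1 : (r + 1 - h) * (r + 1).descFactorial h = (r + 1) * r.descFactorial h := by
      simpa using Nat.succ_descFactorial r h
    have e2 : r + 1 - h = l + 1 := by omega
    rw [e2] at e1
    have e3 := Nat.descFactorial_eq_factorial_mul_choose r h
    simp only [pow_zero, mul_one, add_zero, zero_add, one_mul]
    rw [Nat.choose_succ_self_right, Nat.descFactorial_self, e1, e3]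
    apply le_of_eq; ring
  | succ i ih =>
    have e1 : (i + 1) * (h + i + 1).descFactorial h = (h + i + 1) * (h + i).descFactorial h := by
      have := Nat.succ_descFactorial (h + i) h
      rwa [show h + i + 1 - h = i + 1 by omega] at this
    have e2 : (l + i + 2) * (r + i + 2).descFactorial h
        = (r + i + 2) * (r + i + 1).descFactorial h := by
      have := Nat.succ_descFactorial (r + i + 1) h
      rwa [show r + i + 1 + 1 - h = l + i + 2 by omega] at this
    have e3 : (i + 2) * (l + i + 2).choose l = (l + i + 2) * (l + i + 1).choose l := by
      have := Nat.choose_mul_succ_eq (l + i + 1) l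
      rw [show l + i + 1 + 1 - l = i + 2 by omega] at this
      linarith
    rw [show r + (i + 1) + 1 = r + i + 2 by ring, show l + (i + 1) + 1 = l + i + 2 by ring,
      show h + (i + 1) = h + i + 1 by ring, show i + 1 + 1 = i + 2 by ring]
    refine Nat.le_of_mul_le_mul_left ?_ (show 0 < (l + i + 2) * (i + 1) * (r + i + 1) by positivity)
    have k1 : h * (r + i + 1) ≤ (h + i + 1) * r := by
      subst hr; nlinarith
    calc (l + i + 2) * (i + 1) * (r + i + 1) *
          ((i + 2) * (l + i + 2).choose l * h ^ (i + 1) * (r + i + 2).descFactorial h)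
        = ((i + 2) * (l + i + 2).choose l) * ((l + i + 2) * (r + i + 2).descFactorial h) *
            ((i + 1) * (r + i + 1) * h ^ (i + 1)) := by ring
      _ = ((i + 1) * (l + i + 1).choose l * h ^ i * (r + i + 1).descFactorial h) *
            ((l + i + 2) * (r + i + 2) * (h * (r + i + 1))) := by rw [e2, e3]; ring
      _ ≤ (r.choose h * (h + i).descFactorial h * (r + i + 1) * r ^ i) *
            ((l + i + 2) * (r + i + 2) * ((h + i + 1) * r)) :=
          Nat.mul_le_mul ih (Nat.mul_le_mul_left _ k1)
      _ = (l + i + 2) * (r + i + 1) * (r.choose h * ((h + i + 1) * (h + i).descFactorial h)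
            * (r + i + 2) * r ^ (i + 1)) := by ring
      _ = _ := by rw [← e1]; ring

/-- The `q = 1` criterion. -/
theorem F_crit {r h l y : ℕ} (hr : r = h + l) (hh : 1 ≤ h) (hy1 : 1 ≤ y) (hly : l * y ≤ r)
    (hF : 3769 * (r * (r + y)) ≤ 1000 * (y * (l + y).choose l)) :
    6932 * (2 * r) * (r + y).descFactorial h < 10000 * r.choose h * (h + y - 1).descFactorial h := by
  obtain ⟨i, rfl⟩ := Nat.exists_eq_add_of_le' hy1
  have hI := F_ind hr i
  rw [show h + (i + 1) - 1 = h + i by omega, show r + (i + 1) = r + i + 1 by ring]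
  rw [show l + (i + 1) = l + i + 1 by ring, show r + (i + 1) = r + i + 1 by ring] at hF
  have hr0 : (0 : ℝ) < r := by exact_mod_cast (by omega : 0 < r)
  have hh0 : (0 : ℝ) < h := by exact_mod_cast hh
  have hexp : (r : ℝ) ^ i ≤ 2.7183 * h ^ i := by
    have h1 : (r : ℝ) = h * (1 + l / h) := by
      rw [hr]; push_cast; field_simp
    have h2 : (1 + (l : ℝ) / h) ^ i ≤ Real.exp 1 := by
      calc (1 + (l : ℝ) / h) ^ i ≤ (Real.exp (l / h)) ^ i := by
            gcongr
            have := Real.add_one_le_exp ((l : ℝ) / h)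
            linarith
        _ = Real.exp (i * (l / h)) := (Real.exp_nat_mul _ _).symm
        _ ≤ Real.exp 1 := by
            apply Real.exp_le_exp.2
            rw [← mul_div_assoc, div_le_one hh0]
            have : l * i ≤ h := by nlinarith
            have : (l : ℝ) * i ≤ h := by exact_mod_cast this
            linarith
    have h3 := Real.exp_one_lt_d9
    rw [h1, mul_pow, mul_comm]
    have : (1 + (l : ℝ) / h) ^ i ≤ 2.7183 := by linarith
    gcongr
  have hI' : ((i : ℝ) + 1) * (l + i + 1).choose l * h ^ i * (r + i + 1).descFactorial h ≤
      r.choose h * (h + i).descFactorial h * (r + i + 1) * r ^ i := by exact_mod_cast hI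
  have hF' : (3769 : ℝ) * (r * (r + i + 1)) ≤ 1000 * ((i + 1) * (l + i + 1).choose l) := by
    exact_mod_cast hF
  have hd0 : (0 : ℝ) < (r + i + 1).descFactorial h := by
    exact_mod_cast Nat.descFactorial_pos.2 (by omega : h ≤ r + i + 1)
  have hhi : (0 : ℝ) < (h : ℝ) ^ i := by positivity
  -- combine
  have s1 : (3769 : ℝ) * (r * (r + i + 1)) * (h ^ i * (r + i + 1).descFactorial h) ≤
      1000 * ((i + 1) * (l + i + 1).choose l) * (h ^ i * (r + i + 1).descFactorial h) := by
    gcongr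
  have s2 : (r.choose h * (h + i).descFactorial h * (r + i + 1) * r ^ i : ℝ) ≤
      r.choose h * (h + i).descFactorial h * (r + i + 1) * (2.7183 * h ^ i) := by
    gcongr
  have s3 : ((r : ℝ) + i + 1) * h ^ i * (3769 * r * (r + i + 1).descFactorial h) ≤
      ((r : ℝ) + i + 1) * h ^ i * (2718.3 * (r.choose h * (h + i).descFactorial h)) := by
    linarith
  have s4 := le_of_mul_le_mul_left s3 (by positivity)
  have s5 : (6932 : ℝ) * (2 * r) * (r + i + 1).descFactorial h <
      10000 * r.choose h * (h + i).descFactorial h := by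
    have : 0 < (r : ℝ) * (r + i + 1).descFactorial h := by positivity
    linarith
  exact_mod_cast s5

/-- the `q ≥ q0` density bound -/
theorem X_desc {h q0 : ℕ} (hq : 1 ≤ q0) (K : ℕ) :
    (q0 - 1) ^ K * (q0 * h + K).descFactorial h ≤ q0 ^ K * (q0 * h).descFactorial h := by
  induction K with
  | zero => simp
  | succ K ih =>
    have hle : h ≤ q0 * h := Nat.le_mul_of_pos_left _ hq
    have e := Nat.succ_descFactorial (q0 * h + K) h
    refine Nat.le_of_mul_le_mul_left ?_ (show 0 < q0 * h + K + 1 - h by omega)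
    have k1 : (q0 - 1) * (q0 * h + K + 1) ≤ q0 * (q0 * h + K + 1 - h) := by
      obtain ⟨p, rfl⟩ := Nat.exists_eq_add_of_le' hq
      obtain ⟨x, hx⟩ := Nat.exists_eq_add_of_le (show h ≤ (p + 1) * h + K + 1 by omega)
      rw [hx, Nat.add_sub_cancel_left, Nat.add_sub_cancel]
      nlinarith
    calc (q0 * h + K + 1 - h) * ((q0 - 1) ^ (K + 1) * (q0 * h + (K + 1)).descFactorial h)
        = (q0 - 1) ^ (K + 1) * ((q0 * h + K + 1 - h) * (q0 * h + K + 1).descFactorial h) := by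
          rw [← add_assoc]; ring
      _ = ((q0 - 1) ^ K * (q0 * h + K).descFactorial h) * ((q0 - 1) * (q0 * h + K + 1)) := by
          rw [e]; ring
      _ ≤ (q0 ^ K * (q0 * h).descFactorial h) * (q0 * (q0 * h + K + 1 - h)) :=
          Nat.mul_le_mul ih k1
      _ = _ := by ring
/-- Data of the remaining (greedy) case. -/
structure C4 (n k r h l m c t D : ℕ) : Prop where
  hrl : r = h + l
  hh : 3 ≤ h
  hl : 2 ≤ l
  hk : h + 1 ≤ k
  hkm : k ≤ m
  hq : 1 ≤ n / r
  hm : m = h * (n / r) + c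
  hc1 : h * (n % r) ≤ r * c
  hc2 : r * c < h * (n % r) + r
  hcs : c < n % r
  hch : c < h
  ht : HasStrongCover (completeEdges m k) r (h + 1) t
  ht1 : 1 ≤ t
  hD : (r - 1).choose (h - 1) ≤ D
  hDe : D = (r.choose h + r / h - 1) / (r / h)
  hres2 : l = 2 → Nat.log 2 r * (n / r) < r - n % r - 1
  hres3 : 3 ≤ l → n / r + c < h

namespace C4
variable {n k r h l m c t D : ℕ}

theorem ls (C : C4 n k r h l m c t D) : r ≤ l * (n % r) := by
  have h1 := C.hc1
  have h2 := C.hcs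
  have h3 : r * (c + 1) ≤ r * (n % r) := Nat.mul_le_mul_left _ h2
  have h4 : r * (n % r) = h * (n % r) + l * (n % r) := by rw [← add_mul, ← C.hrl]
  rw [mul_add] at h3
  omega

theorem sr (C : C4 n k r h l m c t D) : n % r < r := Nat.mod_lt _ (by have := C.hrl; have := C.hh; omega)

theorem ratio (C : C4 n k r h l m c t D) : h * n ≤ m * r := by
  have e := Nat.div_add_mod n r
  have h1 := C.hc1
  have h2 := C.hm
  calc h * n = h * (r * (n / r) + n % r) := by rw [e]
    _ = h * (n / r) * r + h * (n % r) := by ring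
    _ ≤ h * (n / r) * r + r * c := by omega
    _ = m * r := by rw [h2]; ring

theorem mn (C : C4 n k r h l m c t D) : m ≤ n := by
  have e := Nat.div_add_mod n r
  have h1 := C.hcs
  have h2 : h * (n / r) ≤ r * (n / r) := Nat.mul_le_mul_right _ (by have := C.hrl; omega)
  have := C.hm
  omega

theorem nlt (C : C4 n k r h l m c t D) : n < (n / r + 1) * r := by
  have e := Nat.div_add_mod n r
  have := C.sr
  rw [add_mul, mul_comm]; omega

theorem sge (C : C4 n k r h l m c t D) : r * (n / r) ≤ n := Nat.mul_div_le n r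

theorem nrh (C : C4 n k r h l m c t D) : n ≤ r * h := by
  have h1 := C.nlt
  have h2 : n / r + 1 ≤ h := by
    rcases Nat.lt_or_ge l 3 with h3 | h3
    · have hl2 : l = 2 := by have := C.hl; omega
      have h4 := C.hres2 hl2
      have hr : 4 ≤ r := by have := C.hrl; have := C.hh; omega
      have h5 : 2 ≤ Nat.log 2 r := by
        have : Nat.log 2 4 ≤ Nat.log 2 r := Nat.log_mono_right hr
        have e : Nat.log 2 4 = 2 := by decide
        omega
      have h6 : 2 * (n / r) ≤ Nat.log 2 r * (n / r) := Nat.mul_le_mul_right _ h5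
      have h7 := C.ls
      have := C.hrl
      subst hl2
      have := C.hh
      omega
    · have := C.hres3 h3
      have h7 := C.hc1
      have h8 := C.hcs
      have : 1 ≤ c := by
        by_contra h0
        have h0 : c = 0 := by omega
        have hh := C.hh
        rw [h0, mul_zero] at h7
        have : h * (n % r) = 0 := by omega
        rcases Nat.mul_eq_zero.1 this with h9 | h9 <;> omega
      omega
  rw [mul_comm]
  exact h1.le.trans (Nat.mul_le_mul_right _ h2)

theorem Dchoose (C : C4 n k r h l m c t D) (hlh : l < h) : D = r.choose h := by
  rw [C.hDe]
  have : r / h = 1 := by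
    rw [C.hrl]
    rw [Nat.add_div_left _ (by have := C.hh; omega), Nat.div_eq_of_lt hlh]
  rw [this]; simp

/-- general density bound -/
theorem cover_AB (C : C4 n k r h l m c t D) {A B a b w : ℕ} (h1 : A * n ≤ m * B) (hAB : A ≤ B)
    (hBn : B ≤ n) (hhB : h ≤ B) (hb : 0 < b)
    (hab : a * B.descFactorial h ≤ b * A.descFactorial h) (hw : n ≤ w)
    (hx : 6932 * w * b < 10000 * D * a) :
    HasStrongCover (completeEdges n k) r (h + 1) (1 + D * t) := by
  refine cover_P C.hk C.hkm C.mn C.ht C.ht1 hb ?_ (lt_of_le_of_lt ?_ hx)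
  · have h2 := desc_ratio h1 hAB hBn h
    have hpos : 0 < B.descFactorial h := Nat.descFactorial_pos.2 hhB
    refine Nat.le_of_mul_le_mul_right ?_ hpos
    calc a * n.descFactorial h * B.descFactorial h
        = (a * B.descFactorial h) * n.descFactorial h := by ring
      _ ≤ (b * A.descFactorial h) * n.descFactorial h := Nat.mul_le_mul_right _ hab
      _ = b * (A.descFactorial h * n.descFactorial h) := by ring
      _ ≤ b * (m.descFactorial h * B.descFactorial h) := Nat.mul_le_mul_left _ h2
      _ = _ := by ring
  · exact Nat.mul_le_mul_right _ (Nat.mul_le_mul_left _ hw)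

theorem cover_q0 (C : C4 n k r h l m c t D) {q0 a b w : ℕ} (hq0 : 1 ≤ q0) (hq : q0 ≤ n / r)
    (hb : 0 < b)
    (hab : a * (q0 * r).descFactorial h ≤ b * (q0 * h).descFactorial h) (hw : n ≤ w)
    (hx : 6932 * w * b < 10000 * D * a) :
    HasStrongCover (completeEdges n k) r (h + 1) (1 + D * t) := by
  have hhr : h ≤ r := by have := C.hrl; omega
  refine C.cover_AB (A := q0 * h) (B := q0 * r) ?_ (Nat.mul_le_mul_left _ hhr) ?_
    (hhr.trans (Nat.le_mul_of_pos_left _ hq0)) hb hab hw hx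
  · have := C.ratio
    calc q0 * h * n = q0 * (h * n) := by ring
      _ ≤ q0 * (m * r) := Nat.mul_le_mul_left _ this
      _ = _ := by ring
  · refine le_trans ?_ C.sge
    rw [mul_comm]; exact Nat.mul_le_mul_left _ hq

theorem cover_X (C : C4 n k r h l m c t D) {q0 w : ℕ} (hq0 : 2 ≤ q0) (hq : q0 ≤ n / r)
    (hw : n ≤ w)
    (hx : 6932 * w * q0 ^ (q0 * l) < 10000 * D * (q0 - 1) ^ (q0 * l)) :
    HasStrongCover (completeEdges n k) r (h + 1) (1 + D * t) := by
  refine C.cover_q0 (q0 := q0) (a := (q0 - 1) ^ (q0 * l)) (b := q0 ^ (q0 * l)) (by omega) hq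
    (by positivity) ?_ hw hx
  have := X_desc (h := h) (q0 := q0) (by omega) (q0 * l)
  rwa [← mul_add, ← C.hrl] at this

theorem cover_F (C : C4 n k r h l m c t D) {y : ℕ} (hq : n / r = 1) (hy : 1 ≤ y)
    (hly : l * y ≤ r)
    (hx : 6932 * (2 * r) * (r + y).descFactorial h < 10000 * D * (h + y - 1).descFactorial h) :
    HasStrongCover (completeEdges n k) r (h + 1) (1 + D * t) := by
  have e := Nat.div_add_mod n r
  rw [hq, mul_one] at e
  have hl := C.hl
  have hys : y ≤ n % r := by
    have := C.ls
    exact Nat.le_of_mul_le_mul_left (hly.trans this) (by omega)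
  have hrl := C.hrl
  refine C.cover_AB (A := h + y - 1) (B := r + y) ?_ (by omega) (by omega) (by omega)
    (Nat.descFactorial_pos.2 (by omega)) (by rw [mul_comm]) (w := 2 * r) ?_ hx
  · have hR := C.ratio
    refine Nat.le_of_mul_le_mul_right ?_ (show 0 < r by omega)
    have h1 : (h + y - 1) * r ≤ h * (r + y) := by
      obtain ⟨x, rfl⟩ := Nat.exists_eq_add_of_le' hy
      rw [show h + (x + 1) - 1 = h + x by omega, hrl]
      rw [hrl] at hly
      nlinarith
    calc (h + y - 1) * n * r = ((h + y - 1) * r) * n := by ring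
      _ ≤ h * (r + y) * n := Nat.mul_le_mul_right _ h1
      _ = (h * n) * (r + y) := by ring
      _ ≤ (m * r) * (r + y) := Nat.mul_le_mul_right _ hR
      _ = _ := by ring
  · have := C.sr; omega

/-- large `r`, small `l` -/
theorem large_small (C : C4 n k r h l m c t D) (hr : 128 ≤ r) (hl3 : 3 * l ≤ r)
    (hF : ∀ y, y = r / l → 3769 * (r * (r + y)) ≤ 1000 * (y * (l + y).choose l))
    (hX : 4 ≤ l → 6932 * (r * r) * 4 ^ l < 10000 * r.choose l) :
    HasStrongCover (completeEdges n k) r (h + 1) (1 + D * t) := by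
  have hrl := C.hrl
  have hl := C.hl
  have hDc := C.Dchoose (by omega)
  have hsym : r.choose h = r.choose l := by rw [hrl]; exact Nat.choose_symm_add
  have hnlt := C.nlt
  rcases Nat.lt_or_ge (n / r) 2 with hq | hq
  · have hq1 : n / r = 1 := by have := C.hq; omega
    have hy1 : 1 ≤ r / l := (Nat.le_div_iff_mul_le (by omega)).2 (by omega)
    have hly : l * (r / l) ≤ r := Nat.mul_div_le r l
    refine C.cover_F hq1 hy1 hly ?_
    rw [hDc]
    exact F_crit hrl (by omega) hy1 hly (hF _ rfl)
  rcases Nat.lt_or_ge l 4 with hl4 | hl4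
  swap
  · refine C.cover_X (q0 := 2) (w := r * r) le_rfl hq ?_ ?_
    · exact C.nrh.trans (Nat.mul_le_mul_left _ (by omega))
    · rw [hDc, hsym, pow_mul]
      simpa using hX hl4
  have hs := C.ls
  rcases Nat.lt_or_ge l 3 with h2 | h2
  · have hl2 : l = 2 := by omega
    subst hl2
    have hz := C.hres2 rfl
    have h7 : 7 ≤ Nat.log 2 r := by
      have : Nat.log 2 128 ≤ Nat.log 2 r := Nat.log_mono_right hr
      have e : Nat.log 2 128 = 7 := Nat.log_pow (b := 2) (by norm_num) 7
      omega
    have h7q : 7 * (n / r) ≤ Nat.log 2 r * (n / r) := Nat.mul_le_mul_right _ h7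
    have hD2 : 2 * D = (r - 2 + 1) * r := by
      rw [hDc, hsym]
      have := c2_eq (r - 2)
      rwa [show r - 2 + 2 = r by omega] at this
    obtain ⟨x, hx⟩ := Nat.exists_eq_add_of_le hr
    have hD3 : 2 * D = (127 + x) * r := by rw [hD2]; congr 1; omega
    rcases Nat.lt_or_ge (n / r) 5 with h5 | h5
    · refine C.cover_X (q0 := 2) (w := 5 * r) (by norm_num) hq ?_ ?_
      · exact hnlt.le.trans (Nat.mul_le_mul_right _ (by omega))
      · norm_num
        nlinarith
    rcases Nat.lt_or_ge (n / r) 6 with h6 | h6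
    · refine C.cover_X (q0 := 5) (w := 6 * r) (by norm_num) h5 ?_ ?_
      · exact hnlt.le.trans (Nat.mul_le_mul_right _ (by omega))
      · norm_num
        nlinarith
    · refine C.cover_X (q0 := 6) (w := (n / r + 1) * r) (by norm_num) h6 hnlt.le ?_
      norm_num
      have hqb : 14 * (n / r + 1) ≤ 138 + x := by omega
      have : 14 * ((n / r + 1) * r) ≤ (138 + x) * r := by
        rw [← mul_assoc]; exact Nat.mul_le_mul_right _ hqb
      generalize (n / r + 1) * r = W at *
      nlinarith
  · have hl2 : l = 3 := by omega
    subst hl2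
    have hz := C.hres3 le_rfl
    have hc1 := C.hc1
    have hc3 : h ≤ 3 * c := by
      have : h * r ≤ 3 * c * r := by
        calc h * r ≤ h * (3 * (n % r)) := Nat.mul_le_mul_left _ hs
          _ = 3 * (h * (n % r)) := by ring
          _ ≤ 3 * (r * c) := Nat.mul_le_mul_left _ hc1
          _ = _ := by ring
      exact Nat.le_of_mul_le_mul_right this (by omega)
    have hD2 : 6 * D = (r - 3 + 1) * (r - 3 + 2) * r := by
      rw [hDc, hsym]
      have := c3_eq (r - 3)
      rwa [show r - 3 + 3 = r by omega] at this
    obtain ⟨x, hx⟩ := Nat.exists_eq_add_of_le hr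
    have hD3 : 6 * D = (126 + x) * (127 + x) * r := by rw [hD2]; congr 2 <;> omega
    rcases Nat.lt_or_ge (n / r) 10 with h5 | h5
    · refine C.cover_X (q0 := 2) (w := 10 * r) (by norm_num) hq ?_ ?_
      · exact hnlt.le.trans (Nat.mul_le_mul_right _ (by omega))
      · norm_num
        have : 126 * 127 * r ≤ (126 + x) * (127 + x) * r :=
          Nat.mul_le_mul_right _ (Nat.mul_le_mul (by omega) (by omega))
        omega
    · refine C.cover_X (q0 := 10) (w := (n / r + 1) * r) (by norm_num) h5 hnlt.le ?_
      have hqb : 3 * (n / r + 1) ≤ 2 * (127 + x) := by omega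
      have : 3 * ((n / r + 1) * r) ≤ 2 * (127 + x) * r := by
        rw [← mul_assoc]; exact Nat.mul_le_mul_right _ hqb
      have h126 : 126 * ((127 + x) * r) ≤ (126 + x) * (127 + x) * r := by
        rw [mul_assoc]; exact Nat.mul_le_mul_right _ (by omega)
      have : 0 < (127 + x) * r := by positivity
      norm_num
      generalize (n / r + 1) * r = W at *
      rw [mul_assoc] at *
      generalize (127 + x) * r = Y at *
      omega

theorem large512 (C : C4 n k r h l m c t D) (hr : 512 ≤ r) :
    HasStrongCover (completeEdges n k) r (h + 1) (1 + D * t) := by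
  have hrl := C.hrl
  rcases Nat.lt_or_ge r (3 * l) with h1 | h1
  · exact T0_of_prod (by omega) C.hh (by have := C.hl; omega) C.hk C.nrh C.ht1 C.hD
      (Bprod_ge hr C.hh (by omega))
  · refine C.large_small (by omega) h1 (fun y hy => F_large hr C.hl h1 hy) ?_
    intro h4
    have h2 := Xprod_ge hr h4 h1
    have h3 := X_eq (r := r) (l := l) (by omega)
    have h5 : ((4 : ℝ) ^ l) * (r : ℝ) ^ 2 ≤ r.choose l := by rw [h3]; gcongr
    have h6 : 4 ^ l * r ^ 2 ≤ r.choose l := by exact_mod_cast h5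
    have : 0 < 4 ^ l * r ^ 2 := by positivity
    nlinarith

end C4
/-! ### Kernel computations -/

/-- evaluate `x` before continuing -/
noncomputable def strict (x : ℕ) (f : ℕ → Bool) : Bool :=
  Nat.rec (motive := fun _ => Bool) (f 0) (fun n _ => f (Nat.succ n)) x

theorem strict_eq (x : ℕ) (f : ℕ → Bool) : strict x f = f x := by
  cases x <;> rfl

noncomputable def allBelow (P : ℕ → Bool) (n : ℕ) : Bool :=
  Nat.rec (motive := fun _ => Bool) true (fun i ih => strict i P && ih) n

theorem allBelow_spec {P : ℕ → Bool} {n : ℕ} (h : allBelow P n = true) : ∀ i < n, P i = true := by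
  induction n with
  | zero => intro i hi; omega
  | succ n ih =>
    have h' : (strict n P && allBelow P n) = true := h
    rw [Bool.and_eq_true, strict_eq] at h'
    intro i hi
    rcases Nat.lt_succ_iff_lt_or_eq.1 hi with h1 | h1
    · exact ih h'.2 i h1
    · rw [h1]; exact h'.1

/-- truncated product of the factors `Bf r i` -/
noncomputable def loopB (r rr fuel : ℕ) : ℕ → ℕ → Bool :=
  Nat.rec (motive := fun _ => ℕ → ℕ → Bool) (fun _ _ => true)
    (fun _ ih i b => (Nat.ble i 2 || Nat.ble rr (12 * b)) &&
      strict (b * ((r - i) * (r - i - 1)) / ((i + 1) * r)) fun b' => strict (i + 1) fun i' => ih i' b')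
    fuel

theorem loopB_spec {r rr : ℕ} (hr : 0 < r) (fuel : ℕ) : ∀ i b : ℕ, i + fuel ≤ r →
    (b : ℝ) ≤ 2 ^ 40 * ∏ j ∈ range i, Bf r j → loopB r rr fuel i b = true →
    ∀ h, 3 ≤ h → i ≤ h → h < i + fuel → (rr : ℝ) ≤ 12 * (2 ^ 40 * ∏ j ∈ range h, Bf r j) := by
  induction fuel with
  | zero => intro i b _ _ _ h _ h1 h2; omega
  | succ fuel ih =>
    intro i b hir hb hl h h3 h1 h2
    have hl' : ((Nat.ble i 2 || Nat.ble rr (12 * b)) &&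
      strict (b * ((r - i) * (r - i - 1)) / ((i + 1) * r)) fun b' => strict (i + 1) fun i' =>
        loopB r rr fuel i' b') = true := hl
    rw [Bool.and_eq_true, strict_eq, strict_eq, Bool.or_eq_true] at hl'
    rcases Nat.eq_or_lt_of_le h1 with h4 | h4
    · subst h4
      rcases hl'.1 with h5 | h5
      · have := Nat.le_of_ble_eq_true h5; omega
      · have h6 : (rr : ℝ) ≤ 12 * b := by exact_mod_cast Nat.le_of_ble_eq_true h5
        linarith
    · refine ih (i + 1) _ (by omega) ?_ hl'.2 h h3 h4 (by omega)
      rw [prod_range_succ, ← mul_assoc ((2 : ℝ) ^ 40)]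
      refine Nat.cast_div_le.trans ?_
      have e1 : ((r - i : ℕ) : ℝ) = r - i := Nat.cast_sub (by omega)
      have e2 : ((r - i - 1 : ℕ) : ℝ) = r - i - 1 := by
        rw [Nat.cast_sub (by omega), e1]; simp
      have hB : (0 : ℝ) ≤ Bf r i := by
        unfold Bf
        rw [← e2, ← e1]; positivity
      refine le_trans (le_of_eq ?_) (mul_le_mul_of_nonneg_right hb hB)
      unfold Bf
      push_cast
      rw [e1, e2]; ring

noncomputable def loopC (N fuel : ℕ) (f : ℕ → Bool) : ℕ → ℕ → Bool :=
  Nat.rec (motive := fun _ => ℕ → ℕ → Bool) (fun _ c => f c)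
    (fun _ ih i c => strict (c * (N - i) / (i + 1)) fun c' => strict (i + 1) fun i' => ih i' c')
    fuel

theorem choose_step (N i : ℕ) : N.choose i * (N - i) / (i + 1) = N.choose (i + 1) := by
  rw [← Nat.choose_succ_right_eq, Nat.mul_div_cancel _ (by omega)]

theorem loopC_eq (N fuel : ℕ) (f : ℕ → Bool) : ∀ i, loopC N fuel f i (N.choose i)
    = f (N.choose (i + fuel)) := by
  induction fuel with
  | zero => intro i; rfl
  | succ fuel ih =>
    intro i
    have : loopC N (fuel + 1) f i (N.choose i) =
      strict (N.choose i * (N - i) / (i + 1)) fun c' => strict (i + 1) fun i' =>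
        loopC N fuel f i' c' := rfl
    rw [this, strict_eq, strict_eq, choose_step, ih]
    congr 2; omega

/-- compute a binomial coefficient and continue -/
noncomputable def withChoose (N j : ℕ) (f : ℕ → Bool) : Bool := loopC N j f 0 1

theorem withChoose_eq (N j : ℕ) (f : ℕ → Bool) : withChoose N j f = f (N.choose j) := by
  have := loopC_eq N j f 0
  rw [Nat.choose_zero_right, zero_add] at this
  exact this

noncomputable def checkF (r l : ℕ) : Bool :=
  strict (r / l) fun y => strict (l + y) fun N =>
    withChoose N (bif Nat.ble l y then l else y) fun c =>
      Nat.ble (3769 * (r * (r + y))) (1000 * (y * c))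

theorem checkF_spec {r l : ℕ} (h : checkF r l = true) :
    ∀ y, y = r / l → 3769 * (r * (r + y)) ≤ 1000 * (y * (l + y).choose l) := by
  rintro y rfl
  unfold checkF at h
  rw [strict_eq, strict_eq, withChoose_eq] at h
  have h := Nat.le_of_ble_eq_true h
  rcases hb : Nat.ble l (r / l) with _ | _
  · rw [hb, cond_false, ← Nat.choose_symm_add] at h; exact h
  · rw [hb, cond_true] at h; exact h

noncomputable def loopX (r rr fuel : ℕ) : ℕ → ℕ → ℕ → Bool :=
  Nat.rec (motive := fun _ => ℕ → ℕ → ℕ → Bool) (fun _ _ _ => true)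
    (fun _ ih l c p4 => (Nat.ble l 3 || Nat.blt (6932 * rr * p4) (10000 * c)) &&
      ((Nat.ble l 1 || checkF r l) &&
      strict (c * (r - l) / (l + 1)) fun c' => strict (l + 1) fun l' => strict (4 * p4) fun p' =>
        ih l' c' p')) fuel

theorem loopX_spec {r : ℕ} (fuel : ℕ) : ∀ i : ℕ,
    loopX r (r * r) fuel i (r.choose i) (4 ^ i) = true →
    ∀ l, 2 ≤ l → i ≤ l → l < i + fuel → checkF r l = true ∧
      (4 ≤ l → 6932 * (r * r) * 4 ^ l < 10000 * r.choose l) := by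
  induction fuel with
  | zero => intro i _ h _ h1 h2; omega
  | succ fuel ih =>
    intro i hl l h2 h1 h3
    have hl' : ((Nat.ble i 3 || Nat.blt (6932 * (r * r) * 4 ^ i) (10000 * r.choose i)) &&
      ((Nat.ble i 1 || checkF r i) &&
      strict (r.choose i * (r - i) / (i + 1)) fun c' => strict (i + 1) fun l' =>
        strict (4 * 4 ^ i) fun p' => loopX r (r * r) fuel l' c' p')) = true := hl
    rw [Bool.and_eq_true, Bool.and_eq_true, strict_eq, strict_eq, strict_eq, Bool.or_eq_true,
      Bool.or_eq_true, choose_step] at hl'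
    rcases Nat.eq_or_lt_of_le h1 with h4 | h4
    · subst h4
      refine ⟨?_, fun h5 => ?_⟩
      · rcases hl'.2.1 with h6 | h6
        · have := Nat.le_of_ble_eq_true h6; omega
        · exact h6
      · rcases hl'.1 with h6 | h6
        · have := Nat.le_of_ble_eq_true h6; omega
        · exact Nat.le_of_ble_eq_true h6
    · have := hl'.2.2
      rw [← pow_succ'] at this
      exact ih (i + 1) this l h2 h4 (by omega)

noncomputable def checkMid (r : ℕ) : Bool :=
  strict (r * r) fun rr => strict (2 ^ 40 * rr) fun s => strict (2 ^ 40) fun b =>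
    loopB r s (3 * r / 4 + 1) 0 b && loopX r rr (r / 4 + 1) 0 1 1

set_option maxRecDepth 100000 in
theorem checkMid_a : allBelow (fun i => strict (128 + i) checkMid) 102 = true := by
  decide +kernel

set_option maxRecDepth 100000 in
theorem checkMid_b : allBelow (fun i => strict (230 + i) checkMid) 90 = true := by
  decide +kernel

set_option maxRecDepth 100000 in
theorem checkMid_c : allBelow (fun i => strict (320 + i) checkMid) 70 = true := by
  decide +kernel

set_option maxRecDepth 100000 in
theorem checkMid_d : allBelow (fun i => strict (390 + i) checkMid) 65 = true := by
  decide +kernel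

set_option maxRecDepth 100000 in
theorem checkMid_e : allBelow (fun i => strict (455 + i) checkMid) 57 = true := by
  decide +kernel

theorem checkMid_all {r : ℕ} (h1 : 128 ≤ r) (h2 : r < 512) : checkMid r = true := by
  rcases Nat.lt_or_ge r 230 with h | h
  · have hc := allBelow_spec checkMid_a (r - 128) (by omega)
    rwa [strict_eq, Nat.add_sub_cancel' (by omega)] at hc
  rcases Nat.lt_or_ge r 320 with h | h
  · have hc := allBelow_spec checkMid_b (r - 230) (by omega)
    rwa [strict_eq, Nat.add_sub_cancel' (by omega)] at hc
  rcases Nat.lt_or_ge r 390 with h | h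
  · have hc := allBelow_spec checkMid_c (r - 320) (by omega)
    rwa [strict_eq, Nat.add_sub_cancel' (by omega)] at hc
  rcases Nat.lt_or_ge r 455 with h | h
  · have hc := allBelow_spec checkMid_d (r - 390) (by omega)
    rwa [strict_eq, Nat.add_sub_cancel' (by omega)] at hc
  · have hc := allBelow_spec checkMid_e (r - 455) (by omega)
    rwa [strict_eq, Nat.add_sub_cancel' (by omega)] at hc

theorem C4.mid {n k r h l m c t D : ℕ} (C : C4 n k r h l m c t D) (h1 : 128 ≤ r) (h2 : r < 512) :
    HasStrongCover (completeEdges n k) r (h + 1) (1 + D * t) := by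
  have hc := checkMid_all h1 h2
  unfold checkMid at hc
  rw [strict_eq, strict_eq, strict_eq, Bool.and_eq_true] at hc
  have hrl := C.hrl
  have hl := C.hl
  rcases Nat.lt_or_ge r (4 * l) with h4 | h4
  · refine T0_of_prod (by omega) C.hh (by omega) C.hk C.nrh C.ht1 C.hD ?_
    have := loopB_spec (by omega) _ 0 (2 ^ 40) (by omega) (by norm_num) hc.1 h C.hh (by omega) (by omega)
    push_cast at this
    nlinarith
  · have := loopX_spec (r := r) (r / 4 + 1) 0 (by simpa using hc.2) l hl (by omega) (by omega)
    exact C.large_small h1 (by omega) (checkF_spec this.1) this.2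
/-! ### Small `r` -/

noncomputable def okc (w b D a : ℕ) : Bool :=
  Nat.blt (Nat.mul (Nat.mul 6932 w) b) (Nat.mul (Nat.mul 10000 D) a)

theorem okc_spec {w b D a : ℕ} (h : okc w b D a = true) : 6932 * w * b < 10000 * D * a :=
  Nat.le_of_ble_eq_true h

/-- fast binomial coefficient -/
noncomputable def chK (N j : ℕ) : ℕ :=
  Nat.rec (motive := fun _ => ℕ) 1
    (fun i ih => Nat.div (Nat.mul ih (Nat.sub N i)) (Nat.succ i)) j

theorem chK_eq (N j : ℕ) : chK N j = N.choose j := by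
  induction j with
  | zero => simp [chK]
  | succ j ih =>
    have : chK N (j + 1) = chK N j * (N - j) / (j + 1) := rfl
    rw [this, ih, choose_step]

noncomputable def cnK (m hk K : ℕ) : ℕ :=
  Nat.rec (motive := fun _ => ℕ) 1
    (fun i ih => Nat.mul ih (Nat.sub (Nat.mul (Nat.add m i) (Nat.succ (Nat.add m i))) hk)) K

theorem cnK_eq (m h k K : ℕ) : cnK m (h * k) K = cloneNum m h k K := by
  induction K with
  | zero => simp [cnK, cloneNum]
  | succ j ih =>
    have : cnK m (h * k) (j + 1) = cnK m (h * k) j * ((m + j) * (m + j + 1) - h * k) := rfl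
    rw [this, ih]
    exact (prod_range_succ _ _).symm

noncomputable def cdK (m K : ℕ) : ℕ :=
  Nat.rec (motive := fun _ => ℕ) 1
    (fun i ih => Nat.mul ih (Nat.mul (Nat.add m i) (Nat.succ (Nat.add m i)))) K

theorem cdK_eq (m K : ℕ) : cdK m K = cloneDen m K := by
  induction K with
  | zero => simp [cdK, cloneDen]
  | succ j ih =>
    have : cdK m (j + 1) = cdK m j * ((m + j) * (m + j + 1)) := rfl
    rw [this, ih]
    exact (prod_range_succ _ _).symm

/-- upper bound for `N.choose k`, `k ≥ K0` in a block -/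
noncomputable def chU (N K0 : ℕ) : ℕ :=
  strict2 (Nat.sub N K0) fun j => chK N (bif Nat.ble K0 j then K0 else j)
where
  strict2 (x : ℕ) (f : ℕ → ℕ) : ℕ :=
    Nat.rec (motive := fun _ => ℕ) (f 0) (fun n _ => f (Nat.succ n)) x

theorem chU_ge (N K0 : ℕ) : N.choose K0 ≤ chU N K0 := by
  have e : ∀ x f, chU.strict2 x f = f x := by intro x f; cases x <;> rfl
  unfold chU
  rw [e, chK_eq]
  rcases hb : Nat.ble K0 (Nat.sub N K0) with _ | _
  · rw [cond_false]
    rcases Nat.lt_or_ge N K0 with h1 | h1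
    · rw [Nat.choose_eq_zero_of_lt h1]; exact Nat.zero_le _
    · exact (Nat.choose_symm h1).ge
  · rw [cond_true]

theorem choose_anti_half {N K0 : ℕ} (h : N ≤ 2 * K0) {k : ℕ} (hk : K0 ≤ k) :
    N.choose k ≤ N.choose K0 := by
  induction k, hk using Nat.le_induction with
  | base => exact le_rfl
  | succ k hk ih =>
    refine le_trans ?_ ih
    have := Nat.choose_succ_right_eq N k
    refine Nat.le_of_mul_le_mul_right (c := k + 1) ?_ (by omega)
    rw [this]
    exact Nat.mul_le_mul_left _ (by omega)

noncomputable def uOK (N K0 K1 : ℕ) : Bool := Nat.ble N (Nat.mul 2 K0) || Nat.beq K0 K1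

theorem uOK_spec {N K0 K1 k : ℕ} (h : uOK N K0 K1 = true) (h0 : K0 ≤ k) (h1 : k ≤ K1) :
    N.choose k ≤ chU N K0 := by
  unfold uOK at h
  rw [Bool.or_eq_true] at h
  refine le_trans ?_ (chU_ge N K0)
  rcases h with h | h
  · exact choose_anti_half (Nat.le_of_ble_eq_true h) h0
  · have := Nat.eq_of_beq_eq_true h
    have : k = K0 := by omega
    rw [this]

noncomputable def blkOK (n m M h cC D K0 K1 : ℕ) : Bool :=
  strict (Nat.sub n m) fun K => strict (Nat.mul h K1) fun hk => strict (cnK m hk K) fun a =>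
    strict (cdK m K) fun b =>
      okc n b D a || (okc (Nat.add (Nat.succ (Nat.log2 cC)) M) b D a ||
        ((uOK M K0 K1 && okc (Nat.succ (Nat.log2 (Nat.mul cC (chU M K0)))) b D a) ||
         (uOK n K0 K1 && okc (Nat.succ (Nat.log2 (chU n K0))) b D a)))

theorem lt_two_pow_log2 (u : ℕ) : u ≤ 2 ^ (Nat.log2 u + 1) := Nat.lt_log2_self.le

theorem blkOK_spec {n k r h l m c t D K0 K1 : ℕ} (C : C4 n k r h l m c t D)
    (h0 : K0 ≤ k) (h1 : k ≤ K1)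
    (hb : blkOK n m (h * (n / r) + min (n % r) h) h (r.choose h) D K0 K1 = true) :
    HasStrongCover (completeEdges n k) r (h + 1) (1 + D * t) := by
  unfold blkOK at hb
  rw [strict_eq, strict_eq, strict_eq, strict_eq] at hb
  change (okc n (cdK m (n - m)) D (cnK m (h * K1) (n - m)) || _) = true at hb
  rw [Bool.or_eq_true, Bool.or_eq_true, Bool.or_eq_true, Bool.and_eq_true, Bool.and_eq_true] at hb
  change _ ∨ okc _ (cdK m (n - m)) D (cnK m (h * K1) (n - m)) = true ∨
    ((_ ∧ okc _ (cdK m (n - m)) D (cnK m (h * K1) (n - m)) = true) ∨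
     (_ ∧ okc _ (cdK m (n - m)) D (cnK m (h * K1) (n - m)) = true)) at hb
  rw [cnK_eq, cdK_eq] at hb
  have hd := dens_P C.hk C.hkm C.mn C.ht
  have hm0 : 0 < m := by have := C.hkm; have := C.hk; omega
  have hpos := cloneDen_pos (K := n - m) hm0
  have hle := cloneNum_le m h k (n - m)
  have hanti := cloneNum_anti (m := m) (h := h) (K := n - m) h1
  have hhr : h < r := by have := C.hrl; have := C.hl; omega
  have key : ∀ w u, okc w (cloneDen m (n - m)) D (cloneNum m h K1 (n - m)) = true → u ≤ 2 ^ w →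
      min (n.choose k) (r.choose h * (h * (n / r) + min (n % r) h).choose k) ≤ u →
      HasStrongCover (completeEdges n k) r (h + 1) (1 + D * t) := by
    intro w u hok hw hu
    exact cover_base hhr hd hpos hle hu hw
      ((okc_spec hok).trans_le (Nat.mul_le_mul_left _ hanti))
  rcases hb with hb | hb | ⟨hb1, hb⟩ | ⟨hb1, hb⟩
  · exact key _ _ hb le_rfl ((min_le_left _ _).trans (Nat.choose_le_two_pow _ _))
  · refine key _ _ hb le_rfl ((min_le_right _ _).trans ?_)
    change _ ≤ 2 ^ (Nat.log2 (r.choose h) + 1 + _)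
    rw [pow_add]
    exact Nat.mul_le_mul (lt_two_pow_log2 _) (Nat.choose_le_two_pow _ _)
  · exact key _ _ hb (lt_two_pow_log2 _)
      ((min_le_right _ _).trans (Nat.mul_le_mul_left _ (uOK_spec hb1 h0 h1)))
  · exact key _ _ hb (lt_two_pow_log2 _) ((min_le_left _ _).trans (uOK_spec hb1 h0 h1))

noncomputable def iterZ (a b D : ℕ) : ℕ → Bool :=
  Nat.rec (motive := fun _ => ℕ → Bool) (fun u => Nat.ble u 0)
    (fun _ ih u => strict (Nat.div (Nat.mul u (Nat.sub b a)) b) ih) D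

theorem iterZ_spec {a b : ℕ} (D : ℕ) : ∀ u, iterZ a b D u = true →
    ((fun u => u * (b - a) / b)^[D] u) = 0 := by
  induction D with
  | zero => intro u h; exact Nat.le_zero.1 (Nat.le_of_ble_eq_true h)
  | succ D ih =>
    intro u h
    have h' : strict (u * (b - a) / b) (iterZ a b D) = true := h
    rw [strict_eq] at h'
    exact ih _ h'

noncomputable def single (n m M r h cC D k : ℕ) : Bool :=
  strict (chK n k) fun c1 => strict (Nat.mul cC (chK M k)) fun c2 =>
  strict (bif Nat.ble c1 c2 then c1 else c2) fun u => strict (Nat.mul h k) fun hk =>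
    (strict (Nat.sub n m) fun K => strict (cnK m hk K) fun a => strict (cdK m K) fun b =>
      iterZ a b D u) ||
    ((strict (bif Nat.ble k r then r else k) fun x => Nat.ble x n &&
      (strict (Nat.sub n x) fun K => strict (cnK x hk K) fun a =>
        strict (cdK x K) fun b => iterZ a b D u)) ||
     (strict (Nat.sub c1 c2) fun a => iterZ a c1 D u))

theorem single_spec {n k r h l m c t D : ℕ} (C : C4 n k r h l m c t D)
    (hb : single n m (h * (n / r) + min (n % r) h) r h (r.choose h) D k = true) :
    HasStrongCover (completeEdges n k) r (h + 1) (1 + D * t) := by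
  unfold single at hb
  simp only [strict_eq] at hb
  change (iterZ (cnK m (h * k) (n - m)) (cdK m (n - m)) D _ || _) = true at hb
  rw [Bool.or_eq_true, Bool.or_eq_true, Bool.and_eq_true] at hb
  have hm0 : 0 < m := by have := C.hkm; have := C.hk; omega
  have hhr : h < r := by have := C.hrl; have := C.hl; omega
  have hu : min (n.choose k) (r.choose h * (h * (n / r) + min (n % r) h).choose k)
      ≤ (bif Nat.ble (chK n k) (Nat.mul (r.choose h) (chK (h * (n / r) + min (n % r) h) k))
        then chK n k else Nat.mul (r.choose h) (chK (h * (n / r) + min (n % r) h) k)) := by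
    rw [chK_eq, chK_eq]
    cases Nat.ble _ _
    · exact min_le_right _ _
    · exact min_le_left _ _
  rcases hb with hb | ⟨hx, hb⟩ | hb
  · rw [cnK_eq, cdK_eq] at hb
    exact cover_base_iter hhr (dens_P C.hk C.hkm C.mn C.ht) (cloneDen_pos hm0) hu
      (iterZ_spec _ _ hb)
  · have ex : (bif Nat.ble k r then r else k) = max k r := by
      rcases hc : Nat.ble k r with _ | _
      · have : ¬ k ≤ r := fun h => by
          have := Nat.ble_eq_true_of_le h
          rw [hc] at this; cases this
        rw [cond_false, max_eq_left (by omega)]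
      · rw [cond_true, max_eq_right (Nat.le_of_ble_eq_true hc)]
    rw [ex] at hx hb
    change iterZ (cnK (max k r) (h * k) (n - max k r)) (cdK (max k r) (n - max k r)) D _ = true at hb
    rw [cnK_eq, cdK_eq] at hb
    exact cover_base_iter hhr (dens_P2 hhr C.hk (Nat.le_of_ble_eq_true hx) C.ht1)
      (cloneDen_pos (lt_of_lt_of_le (by omega) (le_max_right k r))) hu (iterZ_spec _ _ hb)
  · have hd := Dens.pad (base_dens (n := n) (k := k) hhr) le_rfl C.ht1
    refine cover_base_iter hhr hd (Nat.choose_pos (C.hkm.trans C.mn)) hu ?_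
    apply iterZ_spec
    have e : iterZ (chK n k - r.choose h * chK (h * (n / r) + min (n % r) h) k) (chK n k) D
      (bif Nat.ble (chK n k) (Nat.mul (r.choose h) (chK (h * (n / r) + min (n % r) h) k))
        then chK n k else Nat.mul (r.choose h) (chK (h * (n / r) + min (n % r) h) k)) = true := hb
    generalize (bif Nat.ble (chK n k) (Nat.mul (r.choose h) (chK (h * (n / r) + min (n % r) h) k))
        then chK n k else Nat.mul (r.choose h) (chK (h * (n / r) + min (n % r) h) k)) = U at *
    rwa [chK_eq, chK_eq] at e

noncomputable def bis (n m M r h cC D fuel : ℕ) : ℕ → ℕ → Bool :=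
  Nat.rec (motive := fun _ => ℕ → ℕ → Bool) (fun _ _ => false)
    (fun _ ih K0 K1 => blkOK n m M h cC D K0 K1 ||
      (bif Nat.beq K0 K1 then single n m M r h cC D K0
       else strict (Nat.div (Nat.add K0 K1) 2) fun x => ih K0 x &&
        strict (Nat.succ x) fun y => ih y K1)) fuel

theorem bis_spec {n k r h l m c t D : ℕ} (C : C4 n k r h l m c t D) (fuel : ℕ) :
    ∀ K0 K1, K0 ≤ k → k ≤ K1 →
      bis n m (h * (n / r) + min (n % r) h) r h (r.choose h) D fuel K0 K1 = true →
    HasStrongCover (completeEdges n k) r (h + 1) (1 + D * t) := by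
  induction fuel with
  | zero => intro K0 K1 _ _ h; cases h
  | succ fuel ih =>
    intro K0 K1 h0 h1 hb
    change (blkOK _ _ _ _ _ _ K0 K1 || (bif Nat.beq K0 K1 then
       single n m (h * (n / r) + min (n % r) h) r h (r.choose h) D K0
       else strict (Nat.div (Nat.add K0 K1) 2) fun x => bis _ _ _ _ _ _ _ fuel K0 x &&
        strict (Nat.succ x) fun y => bis _ _ _ _ _ _ _ fuel y K1)) = true at hb
    rw [Bool.or_eq_true] at hb
    rcases hb with hb | hb
    · exact blkOK_spec C h0 h1 hb
    rcases he : Nat.beq K0 K1 with _ | _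
    · rw [he, cond_false, strict_eq, strict_eq, Bool.and_eq_true] at hb
      rcases Nat.lt_or_ge (Nat.div (Nat.add K0 K1) 2) k with h2 | h2
      · exact ih _ _ h2 h1 hb.2
      · exact ih _ _ h0 h2 hb.1
    · rw [he, cond_true] at hb
      have := Nat.eq_of_beq_eq_true he
      have : K0 = k := by omega
      rw [this] at hb
      exact single_spec C hb

noncomputable def checkS (r l h cC D z q s : ℕ) : Bool :=
  strict (Nat.div (Nat.add (Nat.mul h s) (Nat.sub r 1)) r) fun c =>
    (Nat.ble s c || Nat.ble h c) ||
    ((bif Nat.ble l 2 then Nat.ble (Nat.sub (Nat.sub r s) 1) (Nat.mul z q)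
      else Nat.ble h (Nat.add q c)) ||
    (strict (Nat.add (Nat.mul r q) s) fun n => strict (Nat.add (Nat.mul h q) c) fun m =>
      strict (Nat.add (Nat.mul h q) (bif Nat.ble s h then s else h)) fun M =>
        strict (Nat.succ h) fun K0 => bis n m M r h cC D 15 K0 m))

theorem checkS_spec {n k r h l m c t D : ℕ} (C : C4 n k r h l m c t D)
    (hb : checkS r l h (r.choose h) D (Nat.log2 r) (n / r) (n % r) = true) :
    HasStrongCover (completeEdges n k) r (h + 1) (1 + D * t) := by
  unfold checkS at hb
  rw [strict_eq] at hb
  have hr0 : 0 < r := by have := C.hrl; have := C.hl; omega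
  have ec : Nat.div (Nat.add (Nat.mul h (n % r)) (Nat.sub r 1)) r = c := by
    change (h * (n % r) + (r - 1)) / r = c
    have h1 := C.hc1
    have h2 := C.hc2
    have : h * (n % r) + (r - 1) = r * c + (h * (n % r) + (r - 1) - r * c) := by omega
    rw [this, Nat.mul_add_div hr0, Nat.div_eq_of_lt (by omega)]
    rfl
  rw [ec, Bool.or_eq_true, Bool.or_eq_true, Bool.or_eq_true, strict_eq, strict_eq, strict_eq,
    strict_eq] at hb
  rcases hb with (hb | hb) | hb | hb
  · have := Nat.le_of_ble_eq_true hb; have := C.hcs; omega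
  · have := Nat.le_of_ble_eq_true hb; have := C.hch; omega
  · have hl := C.hl
    rcases he : Nat.ble l 2 with _ | _
    · rw [he, cond_false] at hb
      have h1 : h ≤ n / r + c := Nat.le_of_ble_eq_true hb
      have h3 : 3 ≤ l := by
        by_contra h3
        have := Nat.ble_eq_true_of_le (show l ≤ 2 by omega)
        rw [he] at this; cases this
      have := C.hres3 h3
      omega
    · rw [he, cond_true] at hb
      have h1 : r - n % r - 1 ≤ Nat.log2 r * (n / r) := Nat.le_of_ble_eq_true hb
      have := Nat.le_of_ble_eq_true he
      have := C.hres2 (by omega)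
      rw [Nat.log2_eq_log_two] at h1
      omega
  · have e1 : Nat.add (Nat.mul r (n / r)) (n % r) = n := Nat.div_add_mod n r
    have e2 : Nat.add (Nat.mul h (n / r)) c = m := C.hm.symm
    have e3 : (bif Nat.ble (n % r) h then n % r else h) = min (n % r) h := by
      rcases hc : Nat.ble (n % r) h with _ | _
      · have : ¬ n % r ≤ h := fun h => by
          have := Nat.ble_eq_true_of_le h
          rw [hc] at this; cases this
        rw [cond_false, min_eq_right (by omega)]
      · rw [cond_true, min_eq_left (Nat.le_of_ble_eq_true hc)]
    rw [e1, e2, e3] at hb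
    exact bis_spec C 15 _ _ C.hk C.hkm hb

noncomputable def loopS (r l h cC D z q : ℕ) : Bool :=
  strict (Nat.div (Nat.add r (Nat.sub l 1)) l) fun s0 =>
    strict (Nat.sub r s0) fun N =>
      allBelow (fun i => strict (Nat.add s0 i) fun s => checkS r l h cC D z q s) N

theorem loopS_spec {n k r h l m c t D : ℕ} (C : C4 n k r h l m c t D)
    (hb : loopS r l h (r.choose h) D (Nat.log2 r) (n / r) = true) :
    HasStrongCover (completeEdges n k) r (h + 1) (1 + D * t) := by
  unfold loopS at hb
  rw [strict_eq, strict_eq] at hb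
  have hl := C.hl
  have hls := C.ls
  have hsr := C.sr
  have h1 : (r + (l - 1)) / l ≤ n % r := by
    have : (r + (l - 1)) / l < n % r + 1 := by
      rw [Nat.div_lt_iff_lt_mul (by omega), add_mul, mul_comm (n % r)]
      omega
    omega
  have := allBelow_spec hb (n % r - (r + (l - 1)) / l)
    (by change _ < r - (r + (l - 1)) / l; omega)
  rw [strict_eq] at this
  refine checkS_spec C ?_
  have e : Nat.add (Nat.div (Nat.add r (Nat.sub l 1)) l) (n % r - (r + (l - 1)) / l) = n % r :=
    Nat.add_sub_cancel' h1
  rwa [e] at this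

noncomputable def checkQ1 (r l h cC D z : ℕ) : Bool :=
  (Nat.beq D cC && checkF r l) || loopS r l h cC D z 1

noncomputable def checkQ2 (r l h cC D z q : ℕ) : Bool :=
  (bif Nat.ble l 2 then Nat.ble r (Nat.mul 2 (Nat.mul z q))
    else Nat.ble (Nat.mul h (Nat.sub l 1)) (Nat.mul l q)) ||
  ((strict (Nat.mul q l) fun e =>
      okc (Nat.mul (Nat.succ q) r) (Nat.pow q e) D (Nat.pow (Nat.sub q 1) e)) ||
    loopS r l h cC D z q)

noncomputable def checkQ (r l h cC D z : ℕ) : Bool :=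
  checkQ1 r l h cC D z &&
  (okc (Nat.mul r h) (Nat.pow 4 l) D 1 ||
    allBelow (fun i => strict (Nat.add 2 i) fun q => checkQ2 r l h cC D z q) h)

theorem checkQ_spec {n k r h l m c t D : ℕ} (C : C4 n k r h l m c t D)
    (hb : checkQ r l h (r.choose h) D (Nat.log2 r) = true) :
    HasStrongCover (completeEdges n k) r (h + 1) (1 + D * t) := by
  unfold checkQ at hb
  rw [Bool.and_eq_true, Bool.or_eq_true] at hb
  have hrl := C.hrl
  have hl := C.hl
  have hh := C.hh
  have hls := C.ls
  rcases Nat.lt_or_ge (n / r) 2 with hq | hq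
  · have hq1 : n / r = 1 := by have := C.hq; omega
    have h1 := hb.1
    unfold checkQ1 at h1
    rw [Bool.or_eq_true, Bool.and_eq_true] at h1
    rcases h1 with ⟨h1, h2⟩ | h1
    · have hD : D = r.choose h := Nat.eq_of_beq_eq_true h1
      have hy1 : 1 ≤ r / l := (Nat.le_div_iff_mul_le (by omega)).2 (by omega)
      have hly : l * (r / l) ≤ r := Nat.mul_div_le r l
      refine C.cover_F hq1 hy1 hly ?_
      rw [hD]
      exact F_crit hrl (by omega) hy1 hly (checkF_spec h2 _ rfl)
    · rw [← hq1] at h1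
      exact loopS_spec C h1
  · rcases hb.2 with h1 | h1
    · refine C.cover_X (q0 := 2) (w := r * h) le_rfl hq C.nrh ?_
      have := okc_spec h1
      rw [pow_mul]
      simpa using this
    · have hqh : n / r ≤ h := by
        rw [Nat.div_le_iff_le_mul_add_pred (by omega)]
        have := C.nrh
        omega
      have h2 := allBelow_spec h1 (n / r - 2) (by omega)
      rw [strict_eq] at h2
      have e : Nat.add 2 (n / r - 2) = n / r := Nat.add_sub_cancel' hq
      rw [e] at h2
      unfold checkQ2 at h2
      rw [Bool.or_eq_true, Bool.or_eq_true, strict_eq] at h2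
      rcases h2 with h2 | h2 | h2
      · exfalso
        rcases he : Nat.ble l 2 with _ | _
        · rw [he, cond_false] at h2
          have h3 : h * (l - 1) ≤ l * (n / r) := Nat.le_of_ble_eq_true h2
          have h4 : 3 ≤ l := by
            by_contra h3
            have := Nat.ble_eq_true_of_le (show l ≤ 2 by omega)
            rw [he] at this; cases this
          have h5 := C.hres3 h4
          have h6 : h ≤ l * c := by
            have : h * r ≤ l * c * r := by
              calc h * r ≤ h * (l * (n % r)) := Nat.mul_le_mul_left _ hls
                _ = l * (h * (n % r)) := by ring
                _ ≤ l * (r * c) := Nat.mul_le_mul_left _ C.hc1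
                _ = _ := by ring
            exact Nat.le_of_mul_le_mul_right this (by omega)
          have h7 : l * (n / r + c + 1) ≤ l * h := Nat.mul_le_mul_left _ h5
          have h8 : h * (l - 1) + h = l * h := by
            obtain ⟨x, rfl⟩ := Nat.exists_eq_add_of_le' (show 1 ≤ l by omega)
            rw [Nat.add_sub_cancel]; ring
          rw [mul_add, mul_add] at h7
          omega
        · rw [he, cond_true] at h2
          have h3 : r ≤ 2 * (Nat.log2 r * (n / r)) := Nat.le_of_ble_eq_true h2
          have h4 : l = 2 := by have := Nat.le_of_ble_eq_true he; omega
          have h5 := C.hres2 h4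
          rw [Nat.log2_eq_log_two] at h3
          subst h4
          omega
      · exact C.cover_X (q0 := n / r) hq le_rfl C.nlt.le (okc_spec h2)
      · exact loopS_spec C h2

noncomputable def checkT0 (r h cC D d f : ℕ) : Bool :=
  strict (Nat.succ h) fun p =>
    okc (Nat.succ (Nat.log2 (Nat.div (Nat.pow (Nat.mul r h) p) f))) (Nat.pow r p) D d

noncomputable def checkPair (r h cC d f : ℕ) : Bool :=
  strict (Nat.div r h) fun x => strict (Nat.div (Nat.sub (Nat.add cC x) 1) x) fun D =>
    checkT0 r h cC D d f ||
    (strict (Nat.sub r h) fun l => strict (Nat.log2 r) fun z => checkQ r l h cC D z)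

theorem checkPair_spec {n k r h l m c t D : ℕ} (C : C4 n k r h l m c t D)
    (hb : checkPair r h (r.choose h) (r.descFactorial (h + 1)) (h + 1).factorial = true) :
    HasStrongCover (completeEdges n k) r (h + 1) (1 + D * t) := by
  have hrl := C.hrl
  have hl := C.hl
  unfold checkPair at hb
  rw [strict_eq, strict_eq, strict_eq, strict_eq, Bool.or_eq_true] at hb
  have eD : Nat.div (Nat.sub (Nat.add (r.choose h) (Nat.div r h)) 1) (Nat.div r h) = D :=
    C.hDe.symm
  have el : Nat.sub r h = l := by change r - h = l; omega
  rw [eD, el] at hb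
  rcases hb with hb | hb
  · unfold checkT0 at hb
    rw [strict_eq] at hb
    have hx := okc_spec hb
    refine cover_T0 (n0 := r * h) (by omega) C.hk C.nrh ?_ C.ht1 ?_ hx
    · have : h * 5 ≤ h * r := Nat.mul_le_mul_left _ (by have := C.hh; omega)
      rw [mul_comm]
      have := C.hh
      omega
    · refine le_trans ?_ (lt_two_pow_log2 _)
      change _ ≤ (r * h) ^ (h + 1) / (h + 1).factorial
      rw [Nat.le_div_iff_mul_le (Nat.factorial_pos _), mul_comm,
        ← Nat.descFactorial_eq_factorial_mul_choose]
      exact Nat.descFactorial_le_pow _ _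
  · exact checkQ_spec C hb

noncomputable def loopH (r fuel : ℕ) : ℕ → ℕ → ℕ → ℕ → Bool :=
  Nat.rec (motive := fun _ => ℕ → ℕ → ℕ → ℕ → Bool) (fun _ _ _ _ => true)
    (fun _ ih h c d f => (Nat.ble h 2 || checkPair r h c d f) &&
      strict (Nat.succ h) fun h' =>
      strict (Nat.div (Nat.mul c (Nat.sub r h)) h') fun c' =>
      strict (Nat.mul (Nat.sub r h') d) fun d' =>
      strict (Nat.mul (Nat.succ h') f) fun f' => ih h' c' d' f') fuel

theorem loopH_spec {r : ℕ} (fuel : ℕ) : ∀ i : ℕ,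
    loopH r fuel i (r.choose i) (r.descFactorial (i + 1)) (i + 1).factorial = true →
    ∀ h, 3 ≤ h → i ≤ h → h < i + fuel →
      checkPair r h (r.choose h) (r.descFactorial (h + 1)) (h + 1).factorial = true := by
  induction fuel with
  | zero => intro i _ h _ h1 h2; omega
  | succ fuel ih =>
    intro i hl h h3 h1 h2
    change ((Nat.ble i 2 || checkPair r i _ _ _) &&
      strict (Nat.succ i) fun h' =>
      strict (Nat.div (Nat.mul (r.choose i) (Nat.sub r i)) h') fun c' =>
      strict (Nat.mul (Nat.sub r h') (r.descFactorial (i + 1))) fun d' =>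
      strict (Nat.mul (Nat.succ h') (i + 1).factorial) fun f' => loopH r fuel h' c' d' f') = true
      at hl
    rw [Bool.and_eq_true, Bool.or_eq_true, strict_eq, strict_eq, strict_eq, strict_eq] at hl
    rcases Nat.eq_or_lt_of_le h1 with h4 | h4
    · subst h4
      rcases hl.1 with h6 | h6
      · have := Nat.le_of_ble_eq_true h6; omega
      · exact h6
    · have e1 : Nat.div (Nat.mul (r.choose i) (Nat.sub r i)) (Nat.succ i) = r.choose (i + 1) :=
        choose_step r i
      have e2 : Nat.mul (Nat.sub r (Nat.succ i)) (r.descFactorial (i + 1))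
        = r.descFactorial (i + 1 + 1) := (Nat.descFactorial_succ r (i + 1)).symm
      have e3 : Nat.mul (Nat.succ (Nat.succ i)) (i + 1).factorial = (i + 1 + 1).factorial :=
        (Nat.factorial_succ (i + 1)).symm
      have := hl.2
      rw [e1, e2, e3] at this
      exact ih (i + 1) this h h3 h4 (by omega)

noncomputable def checkR (r : ℕ) : Bool := strict (Nat.sub r 1) fun N => loopH r N 0 1 r 1

set_option maxRecDepth 100000 in
theorem checkR_a : allBelow (fun i => strict (0 + i) checkR) 40 = true := by
  decide +kernel

set_option maxRecDepth 100000 in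
theorem checkR_b : allBelow (fun i => strict (40 + i) checkR) 20 = true := by
  decide +kernel

set_option maxRecDepth 100000 in
theorem checkR_c : allBelow (fun i => strict (60 + i) checkR) 15 = true := by
  decide +kernel

set_option maxRecDepth 100000 in
theorem checkR_d : allBelow (fun i => strict (75 + i) checkR) 13 = true := by
  decide +kernel

set_option maxRecDepth 100000 in
theorem checkR_e : allBelow (fun i => strict (88 + i) checkR) 12 = true := by
  decide +kernel

set_option maxRecDepth 100000 in
theorem checkR_f : allBelow (fun i => strict (100 + i) checkR) 10 = true := by
  decide +kernel

set_option maxRecDepth 100000 in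
theorem checkR_g : allBelow (fun i => strict (110 + i) checkR) 10 = true := by
  decide +kernel

set_option maxRecDepth 100000 in
theorem checkR_h : allBelow (fun i => strict (120 + i) checkR) 8 = true := by
  decide +kernel

theorem checkR_all {r : ℕ} (h1 : 0 ≤ r) (h2 : r < 128) : checkR r = true := by
  rcases Nat.lt_or_ge r 40 with h | h
  · have hc := allBelow_spec checkR_a (r - 0) (by omega)
    rwa [strict_eq, Nat.add_sub_cancel' (by omega)] at hc
  rcases Nat.lt_or_ge r 60 with h | h
  · have hc := allBelow_spec checkR_b (r - 40) (by omega)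
    rwa [strict_eq, Nat.add_sub_cancel' (by omega)] at hc
  rcases Nat.lt_or_ge r 75 with h | h
  · have hc := allBelow_spec checkR_c (r - 60) (by omega)
    rwa [strict_eq, Nat.add_sub_cancel' (by omega)] at hc
  rcases Nat.lt_or_ge r 88 with h | h
  · have hc := allBelow_spec checkR_d (r - 75) (by omega)
    rwa [strict_eq, Nat.add_sub_cancel' (by omega)] at hc
  rcases Nat.lt_or_ge r 100 with h | h
  · have hc := allBelow_spec checkR_e (r - 88) (by omega)
    rwa [strict_eq, Nat.add_sub_cancel' (by omega)] at hc
  rcases Nat.lt_or_ge r 110 with h | h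
  · have hc := allBelow_spec checkR_f (r - 100) (by omega)
    rwa [strict_eq, Nat.add_sub_cancel' (by omega)] at hc
  rcases Nat.lt_or_ge r 120 with h | h
  · have hc := allBelow_spec checkR_g (r - 110) (by omega)
    rwa [strict_eq, Nat.add_sub_cancel' (by omega)] at hc
  · have hc := allBelow_spec checkR_h (r - 120) (by omega)
    rwa [strict_eq, Nat.add_sub_cancel' (by omega)] at hc

theorem C4.small {n k r h l m c t D : ℕ} (C : C4 n k r h l m c t D) (h1 : r < 128) :
    HasStrongCover (completeEdges n k) r (h + 1) (1 + D * t) := by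
  have hc := checkR_all (Nat.zero_le r) h1
  unfold checkR at hc
  rw [strict_eq] at hc
  have hrl := C.hrl
  have hl := C.hl
  refine checkPair_spec C (loopH_spec (r - 1) 0 (by simpa using hc) h C.hh (by omega) (by omega))

theorem C4.all {n k r h l m c t D : ℕ} (C : C4 n k r h l m c t D) :
    HasStrongCover (completeEdges n k) r (h + 1) (1 + D * t) := by
  rcases Nat.lt_or_ge r 128 with h1 | h1
  · exact C.small h1
  rcases Nat.lt_or_ge r 512 with h2 | h2
  · exact C.mid h1 h2
  · exact C.large512 h2
theorem not_nice {n k r h m D t : ℕ} (hh1 : 1 ≤ h) (hhr : h < r) (hk : h + 1 ≤ k)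
    (hnr : r < n) (hm : m = (h * n) ⌈/⌉ r) (hkm : k ≤ m) (hD : D = (r.choose h) ⌈/⌉ (r / h))
    (ht : HasStrongCover (completeEdges m k) r (h + 1) t)
    (hn : m < h * (n / r) + min (n % r) h) :
    HasStrongCover (completeEdges n k) r (h + 1) (1 + D * t) := by
  have hr0 : 0 < r := by omega
  have hx0 : 0 < r / h := Nat.div_pos hhr.le hh1
  have hDge := choose_le_D hh1 hhr.le hD
  have ht1 := cover_pos hkm ht
  have hsr : n % r < r := Nat.mod_lt _ hr0
  have hq : 1 ≤ n / r := Nat.div_pos hnr.le hr0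
  have en := Nat.div_add_mod n r
  have hm' : m = (h * n + r - 1) / r := by rw [hm, Nat.ceilDiv_eq_add_pred_div]
  have hDe : D = (r.choose h + r / h - 1) / (r / h) := by rw [hD, Nat.ceilDiv_eq_add_pred_div]
  have e1 : h * n = r * (h * (n / r)) + h * (n % r) := by
    calc h * n = h * (r * (n / r) + n % r) := by rw [en]
      _ = _ := by ring
  obtain ⟨c, hmc, hc1, hc2⟩ : ∃ c, m = h * (n / r) + c ∧ h * (n % r) ≤ r * c ∧
      r * c < h * (n % r) + r := by
    refine ⟨(h * (n % r) + (r - 1)) / r, ?_, ?_, ?_⟩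
    · rw [hm', e1, ← Nat.mul_add_div hr0]
      congr 1; omega
    · have h1 := Nat.div_add_mod (h * (n % r) + (r - 1)) r
      have h2 := Nat.mod_lt (h * (n % r) + (r - 1)) hr0
      omega
    · have h1 := Nat.mul_div_le (h * (n % r) + (r - 1)) r
      omega
  have hcmin : c < min (n % r) h := by omega
  have hcs : c < n % r := hcmin.trans_le (min_le_left _ _)
  have hch : c < h := hcmin.trans_le (min_le_right _ _)
  have hc0 : 1 ≤ c := by
    by_contra h0
    have h0 : c = 0 := by omega
    rw [h0, mul_zero] at hc1
    have : 0 < h * (n % r) := Nat.mul_pos hh1 (by omega)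
    omega
  obtain ⟨l, hrl⟩ := Nat.exists_eq_add_of_le hhr.le
  obtain ⟨σ, hσ⟩ := Nat.exists_eq_add_of_le hcs.le
  have hσl : σ < l := by
    have h1 : r * (c + σ) = h * (n % r) + l * (n % r) := by rw [← hσ, ← add_mul, ← hrl]
    have h2 : l * (n % r) < l * r := Nat.mul_lt_mul_of_pos_left hsr (by omega)
    rw [mul_add] at h1
    have h3 : r * σ < r * l := by rw [mul_comm r l]; omega
    exact Nat.lt_of_mul_lt_mul_left h3
  rcases Nat.lt_or_ge h 3 with h3 | h3
  · have h2 : h = 2 := by omega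
    subst h2
    have hc : c = 1 := by omega
    subst hc
    exact case_h2 hk hkm (by omega) (by omega) hq hmc hD ht
  rcases Nat.lt_or_ge l 3 with hl | hl
  · have hl2 : l = 2 := by omega
    subst hl2
    by_cases hz : r - n % r - 1 ≤ Nat.log 2 r * (n / r)
    · have hh : h = r - 2 := by omega
      have hD2 : D = r.choose 2 := by
        have hrh : r / h = 1 := by
          rw [hrl, Nat.add_div_left _ (by omega), Nat.div_eq_of_lt (by omega)]
        rw [hDe, hrh]
        have : r.choose h = r.choose 2 := by rw [hrl]; exact Nat.choose_symm_add
        simp [this]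
      have e : h + 1 = r - 1 := by omega
      rw [e] at ht ⊢
      refine case_l2 (z := Nat.log 2 r) (by omega) (by omega) hkm ?_ (by omega) hq ?_
        (Nat.pow_log_le_self 2 (by omega)) hz hD2 ht
      · have h1 : r * (c + 1) = h * (n % r) + 2 * (n % r) := by
          rw [← add_mul, ← hrl, hσ]; congr 2; omega
        rw [mul_add] at h1
        omega
      · rw [hmc, hh]; omega
    · exact C4.all (c := c) (l := 2) ⟨hrl, h3, le_rfl, hk, hkm, hq, hmc, hc1,
        hc2, hcs, hch, ht, ht1, hDge, hDe, fun _ => by omega, fun _ => by omega⟩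
  · by_cases hz : h - c ≤ n / r
    · have := case3 hrl h3 hk hkm hσ (by omega) hσl hc0 hch hz hmc (by
        intro h1
        subst h1
        rw [hσ, mul_add] at hc1
        have : 3 * σ ≤ h * σ := Nat.mul_le_mul_right _ h3
        omega) ht
      exact this.mono (by omega) (Nat.add_le_add_left (Nat.mul_le_mul_right _ hDge) 1)
    · exact C4.all (c := c) (l := l) ⟨hrl, h3, (by omega), hk, hkm, hq, hmc, hc1,
        hc2, hcs, hch, ht, ht1, hDge, hDe, fun _ => by omega, fun _ => by omega⟩
theorem stmt11 (n k r p m D : ℕ) (hp2 : 2 ≤ p) (hpr : p ≤ r) (hpk : p ≤ k)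
    (hm : m = ((p - 1) * n) ⌈/⌉ r) (hkm : k ≤ m)
    (hD : D = (r.choose (p - 1)) ⌈/⌉ (r / (p - 1))) :
    coverNumber (completeEdges n k) r p ≤ D * coverNumber (completeEdges m k) r p + 1 := by
  by_cases hnr : n ≤ r
  · exact (coverNumber_le (hasStrongCover_one_of_le hnr hpk)).trans (by omega)
  have hC := hasStrongCover_coverNumber (m := m) hpr hpk (by omega)
  have hDge := choose_le_D (by omega) (by omega) hD
  by_cases hnice : (p - 1) * (n / r) + min (n % r) (p - 1) ≤ m
  · have hp1 : p - 1 + 1 = p := by omega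
    have h1 := nice_case (n := n) (k := k) (r := r) (h := p - 1) (m := m) (by omega) (by omega)
      (by omega) hnice (by rw [hp1]; exact hC)
    rw [hp1] at h1
    refine (coverNumber_le h1).trans ?_
    rw [add_comm]
    exact Nat.add_le_add_right (Nat.mul_le_mul_right _ hDge) 1
  · have hp1 : p - 1 + 1 = p := by omega
    have h1 := not_nice (n := n) (k := k) (r := r) (h := p - 1) (m := m) (D := D) (by omega) (by omega)
      (by omega) (by omega) hm hkm hD (by rw [hp1]; exact hC) (by omega)
    rw [hp1] at h1
    refine (coverNumber_le h1).trans ?_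
    omega
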